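/- Suppose d ∈ {1, 2} and α = d/3. Then the critical cluster-size tail is mean-field to within a polylogarithmic factor: there is a constant C₁ < ∞ (depending only on d, α, c, C) such that C₁^{−1} (log n)^{−2} n^{−1/2} ≤ ℙ_{β_c}(|K| ≥ n) ≤ C₁ (log n)^{2} n^{−1/2} for every n ≥ 2. -/

import Mathlib

open MeasureTheory ENNReal

namespace LRP

/-- The vertex set `ℤ^d`. -/
abbrev V (d : ℕ) : Type := Fin d → ℤ

/-- The `ℓ^∞` norm of a lattice point, as a natural number. -/
def normInf {d : ℕ} (x : V d) : ℕ := Finset.univ.sup fun i => (x i).natAbs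

/-- A percolation configuration: each (unordered) pair of vertices is open or closed. -/
abbrev Config (d : ℕ) : Type := Sym2 (V d) → Bool

/-- The probability `1 - exp (-β J(x,y))` that the edge `e = {x,y}` is open
(the symmetrization `(J x y + J y x)/2` equals `J x y` for symmetric `J`). -/
noncomputable def edgeProb {d : ℕ} (J : V d → V d → ℝ) (β : ℝ) (e : Sym2 (V d)) : ℝ≥0∞ :=
  ENNReal.ofReal (1 - Real.exp (-β *
    Sym2.lift ⟨fun x y => (J x y + J y x) / 2, fun x y => by dsimp only; rw [add_comm]⟩ e))

/-- `IsLRP J P` asserts that for each `β`, `P β` is the law of long-range percolation on `ℤ^d`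
with kernel `J` at inverse temperature `β`: distinct edges are open independently, edge `{x,y}`
being open with probability `1 - exp (-β J(x,y))`.  This is expressed by prescribing the
probability of every finite cylinder event, which characterizes the measure uniquely. -/
def IsLRP {d : ℕ} (J : V d → V d → ℝ) (P : ℝ → Measure (Config d)) : Prop :=
  ∀ (β : ℝ) (s : Finset (Sym2 (V d))) (f : Sym2 (V d) → Bool),
    P β {ω | ∀ e ∈ s, ω e = f e} =
      ∏ e ∈ s, (if f e then edgeProb J β e else 1 - edgeProb J β e)

/-- Two vertices are adjacent if they are distinct and the edge between them is open. -/
def adj {d : ℕ} (ω : Config d) (x y : V d) : Prop := x ≠ y ∧ ω s(x, y) = true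

/-- `x ↔ y`: the vertices are connected by a path of open edges. -/
def conn {d : ℕ} (ω : Config d) (x y : V d) : Prop := Relation.ReflTransGen (adj ω) x y

/-- `x ↔ y` inside `A`: connected by an open path all of whose vertices lie in `A`. -/
def connIn {d : ℕ} (ω : Config d) (A : Set (V d)) (x y : V d) : Prop :=
  x ∈ A ∧ y ∈ A ∧ Relation.ReflTransGen (fun a b => a ∈ A ∧ b ∈ A ∧ adj ω a b) x y

/-- The cluster of `x`. -/
def cluster {d : ℕ} (ω : Config d) (x : V d) : Set (V d) := {y | conn ω x y}

/-- The critical point `β_c`. -/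
noncomputable def betaC {d : ℕ} (P : ℝ → Measure (Config d)) : ℝ :=
  sInf {β : ℝ | 0 ≤ β ∧ 0 < P β {ω | ∃ x, (cluster ω x).Infinite}}

/-- The two-point function `ℙ_β(x ↔ y)`. -/
noncomputable def twoPoint {d : ℕ} (P : ℝ → Measure (Config d)) (β : ℝ) (x y : V d) : ℝ≥0∞ :=
  P β {ω | conn ω x y}

/-- The susceptibility `χ(β) = Σ_x ℙ_β(0 ↔ x)`. -/
noncomputable def chi {d : ℕ} (P : ℝ → Measure (Config d)) (β : ℝ) : ℝ≥0∞ :=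
  ∑' x : V d, twoPoint P β 0 x

/-- `Σ_{x ∈ [-n,n]^d} ℙ_β(0 ↔ x)`. -/
noncomputable def boxSum {d : ℕ} (P : ℝ → Measure (Config d)) (β : ℝ) (n : ℕ) : ℝ≥0∞ :=
  ∑' x : V d, if normInf x ≤ n then twoPoint P β 0 x else 0

/-- The correlation length `ξ(β) = inf {r ≥ 1 : Σ_{x ∈ [-r,r]^d} ℙ_β(0↔x) ≥ χ(β)/2}`
(`= ∞` if no such `r` exists). -/
noncomputable def xi {d : ℕ} (P : ℝ → Measure (Config d)) (β : ℝ) : ℝ≥0∞ :=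
  sInf {r : ℝ≥0∞ | ∃ n : ℕ, r = (n : ℝ≥0∞) ∧ 1 ≤ n ∧ chi P β ≤ 2 * boxSum P β n}

/-- The triangle diagram `∇_β`. -/
noncomputable def triangle {d : ℕ} (P : ℝ → Measure (Config d)) (β : ℝ) : ℝ≥0∞ :=
  ∑' x : V d, ∑' y : V d, twoPoint P β 0 x * twoPoint P β x y * twoPoint P β y 0

/-- The standing assumptions on the kernel `J`: symmetric, integrable, translation-invariant,
with `c ‖x-y‖^{-d-α} ≤ J(x,y) ≤ C ‖x-y‖^{-d-α}` for distinct `x, y`, where `0 < α < d`. -/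
structure KernelHyp (d : ℕ) (J : V d → V d → ℝ) (α c C : ℝ) : Prop where
  d_pos : 1 ≤ d
  symm : ∀ x y, J x y = J y x
  transInv : ∀ x y z : V d, J (x + z) (y + z) = J x y
  nonneg : ∀ x y, 0 ≤ J x y
  integrable : Summable fun x : V d => J 0 x
  alpha_pos : 0 < α
  alpha_lt_d : α < (d : ℝ)
  c_pos : 0 < c
  c_le_C : c ≤ C
  lower : ∀ x y : V d, x ≠ y → c * (normInf (x - y) : ℝ) ^ (-(d : ℝ) - α) ≤ J x y
  upper : ∀ x y : V d, x ≠ y → J x y ≤ C * (normInf (x - y) : ℝ) ^ (-(d : ℝ) - α)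

set_option linter.unusedSectionVars false
set_option linter.unusedVariables false
local notation "oR" => ENNReal.ofReal
local notation "py" => (by positivity)
local notation "ly" => (by linarith)
local notation "sy" => (by simp)
local notation "ny" => (by norm_num)
local notation "oy" => (by omega)
local notation "mnl" => mul_le_mul_of_nonneg_left
local notation "mnr" => mul_le_mul_of_nonneg_right
local notation "Sw" W => Set (Sym2 W)
open ENNReal renaming ofReal_mul → Qa, tsum_le_tsum → Qd, ofReal_le_ofReal → Qe, tsum_mul_left → Qg, tsum_comm → Qh, tsum_mul_right → Qn, ofReal_add → Qo, tsum_add → Qr, ofReal_natCast → Qw, ofReal_toReal → QA, summable → QF, toReal_nonneg → QK, ofReal_one → QP, toReal_mono → QS, ofReal_sub → Zk, ofReal_le_ofReal_iff → Zn, ofReal_pow → Zr, ofReal_sum_of_nonneg → Zy, natCast_ne_top → ZN, toReal_mul → ZO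
open Real renaming log → Qb, exp → Qc, rpow_add → Qk, mul_rpow → Qp, exp_pos → Qq, rpow_le_rpow_of_nonpos → Qt, rpow_neg → Qu, rpow_natCast → Qx, log_nonneg → Qz, exp_le_exp → QJ, rpow_mul → QM, rpow_le_one_of_one_le_of_nonpos → QT, sqrt_pos → QU, exp_add → Za, rpow_lt_one_of_one_lt_of_neg → Zd, div_rpow → Ze, sqrt → Zs, sq_sqrt → Zt, add_one_le_exp → ZC, rpow_nonneg → ZJ, rpow_pos_of_pos → ZM, sqrt_nonneg → ZP, rpow_pow_comm → ZQ, log_le_log → ZR, mul_self_sqrt → ZS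
open Finset renaming mem_filter → Qf, sum_congr → Qi, sum_le_sum → Qj, Icc → Qm, range → Qs, mul_sum → Qv, card_le_card → QB, sum_const → QG, mem_powerset → QH, mem_Icc → QI, sum_le_sum_of_subset → QL, sum_le_card_nsmul → QR, sum_filter → QV, prod_congr → QW, union_subset_iff → QY, measurable_sum → Zb, disjoint_left → Zf, mem_union → Zg, coe_insert → Zh, sum_nonneg → Zl, mem_image → Zm, card_nsmul_le_sum → Zo, induction_on → Zu, prod_nonneg → Zv, subset_insert → Zw, filter_subset → Zx, Ico → ZE, sum_ite → ZF, sum_const_zero → ZG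
open Set renaming mem_ofPred_eq → Ql, mem_iUnion → Qy, indicator_of_mem → QC, indicator_of_notMem → QD, subset_univ → QO, inter_subset_left → QZ, sdiff_subset_sdiff_right → Zj, indicator_apply → Zp, insert_subset_iff → ZA, sdiff_subset → ZB, mem_compl_iff → ZD, encard_le_encard → ZT
open Summable renaming tsum_finsetSum → QE
open Sym2 renaming eq_swap → QN, eq_iff → Zi
open Filter renaming Tendsto → QX, atTop → Zz
open Nat renaming pow_le_pow_right → Zc, cast_le → Zq, mul_le_mul_right → ZH, one_le_pow → ZI, cast_nonneg → ZK, mul_pos → ZL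
section T1
open Classical in
noncomputable def ind (Q : Prop) : ℝ := if Q then 1 else 0
lemma ind_t {Q : Prop} (h : Q) : ind Q = 1 := if_pos h
lemma ind_f {Q : Prop} (h : ¬ Q) : ind Q = 0 := if_neg h
lemma ind_nn (Q : Prop) : 0 ≤ ind Q := by unfold ind; split_ifs <;> norm_num
lemma ind_le1 (Q : Prop) : ind Q ≤ 1 := by unfold ind; split_ifs <;> norm_num
lemma ind_mono {Q R : Prop} (h : Q → R) : ind Q ≤ ind R := by
  by_cases hQ : Q
  · rw [ind_t hQ, ind_t (h hQ)]
  · rw [ind_f hQ]; exact ind_nn R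
variable {ι : Type*} [DecidableEq ι]
noncomputable def ex (p : ι → ℝ) (E : Finset ι) (g : Finset ι → ℝ) : ℝ :=
  ∑ T ∈ E.powerset, (∏ e ∈ T, p e) * (∏ e ∈ E \ T, (1 - p e)) * g T
lemma ex_empty (p : ι → ℝ) (g : Finset ι → ℝ) : ex p ∅ g = g ∅ := by simp [ex]
lemma ex_insert (p : ι → ℝ) {E : Finset ι} {e : ι} (he : e ∉ E) (g : Finset ι → ℝ) :
    ex p (insert e E) g = (1 - p e) * ex p E g + p e * ex p E (fun T => g (insert e T)) := by
  unfold ex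
  rw [Finset.sum_powerset_insert he, Qv, Qv]
  congr 1 <;> refine Qi rfl fun T hT => ?_
  · have hT' := QH.1 hT
    rw [Finset.insert_sdiff_of_notMem _ (fun h => he (hT' h)),
      Finset.prod_insert (by simp [he])]; ring
  · have hT' := QH.1 hT
    have h : e ∉ T := fun h => he (hT' h)
    rw [Finset.prod_insert h, Finset.insert_sdiff_insert, Finset.sdiff_insert_of_notMem he]; ring
lemma ex_add (p : ι → ℝ) (E : Finset ι) (g h : Finset ι → ℝ) :
    ex p E (fun T => g T + h T) = ex p E g + ex p E h := by
  simp [ex, mul_add, Finset.sum_add_distrib]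
lemma ex_mul (p : ι → ℝ) (E : Finset ι) (c : ℝ) (g : Finset ι → ℝ) :
    ex p E (fun T => c * g T) = c * ex p E g := by
  simp only [ex, Qv]; exact Qi rfl fun _ _ => by ring
lemma ex_const (p : ι → ℝ) (E : Finset ι) (c : ℝ) : ex p E (fun _ => c) = c := by
  induction E using Zu with
  | empty => exact ex_empty _ _
  | insert e E he ih => rw [ex_insert p he, ih]; ring
lemma ex_congr {p : ι → ℝ} {E : Finset ι} {g h : Finset ι → ℝ} (H : ∀ T ⊆ E, g T = h T) :
    ex p E g = ex p E h :=
  Qi rfl fun T hT => by rw [H T (QH.1 hT)]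
lemma ex_mono {p : ι → ℝ} (hp : ∀ e, 0 ≤ p e ∧ p e ≤ 1) {E : Finset ι} {g h : Finset ι → ℝ}
    (H : ∀ T ⊆ E, g T ≤ h T) : ex p E g ≤ ex p E h := by
  refine Qj fun T hT => mnl (H T (QH.1 hT)) ?_
  exact mul_nonneg (Zv fun e _ => (hp e).1)
    (Zv fun e _ => sub_nonneg.2 (hp e).2)
lemma ex_nn {p : ι → ℝ} (hp : ∀ e, 0 ≤ p e ∧ p e ≤ 1) {E : Finset ι} {g : Finset ι → ℝ}
    (H : ∀ T ⊆ E, 0 ≤ g T) : 0 ≤ ex p E g := by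
  have := ex_mono hp (E := E) (g := fun _ => 0) (h := g) H
  rwa [ex_const] at this
lemma ex_harris {p : ι → ℝ} (hp : ∀ e, 0 ≤ p e ∧ p e ≤ 1) (E : Finset ι) :
    ∀ f g : Finset ι → ℝ, Monotone f → Monotone g →
      ex p E f * ex p E g ≤ ex p E (fun T => f T * g T) := by
  induction E using Zu with
  | empty => intro f g _ _; simp [ex_empty]
  | insert e E he ih =>
    intro f g hf hg
    rw [ex_insert p he, ex_insert p he, ex_insert p he]
    have mi : Monotone (fun T : Finset ι => insert e T) := fun _ _ h => Finset.insert_subset_insert e h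
    have h0 := ih f g hf hg
    have h1 := ih _ _ (hf.comp mi) (hg.comp mi)
    have hf1 := ex_mono hp (E := E) (g := f) (h := fun T => f (insert e T)) fun T _ => hf (Zw e T)
    have hg1 := ex_mono hp (E := E) (g := g) (h := fun T => g (insert e T)) fun T _ => hg (Zw e T)
    simp only [Function.comp_def] at h1
    set f0 := ex p E f
    set g0 := ex p E g
    set f1 := ex p E (fun T => f (insert e T))
    set g1 := ex p E (fun T => g (insert e T))
    obtain ⟨a, b⟩ := hp e
    have := mul_nonneg (mul_nonneg a (sub_nonneg.2 b)) (mul_nonneg (sub_nonneg.2 hf1) (sub_nonneg.2 hg1))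
    have := mnl h0 (sub_nonneg.2 b)
    have := mnl h1 a
    nlinarith
lemma ex_bk {p : ι → ℝ} (hp : ∀ e, 0 ≤ p e ∧ p e ≤ 1) (E : Finset ι) :
    ∀ C : Set (Finset ι × Finset ι), (∀ c ∈ C, Disjoint c.1 c.2) →
      ex p E (fun T => ind (∃ c ∈ C, c.1 ⊆ T ∧ c.2 ⊆ T)) ≤
      ex p E (fun T => ex p E (fun S => ind (∃ c ∈ C, c.1 ⊆ T ∧ c.2 ⊆ S))) := by
  induction E using Zu with
  | empty => intro C _; simp [ex_empty]
  | insert e E he ih =>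
    intro C hC
    obtain ⟨a, b⟩ := hp e
    simp only [ex_insert p he]
    rw [ex_add, ex_mul, ex_mul, ex_add, ex_mul, ex_mul]
    have h0 := ih C hC
    have h1 := ih ((fun c => (c.1.erase e, c.2.erase e)) '' C) (by
      rintro _ ⟨c, hc, rfl⟩
      exact (hC c hc).mono (Finset.erase_subset _ _) (Finset.erase_subset _ _))
    simp only [Set.exists_mem_image] at h1
    simp only [← Finset.subset_insert_iff] at h1
    have key : ex p E (fun T => ex p E (fun S => ind (∃ c ∈ C, c.1 ⊆ T ∧ c.2 ⊆ S)))
        + ex p E (fun T => ex p E (fun S => ind (∃ c ∈ C, c.1 ⊆ insert e T ∧ c.2 ⊆ insert e S))) ≤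
        ex p E (fun T => ex p E (fun S => ind (∃ c ∈ C, c.1 ⊆ insert e T ∧ c.2 ⊆ S)))
        + ex p E (fun T => ex p E (fun S => ind (∃ c ∈ C, c.1 ⊆ T ∧ c.2 ⊆ insert e S))) := by
      rw [← ex_add, ← ex_add]
      refine ex_mono hp fun T hT => ?_
      rw [← ex_add, ← ex_add]
      refine ex_mono hp fun S hS => ?_
      have i1 : ∀ T : Finset ι, T ⊆ insert e T := fun T => Zw e T
      by_cases q0 : ∃ c ∈ C, c.1 ⊆ T ∧ c.2 ⊆ S
      · obtain ⟨c, hc, h1, h2⟩ := q0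
        rw [ind_t (Q := ∃ c ∈ C, c.1 ⊆ insert e T ∧ c.2 ⊆ S) ⟨c, hc, h1.trans (i1 _), h2⟩,
          ind_t (Q := ∃ c ∈ C, c.1 ⊆ T ∧ c.2 ⊆ insert e S) ⟨c, hc, h1, h2.trans (i1 _)⟩]
        exact add_le_add (ind_le1 _) (ind_le1 _)
      · rw [ind_f q0, zero_add]
        by_cases q1 : ∃ c ∈ C, c.1 ⊆ insert e T ∧ c.2 ⊆ insert e S
        · rw [ind_t q1]
          obtain ⟨c, hc, h1, h2⟩ := q1
          by_cases hec : e ∈ c.1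
          · have : e ∉ c.2 := Zf.1 (hC c hc) hec
            rw [ind_t (Q := ∃ c ∈ C, c.1 ⊆ insert e T ∧ c.2 ⊆ S) ⟨c, hc, h1, (Finset.subset_insert_iff_of_notMem this).1 h2⟩]
            linarith [ind_nn (∃ c ∈ C, c.1 ⊆ T ∧ c.2 ⊆ insert e S)]
          · rw [ind_t (Q := ∃ c ∈ C, c.1 ⊆ T ∧ c.2 ⊆ insert e S) ⟨c, hc, (Finset.subset_insert_iff_of_notMem hec).1 h1, h2⟩]
            linarith [ind_nn (∃ c ∈ C, c.1 ⊆ insert e T ∧ c.2 ⊆ S)]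
        · rw [ind_f q1]; exact add_nonneg (ind_nn _) (ind_nn _)
    have := mnl h0 (sub_nonneg.2 b)
    have := mnl h1 a
    have := mnl key (mul_nonneg a (sub_nonneg.2 b))
    nlinarith
end T1
section T2
variable {ι : Type*} [DecidableEq ι] [Countable ι]
def Bern (μ : Measure (ι → Bool)) (p : ι → ℝ) : Prop :=
  (∀ e, 0 ≤ p e ∧ p e ≤ 1) ∧ ∀ (s : Finset ι) (f : ι → Bool),
    μ {ω | ∀ e ∈ s, ω e = f e} = ∏ e ∈ s, oR (if f e then p e else 1 - p e)
def op (ω : ι → Bool) : Set ι := {e | ω e = true}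
def Dn (𝒜 : Set (Finset ι)) : Set (ι → Bool) := {ω | ∃ I ∈ 𝒜, (I : Set ι) ⊆ op ω}
lemma meas_cyl (s : Finset ι) (f : ι → Bool) : MeasurableSet {ω : ι → Bool | ∀ e ∈ s, ω e = f e} := by
  simp only [Set.ofPred_forall]
  exact Finset.measurableSet_biInter _ fun e _ => measurableSet_eq_fun (measurable_pi_apply e) measurable_const
lemma meas_op (e : ι) : MeasurableSet {ω : ι → Bool | e ∈ op ω} :=
  measurableSet_eq_fun (measurable_pi_apply e) measurable_const
lemma meas_sub (I : Finset ι) : MeasurableSet {ω : ι → Bool | (I : Set ι) ⊆ op ω} := by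
  have := meas_cyl I (fun _ => true)
  simpa [Set.subset_def, op] using this
lemma meas_Dn (𝒜 : Set (Finset ι)) : MeasurableSet (Dn 𝒜) := by
  have : Dn 𝒜 = ⋃ I ∈ 𝒜, {ω : ι → Bool | (I : Set ι) ⊆ op ω} := by ext; simp [Dn]
  rw [this]
  exact MeasurableSet.biUnion (Set.to_countable _) fun I _ => meas_sub I
variable {μ ν : Measure (ι → Bool)} {p : ι → ℝ}
lemma Bern.prob (h : Bern μ p) : IsProbabilityMeasure μ := ⟨by simpa using h.2 ∅ (fun _ => true)⟩
lemma Bern.fin (h : Bern μ p) (E : Finset ι) (Q : Finset ι → Prop) :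
    μ {ω | Q (E.filter (fun e => ω e = true))} = oR (ex p E (fun T => ind (Q T))) := by
  classical
  have e1 : {ω : ι → Bool | Q (E.filter (fun e => ω e = true))} =
      ⋃ T ∈ E.powerset.filter Q, {ω | ∀ e ∈ E, ω e = decide (e ∈ T)} := by
    ext ω
    simp only [Ql, Qy, Qf, QH, exists_prop]
    constructor
    · intro hQ
      exact ⟨_, ⟨Zx _ _, hQ⟩, fun e he => by simp [he]⟩
    · rintro ⟨T, ⟨hT, hQ⟩, hω⟩
      have : E.filter (fun e => ω e = true) = T := by
        ext e; simp only [Qf]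
        constructor
        · rintro ⟨he, h1⟩; rw [hω e he] at h1; simpa using h1
        · intro he; exact ⟨hT he, by rw [hω e (hT he)]; simpa using he⟩
      rwa [this]
  have hp := h.1
  have nn : ∀ T ∈ E.powerset, 0 ≤ (∏ e ∈ T, p e) * (∏ e ∈ E \ T, (1 - p e)) := fun T _ =>
    mul_nonneg (Zv fun e _ => (hp e).1) (Zv fun e _ => sub_nonneg.2 (hp e).2)
  rw [e1, measure_biUnion_finset _ (fun T _ => meas_cyl E _)]
  · unfold ex
    rw [Zy fun T hT => mul_nonneg (nn T hT) (ind_nn _), QV]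
    refine Qi rfl fun T hT => ?_
    by_cases hQ : Q T
    · rw [if_pos hQ, ind_t hQ, mul_one, h.2 E, ← ENNReal.ofReal_prod_of_nonneg]
      · congr 1
        rw [← Finset.prod_sdiff (QH.1 hT), mul_comm]
        congr 1 <;> refine QW rfl fun e he => ?_
        · simp [he]
        · simp [(Finset.mem_sdiff.1 he).2]
      · intro e _; split_ifs
        · exact (hp e).1
        · exact sub_nonneg.2 (hp e).2
    · rw [if_neg hQ, ind_f hQ]; simp
  · intro T hT S hS hne
    refine Set.disjoint_left.2 fun ω h1 h2 => hne ?_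
    simp only [Finset.coe_filter, QH, Ql] at hT hS h1 h2
    ext e
    by_cases he : e ∈ E
    · have := (h1 e he).symm.trans (h2 e he); simpa using this
    · exact ⟨fun h => absurd (hT.1 h) he, fun h => absurd (hS.1 h) he⟩
lemma tend_Dn (μ : Measure (ι → Bool)) (𝒜 : Set (Finset ι)) :
    QX (fun E : Finset ι => μ {ω | ∃ I ∈ 𝒜, I ⊆ E.filter (fun e => ω e = true)})
      Zz (nhds (μ (Dn 𝒜))) := by
  have : Dn 𝒜 = ⋃ E : Finset ι, {ω | ∃ I ∈ 𝒜, I ⊆ E.filter (fun e => ω e = true)} := by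
    ext ω; simp only [Dn, Ql, Qy, op]
    constructor
    · rintro ⟨I, hI, h⟩; exact ⟨I, I, hI, fun e he => by simp [he]; exact h he⟩
    · rintro ⟨E, I, hI, h⟩; exact ⟨I, hI, fun e he => (Qf.1 (h he)).2⟩
  rw [this]
  apply tendsto_measure_iUnion_atTop
  rintro E F hEF ω ⟨I, hI, h⟩
  exact ⟨I, hI, h.trans (Finset.filter_subset_filter _ hEF)⟩
lemma Bern.harris (h : Bern μ p) (𝒜 ℬ : Set (Finset ι)) : μ (Dn 𝒜) * μ (Dn ℬ) ≤ μ (Dn 𝒜 ∩ Dn ℬ) := by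
  have := h.prob
  refine le_of_tendsto (ENNReal.Tendsto.mul (tend_Dn μ 𝒜) (Or.inr (measure_ne_top _ _)) (tend_Dn μ ℬ)
    (Or.inr (measure_ne_top _ _))) (Filter.Eventually.of_forall fun E => ?_)
  rw [h.fin E (fun T => ∃ I ∈ 𝒜, I ⊆ T), h.fin E (fun T => ∃ I ∈ ℬ, I ⊆ T), ← Qa (ex_nn h.1 fun _ _ => ind_nn _)]
  have m : ∀ 𝒜 : Set (Finset ι), Monotone (fun T => ind (∃ I ∈ 𝒜, I ⊆ T)) := fun 𝒜 S T hST =>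
    ind_mono fun ⟨I, hI, hh⟩ => ⟨I, hI, hh.trans hST⟩
  refine (Qe ((ex_harris h.1 E _ _ (m 𝒜) (m ℬ)).trans (ex_mono h.1
    (h := fun T => ind ((∃ I ∈ 𝒜, I ⊆ T) ∧ ∃ I ∈ ℬ, I ⊆ T)) fun T _ => ?_))).trans ?_
  · by_cases a : ∃ I ∈ 𝒜, I ⊆ T
    · by_cases b : ∃ I ∈ ℬ, I ⊆ T
      · rw [ind_t a, ind_t b, ind_t ⟨a, b⟩, one_mul]
      · rw [ind_f b, mul_zero]; exact ind_nn _
    · rw [ind_f a, zero_mul]; exact ind_nn _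
  · rw [← h.fin E (fun T => (∃ I ∈ 𝒜, I ⊆ T) ∧ ∃ I ∈ ℬ, I ⊆ T)]
    refine measure_mono ?_
    rintro ω ⟨⟨I, hI, h1⟩, ⟨J, hJ, h2⟩⟩
    exact ⟨⟨I, hI, fun e he => (Qf.1 (h1 he)).2⟩, ⟨J, hJ, fun e he => (Qf.1 (h2 he)).2⟩⟩
def star (𝒜 ℬ : Set (Finset ι)) : Set (Finset ι) := {K | ∃ I ∈ 𝒜, ∃ J ∈ ℬ, Disjoint I J ∧ K = I ∪ J}
lemma Bern.bk (h : Bern μ p) (𝒜 ℬ : Set (Finset ι)) : μ (Dn (star 𝒜 ℬ)) ≤ μ (Dn 𝒜) * μ (Dn ℬ) := by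
  have := h.prob
  refine le_of_tendsto_of_tendsto' (tend_Dn μ _) (ENNReal.Tendsto.mul (tend_Dn μ 𝒜) (Or.inr (measure_ne_top _ _)) (tend_Dn μ ℬ)
    (Or.inr (measure_ne_top _ _))) fun E => ?_
  rw [h.fin E (fun T => ∃ I ∈ 𝒜, I ⊆ T), h.fin E (fun T => ∃ I ∈ ℬ, I ⊆ T),
    h.fin E (fun T => ∃ I ∈ star 𝒜 ℬ, I ⊆ T), ← Qa (ex_nn h.1 fun _ _ => ind_nn _)]
  refine Qe ?_
  have := ex_bk h.1 E {c | c.1 ∈ 𝒜 ∧ c.2 ∈ ℬ ∧ Disjoint c.1 c.2} fun c hc => hc.2.2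
  refine le_trans (ex_mono h.1 fun T _ => ind_mono ?_) (this.trans ?_)
  · rintro ⟨_, ⟨I, hI, J, hJ, hd, rfl⟩, hT⟩
    exact ⟨(I, J), ⟨hI, hJ, hd⟩, QY.1 hT⟩
  · rw [mul_comm, ← ex_mul]
    refine ex_mono h.1 fun T _ => ?_
    rw [mul_comm, ← ex_mul]
    refine ex_mono h.1 fun S _ => ?_
    by_cases q : ∃ c ∈ {c : Finset ι × Finset ι | c.1 ∈ 𝒜 ∧ c.2 ∈ ℬ ∧ Disjoint c.1 c.2}, c.1 ⊆ T ∧ c.2 ⊆ S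
    · obtain ⟨c, ⟨h1, h2, _⟩, h3, h4⟩ := q
      rw [ind_t (Q := ∃ I ∈ 𝒜, I ⊆ T) ⟨_, h1, h3⟩, ind_t (Q := ∃ I ∈ ℬ, I ⊆ S) ⟨_, h2, h4⟩, one_mul]
      exact ind_le1 _
    · rw [ind_f q]; exact mul_nonneg (ind_nn _) (ind_nn _)
lemma ext_closed [IsProbabilityMeasure μ] [IsProbabilityMeasure ν]
    (h : ∀ s : Finset ι, μ {ω | ∀ e ∈ s, ω e = false} = ν {ω | ∀ e ∈ s, ω e = false}) : μ = ν := by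
  refine ext_of_generate_finite {A | ∃ s : Finset ι, A = {ω : ι → Bool | ∀ e ∈ s, ω e = false}} ?_ ?_ ?_ sy
  · refine le_antisymm ?_ (MeasurableSpace.generateFrom_le ?_)
    · refine iSup_le fun e => ?_
      rintro _ ⟨B, -, rfl⟩
      set m := MeasurableSpace.generateFrom {A | ∃ s : Finset ι, A = {ω : ι → Bool | ∀ e ∈ s, ω e = false}}
      have h0 : MeasurableSet[m] {ω : ι → Bool | ω e = false} :=
        MeasurableSpace.measurableSet_generateFrom ⟨{e}, by simp⟩
      have hm : @Measurable _ _ m _ (fun ω : ι → Bool => ω e) := by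
        refine @measurable_to_bool _ m _ ?_
        convert h0.compl using 1
        ext ω; simp
      exact hm (MeasurableSet.of_discrete (s := B))
    · rintro _ ⟨s, rfl⟩; exact meas_cyl s _
  · rintro _ ⟨s, rfl⟩ _ ⟨t, rfl⟩ _
    refine ⟨s ∪ t, ?_⟩
    ext ω; simp only [Set.mem_inter_iff, Ql, Zg]
    exact ⟨fun h e he => he.elim (h.1 e) (h.2 e), fun h => ⟨fun e he => h e (Or.inl he), fun e he => h e (Or.inr he)⟩⟩
  · rintro _ ⟨s, rfl⟩; exact h s
lemma Bern.closed (h : Bern μ p) (s : Finset ι) :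
    μ {ω | ∀ e ∈ s, ω e = false} = ∏ e ∈ s, oR (1 - p e) := by
  simpa using h.2 s (fun _ => false)
open Classical in
noncomputable def mix (F : Set ι) (x : (ι → Bool) × (ι → Bool)) : ι → Bool := fun e => if e ∈ F then x.1 e else x.2 e
def jn (x : (ι → Bool) × (ι → Bool)) : ι → Bool := fun e => x.1 e || x.2 e
lemma meas_mix (F : Set ι) : Measurable (mix F) := by
  refine measurable_pi_iff.2 fun e => ?_
  by_cases h : e ∈ F
  · simp only [mix, if_pos h]; exact (measurable_pi_apply e).comp measurable_fst
  · simp only [mix, if_neg h]; exact (measurable_pi_apply e).comp measurable_snd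
lemma meas_jn : Measurable (jn (ι := ι)) := by
  refine measurable_pi_iff.2 fun e => ?_
  have h1 : Measurable (fun x : (ι → Bool) × (ι → Bool) => (x.1 e, x.2 e)) :=
    ((measurable_pi_apply e).comp measurable_fst).prodMk ((measurable_pi_apply e).comp measurable_snd)
  exact (measurable_of_finite (fun x : Bool × Bool => x.1 || x.2)).comp h1
lemma Bern.mix (h : Bern μ p) (F : Set ι) : (μ.prod μ).map (mix F) = μ := by
  classical
  have := h.prob
  have := Measure.isProbabilityMeasure_map (μ := μ.prod μ) (meas_mix F).aemeasurable
  refine ext_closed fun s => ?_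
  rw [Measure.map_apply (meas_mix F) (meas_cyl s _)]
  have : LRP.mix F ⁻¹' {ω | ∀ e ∈ s, ω e = false} =
    {ω | ∀ e ∈ s.filter (· ∈ F), ω e = false} ×ˢ {ω | ∀ e ∈ s.filter (· ∉ F), ω e = false} := by
    ext x; simp only [Set.mem_preimage, Ql, Set.mem_prod, Qf, LRP.mix]
    constructor
    · intro H; exact ⟨fun e he => by simpa [he.2] using H e he.1, fun e he => by simpa [he.2] using H e he.1⟩
    · intro H e he; split_ifs with hF
      · exact H.1 e ⟨he, hF⟩
      · exact H.2 e ⟨he, hF⟩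
  rw [this, Measure.prod_prod, h.closed, h.closed, h.closed, Finset.prod_filter_mul_prod_filter_not]
lemma Bern.jn {p₁ p₂ : ι → ℝ} {μ₁ μ₂ : Measure (ι → Bool)} (h₁ : Bern μ₁ p₁) (h₂ : Bern μ₂ p₂) (h : Bern μ p)
    (hp : ∀ e, 1 - p e = (1 - p₁ e) * (1 - p₂ e)) : (μ₁.prod μ₂).map jn = μ := by
  have := h.prob
  have := h₁.prob
  have := h₂.prob
  have := Measure.isProbabilityMeasure_map (μ := μ₁.prod μ₂) (meas_jn (ι := ι)).aemeasurable
  refine ext_closed fun s => ?_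
  rw [Measure.map_apply meas_jn (meas_cyl s _)]
  have : LRP.jn ⁻¹' {ω | ∀ e ∈ s, ω e = false} =
    {ω | ∀ e ∈ s, ω e = false} ×ˢ {ω | ∀ e ∈ s, ω e = false} := by
    ext x; simp only [Set.mem_preimage, Ql, Set.mem_prod, LRP.jn, Bool.or_eq_false_iff]
    exact ⟨fun H => ⟨fun e he => (H e he).1, fun e he => (H e he).2⟩, fun H e he => ⟨H.1 e he, H.2 e he⟩⟩
  rw [this, Measure.prod_prod, h₁.closed, h₂.closed, h.closed, ← Finset.prod_mul_distrib]
  exact QW rfl fun e _ => by rw [hp, Qa (sub_nonneg.2 (h₁.1 e).2)]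
def dep (F : Set ι) (A : Set (ι → Bool)) : Prop := ∀ ω ω', (∀ e ∈ F, ω e = ω' e) → ω ∈ A → ω' ∈ A
lemma Bern.indep (h : Bern μ p) {F G : Set ι} {A B : Set (ι → Bool)} (hA : MeasurableSet A) (hB : MeasurableSet B)
    (dA : dep F A) (dB : dep G B) (hFG : Disjoint F G) : μ (A ∩ B) = μ A * μ B := by
  have := h.prob
  conv_lhs => rw [← h.mix F, Measure.map_apply (meas_mix F) (hA.inter hB)]
  rw [← Measure.prod_prod]
  congr 1
  ext x
  have e1 : ∀ e ∈ F, LRP.mix F x e = x.1 e := fun e he => by simp [LRP.mix, he]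
  have e2 : ∀ e ∈ G, LRP.mix F x e = x.2 e := fun e he => by simp [LRP.mix, Set.disjoint_right.1 hFG he]
  exact ⟨fun H => ⟨dA _ _ e1 H.1, dB _ _ e2 H.2⟩,
    fun H => ⟨dA _ _ (fun e he => (e1 e he).symm) H.1, dB _ _ (fun e he => (e2 e he).symm) H.2⟩⟩
end T2
section T3
variable {W : Type*} [DecidableEq W]
def cn (O : Sw W) (x y : W) : Prop := Relation.ReflTransGen (fun a b => s(a, b) ∈ O) x y
lemma cn.r0 {O : Set (Sym2 W)} {x : W} : cn O x x := Relation.ReflTransGen.refl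
lemma cn.symm {O : Set (Sym2 W)} {x y : W} (h : cn O x y) : cn O y x :=
  (@Relation.ReflTransGen.symmetric W _ ⟨fun a b hab => by rwa [QN]⟩).symm _ _ h
lemma cn.trans {O : Set (Sym2 W)} {x y z : W} (h : cn O x y) (h' : cn O y z) : cn O x z :=
  Relation.ReflTransGen.trans h h'
lemma cn.mono {O O' : Set (Sym2 W)} (hO : O ⊆ O') {x y : W} (h : cn O x y) : cn O' x y :=
  Relation.ReflTransGen.mono (fun _ _ hab => hO hab) _ _ h
lemma cn.one {O : Set (Sym2 W)} {x y : W} (h : s(x, y) ∈ O) : cn O x y := Relation.ReflTransGen.single h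
lemma cn_ind {O : Set (Sym2 W)} {z : W} {Q : W → Prop} (h0 : Q z)
    (h1 : ∀ x y, s(x, y) ∈ O → cn O y z → Q y → Q x) {x : W} (h : cn O x z) : Q x := by
  induction h using Relation.ReflTransGen.head_induction_on with
  | refl => exact h0
  | head hab hbc ih => exact h1 _ _ hab hbc ih
inductive Tr : Finset (Sym2 W) → W → W → Prop
  | nil (x : W) : Tr ∅ x x
  | cons {I : Finset (Sym2 W)} {x y z : W} : s(x, y) ∉ I → Tr I y z → Tr (insert s(x, y) I) x z
lemma Tr.cn {I : Finset (Sym2 W)} {x y : W} (h : Tr I x y) : cn (I : Sw W) x y := by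
  induction h with
  | nil x => exact cn.r0
  | cons hn _ ih => exact (cn.one sy).trans (ih.mono sy)
lemma Tr.split {I : Finset (Sym2 W)} {x y : W} (h : Tr I x y) {e : Sym2 W} (he : e ∈ I) {u : W} (hu : u ∈ e) :
    ∃ I₁ I₂, Disjoint I₁ I₂ ∧ I₁ ∪ I₂ ⊆ I ∧ Tr I₁ x u ∧ Tr I₂ u y := by
  induction h with
  | nil x => simp at he
  | @cons I x x' z hn ht ih =>
    by_cases hux : u = x
    · subst hux
      exact ⟨∅, insert s(u, x') I, by simp, by simp, Tr.nil _, Tr.cons hn ht⟩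
    rcases Finset.mem_insert.1 he with rfl | he'
    · rcases Sym2.mem_iff.1 hu with rfl | rfl
      · exact absurd rfl hux
      · exact ⟨{s(x, u)}, I, by simpa using hn, by rw [← Finset.insert_eq], by simpa using Tr.cons sy (Tr.nil u), ht⟩
    · obtain ⟨I₁, I₂, h1, h2, h3, h4⟩ := ih he'
      have hh := QY.1 h2
      refine ⟨insert s(x, x') I₁, I₂, ?_, ?_, Tr.cons (fun h => hn (hh.1 h)) h3, h4⟩
      · rw [Finset.disjoint_insert_left]; exact ⟨fun h => hn (hh.2 h), h1⟩
      · rw [Finset.insert_union]; exact Finset.insert_subset_insert _ h2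
lemma cn.tr {O : Set (Sym2 W)} {x y : W} (h : cn O x y) : ∃ I : Finset (Sym2 W), (I : Sw W) ⊆ O ∧ Tr I x y := by
  refine cn_ind (Q := fun x => ∃ I : Finset (Sym2 W), (I : Sw W) ⊆ O ∧ Tr I x y) ⟨∅, by simp, Tr.nil _⟩ ?_ h
  rintro a b hab - ⟨I, hI, hT⟩
  by_cases he : s(a, b) ∈ I
  · obtain ⟨I₁, I₂, -, h2, -, h4⟩ := hT.split he (Sym2.mem_mk_left a b)
    exact ⟨I₂, fun e he => hI (h2 (Finset.mem_union_right _ he)), h4⟩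
  · exact ⟨_, by simp only [Zh, ZA]; exact ⟨hab, hI⟩, Tr.cons he hT⟩
lemma Tr.first {I : Finset (Sym2 W)} {x y : W} (h : Tr I x y) (F : Sw W) :
    (I : Sw W) ⊆ F ∨ ∃ u v, ∃ I₁ I₂ : Finset (Sym2 W), s(u, v) ∈ I ∧ s(u, v) ∉ F ∧ s(u, v) ∉ I₂ ∧ (I₁ : Sw W) ⊆ F ∧
      I₁ ⊆ I ∧ I₂ ⊆ I ∧ Disjoint I₁ I₂ ∧ LRP.cn (I₁ : Sw W) x u ∧ LRP.cn (I₂ : Sw W) v y := by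
  induction h with
  | nil x => left; simp
  | @cons I x x' z hn ht ih =>
    have si : ∀ K : Finset (Sym2 W), K ⊆ I → insert s(x, x') K ⊆ insert s(x, x') I := fun K hK => Finset.insert_subset_insert _ hK
    by_cases he : s(x, x') ∈ F
    · rcases ih with h | ⟨u, v, I₁, I₂, h1, h2, h3, h4, h5, h6, h7, h8, h9⟩
      · left; simp only [Zh, ZA]; exact ⟨he, h⟩
      · right
        refine ⟨u, v, insert s(x, x') I₁, I₂, Finset.mem_insert_of_mem h1, h2, h3, ?_, si _ h5,
          h6.trans (Zw _ _), ?_, (cn.one sy).trans (h8.mono sy), h9⟩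
        · simp only [Zh, ZA]; exact ⟨he, h4⟩
        · rw [Finset.disjoint_insert_left]; exact ⟨fun h => hn (h6 h), h7⟩
    · right
      exact ⟨x, x', ∅, I, by simp, he, hn, by simp, by simp, by simp, by simp, cn.r0, ht.cn⟩
lemma cn.attach {O : Set (Sym2 W)} {h b : W} (hb : cn O b h) (S : Finset (Sym2 W)) :
    ∃ v, ∃ L : Finset (Sym2 W), (L : Sw W) ⊆ O ∧ Disjoint L S ∧ cn (L : Sw W) v b ∧ (v = h ∨ ∃ e ∈ S, v ∈ e) := by
  refine cn_ind (Q := fun b => ∃ v, ∃ L : Finset (Sym2 W), (L : Sw W) ⊆ O ∧ Disjoint L S ∧ cn (L : Sw W) v b ∧ (v = h ∨ ∃ e ∈ S, v ∈ e))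
    ⟨h, ∅, by simp, by simp, cn.r0, Or.inl rfl⟩ ?_ hb
  rintro a a' he - ⟨v, L, h1, h2, h3, h4⟩
  by_cases hS : s(a, a') ∈ S
  · exact ⟨a, ∅, by simp, by simp, cn.r0, Or.inr ⟨_, hS, Sym2.mem_mk_left _ _⟩⟩
  · refine ⟨v, insert s(a, a') L, ?_, ?_, (h3.mono sy).trans (cn.one (by simp [QN])), h4⟩
    · simp only [Zh, ZA]; exact ⟨he, h1⟩
    · rw [Finset.disjoint_insert_left]; exact ⟨hS, h2⟩
def fam (F : Sw W) (x y : W) : Set (Finset (Sym2 W)) := {I | (I : Sw W) ⊆ F ∧ cn (I : Sw W) x y}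
lemma Dn_fam (F : Sw W) (x y : W) : Dn (fam F x y) = {ω | cn (op ω ∩ F) x y} := by
  ext ω
  constructor
  · rintro ⟨I, ⟨h1, h2⟩, h3⟩
    exact h2.mono (Set.subset_inter h3 h1)
  · intro h
    obtain ⟨I, h1, h2⟩ := cn.tr h
    exact ⟨I, ⟨h1.trans Set.inter_subset_right, h2.cn⟩, h1.trans QZ⟩
lemma four_pt {O : Set (Sym2 W)} {h o a b : W} (ho : cn O h o) (ha : cn O h a) (hb : cn O h b) :
    ∃ u v, ∃ I₁ I₂ I₃ I₄ I₅ : Finset (Sym2 W), ((I₁ ∪ (I₂ ∪ (I₃ ∪ (I₄ ∪ I₅))) : Finset (Sym2 W)) : Sw W) ⊆ O ∧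
      Disjoint I₁ (I₂ ∪ (I₃ ∪ (I₄ ∪ I₅))) ∧ Disjoint I₂ (I₃ ∪ (I₄ ∪ I₅)) ∧ Disjoint I₃ (I₄ ∪ I₅) ∧ Disjoint I₄ I₅ ∧
      cn (I₅ : Sw W) v b ∧ cn (I₂ : Sw W) u v ∧
      ((cn (I₁ : Sw W) v h ∧ cn (I₃ : Sw W) u o ∧ cn (I₄ : Sw W) u a) ∨
       (cn (I₁ : Sw W) u h ∧ cn (I₃ : Sw W) v o ∧ cn (I₄ : Sw W) u a) ∨
       (cn (I₁ : Sw W) u h ∧ cn (I₃ : Sw W) u o ∧ cn (I₄ : Sw W) v a)) := by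
  obtain ⟨I, hOI, hI⟩ := ho.tr
  obtain ⟨u, L, hLO, hLI, hL, hu⟩ := ha.symm.attach I
  have : ∃ I₁ I₂, Disjoint I₁ I₂ ∧ I₁ ∪ I₂ ⊆ I ∧ Tr I₁ h u ∧ Tr I₂ u o := by
    rcases hu with rfl | ⟨e, he, hu⟩
    · exact ⟨∅, I, by simp, by simp, Tr.nil _, hI⟩
    · exact hI.split he hu
  obtain ⟨A, B, dAB, hAB, hA, hB⟩ := this
  obtain ⟨K, hKL, hK⟩ := hL.tr
  obtain ⟨v, M, hMO, hMS, hM, hv⟩ := hb.symm.attach (A ∪ (B ∪ K))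
  have hAB' := QY.1 hAB
  have hKL' : K ⊆ L := by exact_mod_cast hKL
  have dAK : Disjoint A K := (hLI.mono hKL' hAB'.1).symm
  have dBK : Disjoint B K := (hLI.mono hKL' hAB'.2).symm
  have cA : (A : Sw W) ⊆ O := fun e he => hOI (hAB'.1 he)
  have cB : (B : Sw W) ⊆ O := fun e he => hOI (hAB'.2 he)
  have cK : (K : Sw W) ⊆ O := fun e he => hLO (hKL he)
  simp only [Finset.disjoint_union_right] at hMS
  obtain ⟨dMA, dMB, dMK⟩ := hMS
  simp only [Finset.coe_union, Set.union_subset_iff, Finset.disjoint_union_right]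
  rcases hv with rfl | ⟨e, he, hv⟩
  · exact ⟨u, v, ∅, A, B, K, M, ⟨by simp, cA, cB, cK, hMO⟩, by simp, ⟨dAB, dAK, dMA.symm⟩, ⟨dBK, dMB.symm⟩, dMK.symm, hM,
      hA.cn.symm, Or.inl ⟨cn.r0, hB.cn, hK.cn⟩⟩
  simp only [Zg] at he
  rcases he with he | he | he
  · obtain ⟨P, Q, dPQ, hPQ, hP, hQ⟩ := hA.split he hv
    obtain ⟨sP, sQ⟩ := QY.1 hPQ
    exact ⟨u, v, P, Q, B, K, M, ⟨fun e he => cA (sP he), fun e he => cA (sQ he), cB, cK, hMO⟩, ⟨dPQ, dAB.mono_left sP, dAK.mono_left sP, (dMA.mono_right sP).symm⟩,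
      ⟨dAB.mono_left sQ, dAK.mono_left sQ, (dMA.mono_right sQ).symm⟩, ⟨dBK, dMB.symm⟩, dMK.symm, hM, hQ.cn.symm, Or.inl ⟨hP.cn.symm, hB.cn, hK.cn⟩⟩
  · obtain ⟨P, Q, dPQ, hPQ, hP, hQ⟩ := hB.split he hv
    obtain ⟨sP, sQ⟩ := QY.1 hPQ
    exact ⟨u, v, A, P, Q, K, M, ⟨cA, fun e he => cB (sP he), fun e he => cB (sQ he), cK, hMO⟩, ⟨dAB.mono_right sP, dAB.mono_right sQ, dAK, dMA.symm⟩,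
      ⟨dPQ, dBK.mono_left sP, (dMB.mono_right sP).symm⟩, ⟨dBK.mono_left sQ, (dMB.mono_right sQ).symm⟩, dMK.symm, hM, hP.cn, Or.inr (Or.inl ⟨hA.cn.symm, hQ.cn, hK.cn⟩)⟩
  · obtain ⟨P, Q, dPQ, hPQ, hP, hQ⟩ := hK.split he hv
    obtain ⟨sP, sQ⟩ := QY.1 hPQ
    exact ⟨u, v, A, P, B, Q, M, ⟨cA, fun e he => cK (sP he), cB, fun e he => cK (sQ he), hMO⟩, ⟨dAK.mono_right sP, dAB, dAK.mono_right sQ, dMA.symm⟩,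
      ⟨(dBK.mono_right sP).symm, dPQ, (dMK.mono_right sP).symm⟩, ⟨dBK.mono_right sQ, dMB.symm⟩, (dMK.mono_right sQ).symm, hM, hP.cn, Or.inr (Or.inr ⟨hA.cn.symm, hB.cn, hQ.cn⟩)⟩
open Classical in
noncomputable def mk (b : Finset W) (O : Sw W) (x : W) : ℕ := (b.filter (fun y => cn O x y)).card
lemma mk_mono {b : Finset W} {O O' : Set (Sym2 W)} {x : W} (h : O ⊆ O') : mk b O x ≤ mk b O' x := by
  classical
  exact QB (Finset.monotone_filter_right _ fun _ _ hy => hy.mono h)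
lemma mk_finite {b : Finset W} {O : Set (Sym2 W)} (x : W) :
    ∃ I : Finset (Sym2 W), (I : Sw W) ⊆ O ∧ mk b O x ≤ mk b (I : Sw W) x := by
  classical
  have : ∀ y, ∃ I : Finset (Sym2 W), (I : Sw W) ⊆ O ∧ (cn O x y → cn (I : Sw W) x y) := fun y => by
    by_cases h : cn O x y
    · obtain ⟨I, h1, h2⟩ := h.tr; exact ⟨I, h1, fun _ => h2.cn⟩
    · exact ⟨∅, by simp, fun h' => absurd h' h⟩
  choose I h1 h2 using this
  refine ⟨b.biUnion I, ?_, QB fun y hy => ?_⟩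
  · intro e he; simp only [Finset.coe_biUnion, Qy] at he
    obtain ⟨y, _, he⟩ := he; exact h1 y he
  · rw [Qf] at hy ⊢
    exact ⟨hy.1, (h2 y hy.2).mono fun e he => by simpa using ⟨y, hy.1, he⟩⟩
lemma comp_split (I : Sw W) (v : W) : ∃ I' ⊆ I, (∀ p, cn I v p → cn I' v p) ∧
    ∀ v' p, cn I v' p → cn I v p ∨ cn (I \ I') v' p := by
  refine ⟨{e ∈ I | ∃ z ∈ e, cn I v z}, fun e he => he.1, fun p hp => ?_, fun v' p hp => ?_⟩
  · have : ∀ x, cn I x p → cn I v x → cn {e ∈ I | ∃ z ∈ e, cn I v z} x p := fun x hx => by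
      refine cn_ind (Q := fun x => cn I v x → cn {e ∈ I | ∃ z ∈ e, cn I v z} x p) (fun _ => cn.r0) ?_ hx
      intro a b hab _ ih hva
      have he : s(a, b) ∈ {e ∈ I | ∃ z ∈ e, cn I v z} := ⟨hab, a, Sym2.mem_mk_left _ _, hva⟩
      exact (cn.one he).trans (ih (hva.trans (cn.one hab)))
    exact this v hp cn.r0
  · by_cases h : cn I v p
    · exact Or.inl h
    right
    refine cn_ind (Q := fun x => cn (I \ {e ∈ I | ∃ z ∈ e, cn I v z}) x p) cn.r0 ?_ hp
    intro a b hab hbp ih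
    refine (cn.one (O := I \ {e ∈ I | ∃ z ∈ e, cn I v z}) ⟨hab, ?_⟩).trans ih
    rintro ⟨-, z, hz, hvz⟩
    have hap : cn I a p := (cn.one hab).trans hbp
    rcases Sym2.mem_iff.1 hz with rfl | rfl
    · exact h (hvz.trans hap)
    · exact h (hvz.trans hbp)
lemma cn_erase {I : Set (Sym2 W)} {w w' p : W} (h : cn I w p) :
    cn (I \ {s(w, w')}) w p ∨ cn (I \ {s(w, w')}) w' p := by
  have : ∀ x, cn I x p → cn (I \ {s(w, w')}) x p ∨ cn (I \ {s(w, w')}) w p ∨ cn (I \ {s(w, w')}) w' p := fun x hx => by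
    refine cn_ind (Q := fun x => cn (I \ {s(w, w')}) x p ∨ cn (I \ {s(w, w')}) w p ∨ cn (I \ {s(w, w')}) w' p) (Or.inl cn.r0) ?_ hx
    intro a b hab _ ih
    rcases ih with ih | ih
    · by_cases he : s(a, b) = s(w, w')
      · rcases Zi.1 he with ⟨rfl, rfl⟩ | ⟨rfl, rfl⟩
        · exact Or.inr (Or.inr ih)
        · exact Or.inr (Or.inl ih)
      · exact Or.inl ((cn.one (O := I \ {s(w, w')}) ⟨hab, he⟩).trans ih)
    · exact Or.inr ih
  rcases this w h with h | h | h <;> simp [h]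
lemma mark_split (b : Finset W) (I₀ : Finset (Sym2 W)) (x : W) {n m : ℕ} (hm : 1 ≤ m) (h : n + 2 * m ≤ mk b (I₀ : Sw W) x) :
    ∃ I J : Finset (Sym2 W), I ⊆ I₀ ∧ J ⊆ I₀ ∧ Disjoint I J ∧ n ≤ mk b (I : Sw W) x ∧ ∃ w, m ≤ mk b (J : Sw W) w := by
  classical
  let Q : ℕ → Prop := fun k => ∃ J ⊆ I₀, ∃ w, J.card = k ∧ cn ((I₀ : Sw W) \ J) x w ∧ m ≤ mk b (J : Sw W) w ∧
    ∀ p, cn (I₀ : Sw W) x p → cn ((I₀ : Sw W) \ J) x p ∨ cn (J : Sw W) w p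
  have hQ : ∃ k, Q k := ⟨_, I₀, subset_rfl, x, rfl, cn.r0, by omega, fun p hp => Or.inr hp⟩
  obtain ⟨J, hJ, w, hk, h1, h2, h3⟩ := Nat.find_spec hQ
  have hmin := fun k (hk : k < Nat.find hQ) => Nat.find_min hQ hk
  have key : ∀ v v', s(v, v') ∈ J → cn ((I₀ : Sw W) \ (J \ {s(v, v')})) x v →
      (∀ p, cn (J : Sw W) w p → cn ((J : Sw W) \ {s(v, v')}) v p ∨ cn ((J : Sw W) \ {s(v, v')}) v' p) →
      mk b ((J : Sw W) \ {s(v, v')}) v < m := by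
    intro v v' he hv hw
    by_contra hge
    push Not at hge
    obtain ⟨J', hJ', c1, c2⟩ := comp_split ((J : Sw W) \ {s(v, v')}) v
    have fin : J'.Finite := (J.finite_toSet.subset ZB).subset hJ'
    have hJJ : J' ⊆ (J : Sw W) := hJ'.trans ZB
    have hlt : fin.toFinset.card < J.card := Finset.card_lt_card
      ((Finset.ssubset_iff_of_subset (fun e he => hJJ (by simpa using he))).2 ⟨_, he, fun h => by
        have := hJ' (by simpa using h); simp at this⟩)
    refine hmin _ (hk ▸ hlt) ⟨fin.toFinset, fun e he => hJ (hJJ (by simpa using he)), v, rfl, ?_, ?_, ?_⟩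
    · rw [Set.Finite.coe_toFinset]
      exact hv.mono (Zj hJ')
    · rw [Set.Finite.coe_toFinset]
      exact hge.trans (QB (Finset.monotone_filter_right _ fun p _ hp => c1 p hp))
    · rw [Set.Finite.coe_toFinset]
      intro p hp
      rcases h3 p hp with hp | hp
      · exact Or.inl (hp.mono (Zj hJJ))
      rcases hw p hp with hp | hp
      · exact Or.inr (c1 p hp)
      rcases c2 _ _ hp with hp | hp
      · exact Or.inr (c1 p hp)
      · left
        refine (hv.mono (Zj hJ')).trans ((cn.one ?_).trans (hp.mono ?_))
        · exact ⟨hJ he, fun h => by have := hJ' h; simp at this⟩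
        · exact fun e he => ⟨hJ he.1.1, he.2⟩
  have small : mk b (J : Sw W) w ≤ 2 * m := by
    by_cases hw : ∃ w', w' ≠ w ∧ s(w, w') ∈ J
    · obtain ⟨w', -, he⟩ := hw
      have k1 := key w w' he (h1.mono (Zj ZB)) (fun p hp => cn_erase hp)
      have k2 := key w' w (by rwa [QN]) ((h1.mono (Zj ZB)).trans (cn.one ⟨hJ he, fun h => h.2 (QN)⟩))
        (fun p hp => by rw [QN]; exact (cn_erase hp).symm)
      have : mk b (J : Sw W) w ≤ mk b ((J : Sw W) \ {s(w, w')}) w + mk b ((J : Sw W) \ {s(w', w)}) w' := by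
        refine (QB fun p hp => ?_).trans (Finset.card_union_le _ _)
        rw [Qf] at hp
        rw [Zg, Qf, Qf, QN (a := w') (b := w)]
        exact (cn_erase hp.2).imp (fun h => ⟨hp.1, h⟩) (fun h => ⟨hp.1, h⟩)
      omega
    · push Not at hw
      have : mk b (J : Sw W) w ≤ 1 := by
        refine Finset.card_le_one.2 fun p hp q hq => ?_
        have : ∀ p, cn (J : Sw W) w p → p = w := fun p hp => by
          refine cn_ind (Q := fun x => x = w) rfl ?_ hp.symm
          rintro a b hab - rfl
          by_contra hne
          exact hw a hne (by rw [QN]; exact hab)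
        rw [Qf] at hp hq
        rw [this p hp.2, this q hq.2]
      omega
  refine ⟨I₀ \ J, J, Finset.sdiff_subset, hJ, Finset.sdiff_disjoint, ?_, w, h2⟩
  have : mk b (I₀ : Sw W) x ≤ mk b ((I₀ : Sw W) \ J) x + mk b (J : Sw W) w := by
    refine (QB fun p hp => ?_).trans (Finset.card_union_le _ _)
    rw [Qf] at hp
    rw [Zg, Qf, Qf]
    exact (h3 p hp.2).imp (fun h => ⟨hp.1, h⟩) (fun h => ⟨hp.1, h⟩)
  rw [Finset.coe_sdiff]
  omega
end T3
section T4
variable {W : Type*} [DecidableEq W] [Countable W]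
instance : Countable (Sym2 W) := inferInstanceAs (Countable (Quot _))
variable {μ : Measure (Sym2 W → Bool)} {p : Sym2 W → ℝ}
noncomputable def tau (μ : Measure (Sym2 W → Bool)) (F : Sw W) (x y : W) : ℝ≥0∞ := μ {ω | cn (op ω ∩ F) x y}
lemma meas_cn (F : Sw W) (x y : W) : MeasurableSet {ω : Sym2 W → Bool | cn (op ω ∩ F) x y} := by
  rw [← Dn_fam]; exact meas_Dn _
lemma tau_symm (F : Sw W) (x y : W) : tau μ F x y = tau μ F y x := by
  unfold tau; congr 1; ext ω; exact ⟨cn.symm, cn.symm⟩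
lemma tau_mono {F G : Set (Sym2 W)} (h : F ⊆ G) (x y : W) : tau μ F x y ≤ tau μ G x y :=
  measure_mono fun _ hω => cn.mono (Set.inter_subset_inter_right _ h) hω
lemma tau_self (h : Bern μ p) (F : Sw W) (x : W) : tau μ F x x = 1 := by
  have := h.prob
  unfold tau; rw [show {ω : Sym2 W → Bool | cn (op ω ∩ F) x x} = Set.univ from Set.eq_univ_of_forall fun _ => cn.r0]
  exact measure_univ
lemma tau_le_one (h : Bern μ p) (F : Sw W) (x y : W) : tau μ F x y ≤ 1 := by
  have := h.prob
  exact prob_le_one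
lemma tau_zero {F : Set (Sym2 W)} {S : Set W} (hS : ∀ a b, s(a, b) ∈ F → a ∈ S → b ∈ S) {x y : W} (hx : x ∈ S) (hy : y ∉ S) :
    tau μ F x y = 0 := by
  unfold tau
  rw [show {ω : Sym2 W → Bool | cn (op ω ∩ F) x y} = ∅ from Set.eq_empty_of_forall_notMem fun ω h => ?_, measure_empty]
  refine (cn_ind (Q := fun x => x ∉ S) hy ?_ h) hx
  exact fun a b hab _ hb ha => hb (hS a b hab.2 ha)
lemma Bern.edge (h : Bern μ p) (e : Sym2 W) : μ {ω | e ∈ op ω} = oR (p e) := by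
  have := h.2 {e} (fun _ => true); simpa [op] using this
lemma Bern.edgeD (h : Bern μ p) (e : Sym2 W) : μ (Dn {{e}}) = oR (p e) := by
  rw [← h.edge]; congr 1; ext; simp [Dn]
lemma first_edge (h : Bern μ p) {F G : Set (Sym2 W)} (x y : W) :
    tau μ G x y ≤ tau μ F x y + ∑' u, ∑' v, tau μ F x u * (G \ F).indicator (fun e => oR (p e)) s(u, v) * tau μ G v y := by
  have sub : {ω : Sym2 W → Bool | cn (op ω ∩ G) x y} ⊆ {ω | cn (op ω ∩ F) x y} ∪
      ⋃ u, ⋃ v, {ω | s(u, v) ∈ G \ F ∧ ω ∈ Dn (star (fam F x u) (star {{s(u, v)}} (fam G v y)))} := by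
    intro ω hω
    obtain ⟨I, hI, hT⟩ := cn.tr hω
    rcases hT.first F with h | ⟨u, v, I₁, I₂, h1, h2, h3, h4, h5, h6, h7, h8, h9⟩
    · exact Or.inl (cn.mono (O' := op ω ∩ F) (h := hT.cn) fun e he => ⟨(hI he).1, h he⟩)
    · right
      simp only [Qy]
      refine ⟨u, v, ⟨(hI h1).2, h2⟩, I₁ ∪ ({s(u, v)} ∪ I₂), ⟨I₁, ⟨h4, h8⟩, _, ⟨{s(u, v)}, rfl, I₂, ⟨fun e he => (hI (h6 he)).2, h9⟩, by simpa using h3, rfl⟩, ?_, rfl⟩, ?_⟩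
      · rw [Finset.disjoint_union_right]
        exact ⟨by simpa using fun h => h2 (h4 h), h7⟩
      · intro e he
        simp only [Finset.coe_union, Set.mem_union, Finset.mem_coe, Finset.mem_singleton] at he
        rcases he with he | rfl | he
        · exact (hI (h5 he)).1
        · exact (hI h1).1
        · exact (hI (h6 he)).1
  refine (measure_mono sub).trans ((measure_union_le _ _).trans (add_le_add le_rfl ?_))
  refine (measure_iUnion_le _).trans (Qd fun u => (measure_iUnion_le _).trans (Qd fun v => ?_))
  by_cases he : s(u, v) ∈ G \ F
  · rw [QC he]
    refine (measure_mono fun ω hω => hω.2).trans ((h.bk _ _).trans ?_)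
    rw [Dn_fam, mul_assoc]
    refine mul_le_mul_right ((h.bk _ _).trans ?_) _
    rw [h.edgeD, Dn_fam]; rfl
  · rw [show {ω | s(u, v) ∈ G \ F ∧ ω ∈ Dn (star (fam F x u) (star {{s(u, v)}} (fam G v y)))} = ∅ from
      Set.eq_empty_of_forall_notMem fun ω h => he h.1, measure_empty]
    exact zero_le
lemma four_pt_prob (h : Bern μ p) (t o a b : W) :
    μ {ω | cn (op ω) t o ∧ cn (op ω) t a ∧ cn (op ω) t b} ≤
    ∑' u, ∑' v, (tau μ Set.univ v t * (tau μ Set.univ u v * (tau μ Set.univ u o * (tau μ Set.univ u a * tau μ Set.univ v b)))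
      + (tau μ Set.univ u t * (tau μ Set.univ u v * (tau μ Set.univ v o * (tau μ Set.univ u a * tau μ Set.univ v b)))
      + tau μ Set.univ u t * (tau μ Set.univ u v * (tau μ Set.univ u o * (tau μ Set.univ v a * tau μ Set.univ v b))))) := by
  let f := fam (Set.univ : Sw W)
  let S := fun A B C D E : Set (Finset (Sym2 W)) => Dn (star A (star B (star C (star D E))))
  have hS : ∀ x1 y1 x2 y2 x3 y3 x4 y4 x5 y5, μ (S (f x1 y1) (f x2 y2) (f x3 y3) (f x4 y4) (f x5 y5)) ≤
      tau μ Set.univ x1 y1 * (tau μ Set.univ x2 y2 * (tau μ Set.univ x3 y3 * (tau μ Set.univ x4 y4 * tau μ Set.univ x5 y5))) := by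
    intros
    simp only [tau, ← Dn_fam]
    refine (h.bk _ _).trans (mul_le_mul_right ((h.bk _ _).trans (mul_le_mul_right ((h.bk _ _).trans (mul_le_mul_right (h.bk _ _) _)) _)) _)
  refine le_trans (measure_mono (t := ⋃ u, ⋃ v, (S (f v t) (f u v) (f u o) (f u a) (f v b) ∪
    (S (f u t) (f u v) (f v o) (f u a) (f v b) ∪ S (f u t) (f u v) (f u o) (f v a) (f v b)))) ?_) ?_
  · rintro ω ⟨h1, h2, h3⟩
    obtain ⟨u, v, I₁, I₂, I₃, I₄, I₅, hO, d1, d2, d3, d4, c5, c2, hc⟩ := four_pt h1 h2 h3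
    simp only [Qy]
    refine ⟨u, v, ?_⟩
    have mm : ∀ {x1 y1 x2 y2 x3 y3 x4 y4 x5 y5}, cn (I₁ : Sw W) x1 y1 → cn (I₂ : Sw W) x2 y2 → cn (I₃ : Sw W) x3 y3 →
      cn (I₄ : Sw W) x4 y4 → cn (I₅ : Sw W) x5 y5 → ω ∈ S (f x1 y1) (f x2 y2) (f x3 y3) (f x4 y4) (f x5 y5) := by
      intro _ _ _ _ _ _ _ _ _ _ q1 q2 q3 q4 q5
      exact ⟨_, ⟨I₁, ⟨QO _, q1⟩, _, ⟨I₂, ⟨QO _, q2⟩, _, ⟨I₃, ⟨QO _, q3⟩, _,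
        ⟨I₄, ⟨QO _, q4⟩, I₅, ⟨QO _, q5⟩, d4, rfl⟩, d3, rfl⟩, d2, rfl⟩, d1, rfl⟩, hO⟩
    rcases hc with ⟨q1, q3, q4⟩ | ⟨q1, q3, q4⟩ | ⟨q1, q3, q4⟩
    · exact Or.inl (mm q1 c2 q3 q4 c5)
    · exact Or.inr (Or.inl (mm q1 c2 q3 q4 c5))
    · exact Or.inr (Or.inr (mm q1 c2 q3 q4 c5))
  · refine (measure_iUnion_le _).trans (Qd fun u => (measure_iUnion_le _).trans (Qd fun v => ?_))
    exact (measure_union_le _ _).trans (add_le_add (hS ..) ((measure_union_le _ _).trans (add_le_add (hS ..) (hS ..))))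
def famM (b : Finset W) (F : Sw W) (n : ℕ) (x : W) : Set (Finset (Sym2 W)) := {I | (I : Sw W) ⊆ F ∧ n ≤ mk b (I : Sw W) x}
def famQ (b : Finset W) (F : Sw W) (n : ℕ) : Set (Finset (Sym2 W)) := {I | (I : Sw W) ⊆ F ∧ ∃ x, n ≤ mk b (I : Sw W) x}
lemma Dn_famM (b : Finset W) (F : Sw W) (n : ℕ) (x : W) : Dn (famM b F n x) = {ω | n ≤ mk b (op ω ∩ F) x} := by
  ext ω
  constructor
  · rintro ⟨I, ⟨h1, h2⟩, h3⟩
    exact h2.trans (mk_mono (Set.subset_inter h3 h1))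
  · intro h
    obtain ⟨I, h1, h2⟩ := mk_finite (b := b) (O := op ω ∩ F) x
    exact ⟨I, ⟨h1.trans Set.inter_subset_right, le_trans h h2⟩, h1.trans QZ⟩
lemma Dn_famQ (b : Finset W) (F : Sw W) (n : ℕ) : Dn (famQ b F n) = {ω | ∃ x, n ≤ mk b (op ω ∩ F) x} := by
  ext ω
  constructor
  · rintro ⟨I, ⟨h1, x, h2⟩, h3⟩
    exact ⟨x, h2.trans (mk_mono (Set.subset_inter h3 h1))⟩
  · rintro ⟨x, h⟩
    obtain ⟨I, h1, h2⟩ := mk_finite (b := b) (O := op ω ∩ F) x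
    exact ⟨I, ⟨h1.trans Set.inter_subset_right, x, le_trans h h2⟩, h1.trans QZ⟩
noncomputable def qq (μ : Measure (Sym2 W → Bool)) (b : Finset W) (F : Sw W) (n : ℕ) : ℝ≥0∞ := μ {ω | ∃ x, n ≤ mk b (op ω ∩ F) x}
lemma mark1 (h : Bern μ p) (b : Finset W) (F : Sw W) (n : ℕ) {m : ℕ} (hm : 1 ≤ m) (x : W) :
    μ {ω | n + 2 * m ≤ mk b (op ω ∩ F) x} ≤ μ {ω | n ≤ mk b (op ω ∩ F) x} * qq μ b F m := by
  rw [qq, ← Dn_famM, ← Dn_famM, ← Dn_famQ]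
  refine le_trans (measure_mono ?_) (h.bk _ _)
  rintro ω ⟨I, ⟨h1, h2⟩, h3⟩
  obtain ⟨A, B, hA, hB, hd, ha, w, hb⟩ := mark_split b I x hm h2
  refine ⟨A ∪ B, ⟨A, ⟨fun e he => h1 (hA he), ha⟩, B, ⟨fun e he => h1 (hB he), w, hb⟩, hd, rfl⟩, fun e he => ?_⟩
  exact h3 (Finset.union_subset hA hB he)
lemma mark2 (h : Bern μ p) (b : Finset W) (F : Sw W) (n : ℕ) {m : ℕ} (hm : 1 ≤ m) :
    qq μ b F (n + 2 * m) ≤ qq μ b F n * qq μ b F m := by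
  simp only [qq, ← Dn_famQ]
  refine le_trans (measure_mono ?_) (h.bk _ _)
  rintro ω ⟨I, ⟨h1, x, h2⟩, h3⟩
  obtain ⟨A, B, hA, hB, hd, ha, w, hb⟩ := mark_split b I x hm h2
  refine ⟨A ∪ B, ⟨A, ⟨fun e he => h1 (hA he), x, ha⟩, B, ⟨fun e he => h1 (hB he), w, hb⟩, hd, rfl⟩, fun e he => ?_⟩
  exact h3 (Finset.union_subset hA hB he)
lemma mark3 (h : Bern μ p) (b : Finset W) (F : Sw W) {m : ℕ} (hm : 1 ≤ m) (j : ℕ) :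
    qq μ b F ((2 * j + 1) * m) ≤ qq μ b F m ^ (j + 1) := by
  induction j with
  | zero => simp
  | succ j ih =>
    rw [show (2 * (j + 1) + 1) * m = (2 * j + 1) * m + 2 * m by ring, pow_succ]
    exact (mark2 h b F _ hm).trans (mul_le_mul_left ih _)
end T4
section P5
variable {d : ℕ} {J : V d → V d → ℝ} {α c C : ℝ} {P : ℝ → Measure (Config d)} {β δ : ℝ}
lemma nI_le {x : V d} {r : ℕ} : normInf x ≤ r ↔ ∀ i, (x i).natAbs ≤ r := by simp [normInf]
lemma nI_add (x y : V d) : normInf (x + y) ≤ normInf x + normInf y :=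
  nI_le.2 fun i => (Int.natAbs_add_le _ _).trans (add_le_add (nI_le.1 le_rfl i) (nI_le.1 le_rfl i))
lemma nI_neg (x : V d) : normInf (-x) = normInf x := by simp [normInf]
lemma nI_sub_comm (x y : V d) : normInf (x - y) = normInf (y - x) := by rw [← nI_neg, neg_sub]
lemma nI_zero : normInf (0 : V d) = 0 := Nat.le_zero.1 (nI_le.2 fun i => by simp)
lemma nI_eq0 {x : V d} : normInf x = 0 ↔ x = 0 := by
  refine ⟨fun h => funext fun i => ?_, fun h => h ▸ nI_zero⟩
  have := nI_le.1 h.le i; simpa using this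
lemma nI_tri (x y : V d) : normInf x ≤ normInf (x - y) + normInf y := by simpa using nI_add (x - y) y
noncomputable def box (d r : ℕ) : Finset (V d) := Fintype.piFinset fun _ => Qm (-(r : ℤ)) r
lemma mem_box {x : V d} {r : ℕ} : x ∈ box d r ↔ normInf x ≤ r := by
  simp only [box, Fintype.mem_piFinset, QI, nI_le]
  exact forall_congr' fun i => by omega
lemma card_box (r : ℕ) : (box d r).card = (2 * r + 1) ^ d := by
  simp [box, Fintype.card_piFinset]; congr 1; omega
noncomputable def jw (J : V d → V d → ℝ) (e : Sym2 (V d)) : ℝ :=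
  Sym2.lift ⟨fun x y => (J x y + J y x) / 2, fun x y => by dsimp only; rw [add_comm]⟩ e
noncomputable def pr (J : V d → V d → ℝ) (β : ℝ) (e : Sym2 (V d)) : ℝ := 1 - Qc (-β * jw J e)
lemma jw_mk (hJ : KernelHyp d J α c C) (x y : V d) : jw J s(x, y) = J x y := by simp [jw, hJ.symm y x]
lemma jw_nn (hJ : KernelHyp d J α c C) (e : Sym2 (V d)) : 0 ≤ jw J e := by
  induction e with | _ x y => rw [jw_mk hJ]; exact hJ.nonneg _ _
lemma bern (hJ : KernelHyp d J α c C) (hP : IsLRP J P) (hβ : 0 ≤ β) : Bern (P β) (pr J β) := by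
  have h01 : ∀ e, 0 ≤ pr J β e ∧ pr J β e ≤ 1 := fun e => by
    have h1 : Qc (-β * jw J e) ≤ 1 := Real.exp_le_one_iff.2 (by nlinarith [jw_nn hJ e])
    have h2 := Qq (-β * jw J e)
    unfold pr; constructor <;> linarith
  refine ⟨h01, fun s f => (hP β s f).trans (QW rfl fun e _ => ?_)⟩
  split_ifs
  · rfl
  · rw [Zk _ (h01 e).1, QP]; rfl
lemma pr_le (β : ℝ) (e : Sym2 (V d)) : pr J β e ≤ β * jw J e := by
  unfold pr; linarith [ZC (-β * jw J e)]
lemma jn_map (hJ : KernelHyp d J α c C) (hP : IsLRP J P) (hβ : 0 ≤ β) (hδ : 0 ≤ δ) :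
    ((P β).prod (P δ)).map jn = P (β + δ) :=
  (bern hJ hP hβ).jn (bern hJ hP hδ) (bern hJ hP (add_nonneg hβ hδ)) fun e => by
    have : -(β + δ) * jw J e = -β * jw J e + -δ * jw J e := by ring
    simp only [pr]; rw [this, Za]; ring
def sh (z : V d) (e : Sym2 (V d)) : Sym2 (V d) := e.map (· + z)
lemma sh_inj (z : V d) : Function.Injective (sh z) := Sym2.map.injective (add_left_injective z)
lemma cn_sh {O : Set (Sym2 (V d))} {x y z : V d} : cn (sh z ⁻¹' O) x y ↔ cn O (x + z) (y + z) := by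
  constructor
  · intro h
    refine cn_ind (Q := fun x => cn O (x + z) (y + z)) cn.r0 (fun a b hab _ ih => (cn.one ?_).trans ih) h
    simpa [sh] using hab
  · intro h
    have := cn_ind (Q := fun w => cn (sh z ⁻¹' O) (w - z) y) (by simpa using cn.r0) (fun a b hab _ ih => (cn.one ?_).trans ih) h
    · simpa using this
    · simpa [sh] using hab
lemma map_sh (hJ : KernelHyp d J α c C) (hP : IsLRP J P) (hβ : 0 ≤ β) (z : V d) :
    (P β).map (fun ω e => ω (sh z e)) = P β := by
  have B := bern hJ hP hβ
  have := B.prob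
  have hm : Measurable (fun (ω : Config d) e => ω (sh z e)) := measurable_pi_iff.2 fun e => measurable_pi_apply _
  have := Measure.isProbabilityMeasure_map (μ := P β) hm.aemeasurable
  refine ext_closed fun s => ?_
  rw [Measure.map_apply hm (meas_cyl s _), B.closed]
  have : (fun (ω : Config d) e => ω (sh z e)) ⁻¹' {ω | ∀ e ∈ s, ω e = false} = {ω | ∀ e ∈ s.image (sh z), ω e = false} := by
    ext ω; simp
  rw [this, B.closed, Finset.prod_image (fun _ _ _ _ h => sh_inj z h)]
  refine QW rfl fun e _ => ?_
  induction e with | _ x y => simp only [pr, sh, Sym2.map_mk, jw_mk hJ, hJ.transInv]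
lemma tau_sh (hJ : KernelHyp d J α c C) (hP : IsLRP J P) (hβ : 0 ≤ β) (F : Sw (V d)) (x y z : V d) :
    tau (P β) F (x + z) (y + z) = tau (P β) (sh z ⁻¹' F) x y := by
  have hm : Measurable (fun (ω : Config d) e => ω (sh z e)) := measurable_pi_iff.2 fun e => measurable_pi_apply _
  conv_rhs => rw [tau, ← map_sh hJ hP hβ z, Measure.map_apply hm (meas_cn _ _ _)]
  unfold tau; congr 1; ext ω
  exact cn_sh.symm
def TI (F : Sw (V d)) : Prop := ∀ z, sh z ⁻¹' F = F
lemma TI_univ : TI (Set.univ : Sw (V d)) := fun _ => rfl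
lemma tau_ti (hJ : KernelHyp d J α c C) (hP : IsLRP J P) (hβ : 0 ≤ β) {F : Set (Sym2 (V d))} (hF : TI F) (x y z : V d) :
    tau (P β) F (x + z) (y + z) = tau (P β) F x y := by rw [tau_sh hJ hP hβ, hF]
lemma tau_ti0 (hJ : KernelHyp d J α c C) (hP : IsLRP J P) (hβ : 0 ≤ β) {F : Set (Sym2 (V d))} (hF : TI F) (x y : V d) :
    tau (P β) F x y = tau (P β) F 0 (y - x) := by
  have := tau_ti hJ hP hβ hF 0 (y - x) x; simpa using this
def ins (S : Set (V d)) : Set (Sym2 (V d)) := {e | ∀ v ∈ e, v ∈ S}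
lemma mem_ins {S : Set (V d)} {x y : V d} : s(x, y) ∈ ins S ↔ x ∈ S ∧ y ∈ S := by simp [ins]
open Classical in
lemma fe_in (hJ : KernelHyp d J α c C) (hP : IsLRP J P) (hβ : 0 ≤ β) (G : Sw (V d)) (S : Set (V d)) {x : V d} (hx : x ∈ S) (y : V d) :
    tau (P β) G x y ≤ tau (P β) (G ∩ ins S) x y + ∑' u, ∑' v, (if u ∈ S ∧ v ∉ S ∧ s(u, v) ∈ G then
      tau (P β) (G ∩ ins S) x u * oR (β * J u v) else 0) * tau (P β) G v y := by
  refine (first_edge (bern hJ hP hβ) (F := G ∩ ins S) x y).trans (add_le_add le_rfl ?_)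
  refine Qd fun u => Qd fun v => mul_le_mul_left ?_ _
  by_cases hu : u ∈ S
  · by_cases he : s(u, v) ∈ G \ (G ∩ ins S)
    · rw [QC he, if_pos ⟨hu, fun hv => he.2 ⟨he.1, mem_ins.2 ⟨hu, hv⟩⟩, he.1⟩]
      exact mul_le_mul_right (Qe ((pr_le β _).trans_eq (by rw [jw_mk hJ]))) _
    · rw [QD he, mul_zero]; exact zero_le
  · rw [tau_zero (S := S) (fun a b hab ha => (mem_ins.1 hab.2).2) hx hu, zero_mul]; exact zero_le
noncomputable def ch (P : ℝ → Measure (Config d)) (β : ℝ) : ℝ≥0∞ := ∑' x, tau (P β) Set.univ 0 x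
open Classical in
noncomputable def phi (J : V d → V d → ℝ) (P : ℝ → Measure (Config d)) (β : ℝ) (S : Finset (V d)) : ℝ≥0∞ :=
  ∑' u, ∑' v, if u ∈ S ∧ v ∉ S then tau (P β) (ins S) 0 u * oR (β * J u v) else 0
lemma ch_shift (hJ : KernelHyp d J α c C) (hP : IsLRP J P) (hβ : 0 ≤ β) (x : V d) : ∑' y, tau (P β) Set.univ x y = ch P β := by
  rw [ch, ← (Equiv.subRight x).tsum_eq (fun y => tau (P β) Set.univ 0 y)]
  exact tsum_congr fun y => by rw [tau_ti0 hJ hP hβ TI_univ]; rfl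
lemma sharp (hJ : KernelHyp d J α c C) (hP : IsLRP J P) (hβ : 0 ≤ β) (S : Finset (V d)) (h0 : 0 ∈ S) (hφ : phi J P β S < 1) :
    ch P β ≠ ∞ := by
  have B := bern hJ hP hβ
  set t := tau (P β) Set.univ
  have fin : ∀ A : Finset (V d), ∑ x ∈ A, t 0 x ≤ S.card / (1 - phi J P β S) := by
    intro A
    set X := ⨆ z, ∑ x ∈ A, t z x
    have hX : X ≤ A.card := iSup_le fun z => (QR A _ 1 fun x _ => tau_le_one B _ _ _).trans sy
    have hXt : X ≠ ∞ := ne_top_of_le_ne_top sy hX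
    have key : X ≤ S.card + phi J P β S * X := by
      refine iSup_le fun z => ?_
      have e1 : ∀ x, t z x = t 0 (x - z) := fun x => tau_ti0 hJ hP hβ TI_univ z x
      calc ∑ x ∈ A, t z x ≤ ∑ x ∈ A, (tau (P β) (ins S) 0 (x - z) + ∑' u, ∑' v, (if u ∈ S ∧ v ∉ S then
      tau (P β) (ins S) 0 u * oR (β * J u v) else 0) * t v (x - z)) := by
            refine Qj fun x _ => ?_
            rw [e1]
            have := fe_in hJ hP hβ Set.univ (S : Set (V d)) (x := 0) h0 (x - z)
            simpa using this
        _ = ∑ x ∈ A, tau (P β) (ins S) 0 (x - z) + ∑' u, ∑' v, (if u ∈ S ∧ v ∉ S then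
      tau (P β) (ins S) 0 u * oR (β * J u v) else 0) * ∑ x ∈ A, t v (x - z) := by
            rw [Finset.sum_add_distrib]; congr 1
            rw [← QE fun _ _ => QF]
            refine tsum_congr fun u => ?_
            rw [← QE fun _ _ => QF]
            exact tsum_congr fun v => by rw [Qv]
        _ ≤ S.card + phi J P β S * X := by
            refine add_le_add ?_ ?_
            · calc ∑ x ∈ A, tau (P β) (ins S) 0 (x - z) ≤ ∑' x, tau (P β) (ins S) 0 (x - z) := ENNReal.sum_le_tsum _
                _ = ∑' x, tau (P β) (ins S) 0 x := (Equiv.subRight z).tsum_eq _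
                _ = ∑ x ∈ S, tau (P β) (ins S) 0 x := tsum_eq_sum fun x hx =>
                    tau_zero (S := (S : Set (V d))) (fun a b hab _ => (mem_ins.1 hab).2) h0 hx
                _ ≤ S.card := (QR S _ 1 fun x _ => tau_le_one B _ _ _).trans sy
            · rw [phi, ← Qn]
              refine Qd fun u => ?_
              rw [← Qn]
              refine Qd fun v => mul_le_mul_right (le_trans (le_of_eq ?_) (le_iSup _ (v + z))) _
              refine Qi rfl fun x _ => ?_
              simp only [t]; rw [← tau_ti hJ hP hβ TI_univ v (x - z) z, sub_add_cancel]
    refine (le_iSup (fun z => ∑ x ∈ A, t z x) 0).trans ?_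
    rw [ENNReal.le_div_iff_mul_le (Or.inl (tsub_pos_of_lt hφ).ne') (Or.inl sy), ENNReal.mul_sub (fun _ _ => hXt), mul_one, mul_comm]
    exact tsub_le_iff_right.2 key
  refine ne_top_of_le_ne_top (b := S.card / (1 - phi J P β S)) (ENNReal.div_ne_top sy (tsub_pos_of_lt hφ).ne') ?_
  rw [ch, ENNReal.tsum_eq_iSup_sum]
  exact iSup_le fin
def cT (O : Sw (V d)) (x : V d) (T : Set (V d)) : Prop := ∃ t ∈ T, cn O x t
lemma meas_conn (x y : V d) : MeasurableSet {ω : Config d | cn (op ω) x y} := by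
  simpa using meas_cn (Set.univ : Sw (V d)) x y
lemma meas_cT (x : V d) (T : Set (V d)) : MeasurableSet {ω : Config d | cT (op ω) x T} := by
  have : {ω : Config d | cT (op ω) x T} = ⋃ t ∈ T, {ω | cn (op ω) x t} := by ext; simp [cT]
  rw [this]; exact MeasurableSet.biUnion (Set.to_countable _) fun t _ => meas_conn x t
lemma op_jn (x : Config d × Config d) : op (jn x) = op x.1 ∪ op x.2 := by
  ext e; simp [op, jn]
lemma sprinkle (hJ : KernelHyp d J α c C) (hP : IsLRP J P) (hβ : 0 ≤ β) (hδ : 0 ≤ δ) (T : Set (V d)) (E : Finset (V d × V d)) :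
    P β {ω | cT (op ω) 0 T} + oR (δ * Qc (-δ * ∑ e ∈ E, J e.1 e.2)) * ∑ e ∈ E, oR (J e.1 e.2) *
      P β {ω | cn (op ω) 0 e.1 ∧ cT (op ω) e.2 T ∧ ¬ cT (op ω) 0 T} ≤ P (β + δ) {ω | cT (op ω) 0 T} := by
  classical
  have Bδ := bern hJ hP hδ
  have B1 := (bern hJ hP hβ).prob
  have B2 := Bδ.prob
  set M := ∑ e ∈ E, J e.1 e.2
  set A : Set (Config d) := {ω | cT (op ω) 0 T}
  have hA : MeasurableSet A := meas_cT _ _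
  have hE : ∀ e : V d × V d, MeasurableSet {ω : Config d | cn (op ω) 0 e.1 ∧ cT (op ω) e.2 T ∧ ¬ cT (op ω) 0 T} := fun e =>
    (meas_conn _ _).inter ((meas_cT _ _).inter hA.compl)
  rw [← jn_map hJ hP hβ hδ, Measure.map_apply meas_jn hA, Measure.prod_apply (meas_jn hA)]
  calc _ = ∫⁻ ω, A.indicator 1 ω + oR (δ * Qc (-δ * M)) * ∑ e ∈ E, oR (J e.1 e.2) *
        {ω | cn (op ω) 0 e.1 ∧ cT (op ω) e.2 T ∧ ¬ cT (op ω) 0 T}.indicator 1 ω ∂(P β) := by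
        have mi : ∀ e : V d × V d, Measurable ({ω : Config d | cn (op ω) 0 e.1 ∧ cT (op ω) e.2 T ∧ ¬ cT (op ω) 0 T}.indicator (1 : Config d → ℝ≥0∞)) :=
          fun e => measurable_one.indicator (hE e)
        rw [lintegral_add_left (measurable_one.indicator hA), lintegral_indicator_one hA, lintegral_const_mul _
          (Zb _ fun e _ => (mi e).const_mul _), lintegral_finsetSum _ fun e _ => (mi e).const_mul _]
        congr 2
        refine Qi rfl fun e _ => ?_
        rw [lintegral_const_mul _ (mi e), lintegral_indicator_one (hE e)]
    _ ≤ _ := by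
      refine lintegral_mono fun ω => ?_
      by_cases hω : ω ∈ A
      · have h1 : Prod.mk ω ⁻¹' (jn ⁻¹' A) = Set.univ := by
          refine Set.eq_univ_of_forall fun ω' => ?_
          obtain ⟨t, ht, h⟩ := hω
          exact ⟨t, ht, h.mono (by rw [op_jn]; exact Set.subset_union_left)⟩
        have h2 : ∀ e : V d × V d, {ω : Config d | cn (op ω) 0 e.1 ∧ cT (op ω) e.2 T ∧ ¬ cT (op ω) 0 T}.indicator (1 : Config d → ℝ≥0∞) ω = 0 :=
          fun e => QD (fun h => h.2.2 hω) _
        simp [h1, h2, hω]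
      · set S := E.filter (fun e => cn (op ω) 0 e.1 ∧ cT (op ω) e.2 T)
        have h2 : ∑ e ∈ E, oR (J e.1 e.2) *
          {ω | cn (op ω) 0 e.1 ∧ cT (op ω) e.2 T ∧ ¬ cT (op ω) 0 T}.indicator (1 : Config d → ℝ≥0∞) ω = oR (∑ e ∈ S, J e.1 e.2) := by
          rw [Zy fun e _ => hJ.nonneg _ _, QV]
          refine Qi rfl fun e _ => ?_
          by_cases h : cn (op ω) 0 e.1 ∧ cT (op ω) e.2 T
          · rw [if_pos h, QC (show ω ∈ {ω | cn (op ω) 0 e.1 ∧ cT (op ω) e.2 T ∧ ¬ cT (op ω) 0 T} from ⟨h.1, h.2, hω⟩)]; simp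
          · rw [if_neg h, QD (show ω ∉ {ω | cn (op ω) 0 e.1 ∧ cT (op ω) e.2 T ∧ ¬ cT (op ω) 0 T} from fun h' => h ⟨h'.1, h'.2.1⟩), mul_zero]
        rw [h2, QD hω, zero_add]
        have inj : Set.InjOn (fun e : V d × V d => s(e.1, e.2)) S := by
          rintro ⟨u, v⟩ h ⟨u', v'⟩ h' heq
          simp only [S, Finset.coe_filter, Ql] at h h'
          rcases Zi.1 heq with ⟨rfl, rfl⟩ | ⟨h1, h2⟩
          · rfl
          · dsimp only at h1 h2 h h'
            obtain ⟨t, ht, hc⟩ := h.2.2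
            exact absurd ⟨t, ht, h'.2.1.trans (h2 ▸ hc)⟩ hω
        have hcl := Bδ.closed (S.image (fun e => s(e.1, e.2)))
        rw [Finset.prod_image inj] at hcl
        have hcl2 : P δ {ω' | ∀ e ∈ S.image (fun e => s(e.1, e.2)), ω' e = false} = oR (Qc (-δ * ∑ e ∈ S, J e.1 e.2)) := by
          rw [hcl, Qv, Real.exp_sum, ENNReal.ofReal_prod_of_nonneg fun _ _ => (Qq _).le]
          exact QW rfl fun e _ => by simp [pr, jw_mk hJ]
        have hs0 : 0 ≤ ∑ e ∈ S, J e.1 e.2 := Zl fun e _ => hJ.nonneg _ _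
        have hsM : ∑ e ∈ S, J e.1 e.2 ≤ M := Finset.sum_le_sum_of_subset_of_nonneg (Zx _ _) fun e _ _ => hJ.nonneg _ _
        calc oR (δ * Qc (-δ * M)) * oR (∑ e ∈ S, J e.1 e.2)
            ≤ oR (1 - Qc (-δ * ∑ e ∈ S, J e.1 e.2)) := by
              rw [← Qa (mul_nonneg hδ (Qq _).le)]
              refine Qe ?_
              set s := ∑ e ∈ S, J e.1 e.2
              have h1 := ZC (δ * s)
              have h2 : Qc (-δ * M) ≤ Qc (-δ * s) := QJ.2 (by nlinarith)
              have h3 := Qq (-δ * s)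
              have h4 : Qc (δ * s) * Qc (-δ * s) = 1 := by rw [← Za]; simp
              have h5 : 0 ≤ δ * s := mul_nonneg hδ hs0
              nlinarith [mnl h2 h5, mnr h1 h3.le]
          _ = P δ {ω' | ∀ e ∈ S.image (fun e => s(e.1, e.2)), ω' e = false}ᶜ := by
              rw [prob_compl_eq_one_sub (meas_cyl _ _), hcl2, Zk _ (Qq _).le, QP]
          _ ≤ _ := by
              refine measure_mono fun ω' h => ?_
              simp only [ZD, Ql, not_forall, Bool.not_eq_false] at h
              obtain ⟨e, he, ho⟩ := h
              obtain ⟨f, hf, rfl⟩ := Zm.1 he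
              obtain ⟨-, h1, t, ht, h2⟩ := Qf.1 hf
              have s1 : op ω ⊆ op (jn (ω, ω')) := by rw [op_jn]; exact Set.subset_union_left
              exact ⟨t, ht, (h1.mono s1).trans ((cn.one (by rw [op_jn]; exact Or.inr ho)).trans (h2.mono s1))⟩
end P5
section P6
variable {d : ℕ} {J : V d → V d → ℝ} {α c C : ℝ} {P : ℝ → Measure (Config d)} {β δ : ℝ}
lemma dini {g : ℝ → ℝ} {a b k : ℝ} (hab : a ≤ b) (hg : MonotoneOn g (Set.Icc a b))
    (h : ∀ t, a ≤ t → t < b → ∃ s, t < s ∧ s ≤ b ∧ g t + k * (s - t) ≤ g s) : g a + k * (b - a) ≤ g b := by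
  set A := {t | t ∈ Set.Icc a b ∧ g a + k * (t - a) ≤ g t}
  have ha : a ∈ A := ⟨⟨le_rfl, hab⟩, by simp⟩
  have hB : BddAbove A := ⟨b, fun t ht => ht.1.2⟩
  set s := sSup A
  have h1 : a ≤ s := le_csSup hB ha
  have h2 : s ≤ b := csSup_le ⟨a, ha⟩ fun t ht => ht.1.2
  have hs : g a + k * (s - a) ≤ g s := by
    refine le_of_forall_pos_le_add fun ε hε => ?_
    have hp : 0 < ε / (|k| + 1) := by positivity
    obtain ⟨t, ht, hlt⟩ := exists_lt_of_lt_csSup ⟨a, ha⟩ (show s - ε / (|k| + 1) < s by linarith)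
    have h3 : t ≤ s := le_csSup hB ht
    have h4 := hg ht.1 ⟨h1, h2⟩ h3
    have h5 : k * (s - t) ≤ ε := by
      have h6 : (s - t) ≤ ε / (|k| + 1) := by linarith
      rw [le_div_iff₀ py] at h6
      nlinarith [le_abs_self k, abs_nonneg k, mnr (le_abs_self k) (sub_nonneg.2 h3)]
    nlinarith [ht.2]
  rcases h2.lt_or_eq with h3 | h3
  · obtain ⟨r, hr1, hr2, hr3⟩ := h s h1 h3
    have : r ∈ A := ⟨⟨h1.trans hr1.le, hr2⟩, by nlinarith⟩
    exact absurd (le_csSup hB this) (not_le.2 hr1)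
  · rwa [h3] at hs
lemma cn_conn {ω : Config d} {x y : V d} : cn (op ω) x y ↔ conn ω x y := by
  constructor
  · intro h
    refine cn_ind (Q := fun x => conn ω x y) .refl (fun a b hab _ ih => ?_) h
    by_cases e : a = b
    · rwa [e]
    · exact .head ⟨e, hab⟩ ih
  · exact fun h => Relation.ReflTransGen.mono (fun a b h => h.2) _ _ h
lemma meas_dec_mono (hJ : KernelHyp d J α c C) (hP : IsLRP J P) (hβ : 0 ≤ β) (hδ : β ≤ δ) {A : Set (Config d)} (hA : MeasurableSet A)
    (hm : ∀ ω ω', op ω ⊆ op ω' → ω ∈ A → ω' ∈ A) : P β A ≤ P δ A := by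
  have h0 : 0 ≤ δ - β := sub_nonneg.2 hδ
  have := (bern hJ hP hβ).prob
  have := (bern hJ hP h0).prob
  have e : P δ A = ((P β).prod (P (δ - β))) (jn ⁻¹' A) := by
    rw [← Measure.map_apply meas_jn hA, jn_map hJ hP hβ h0]; congr 2; ring
  rw [e]
  calc P β A = ((P β).prod (P (δ - β))) (A ×ˢ Set.univ) := by rw [Measure.prod_prod]; simp
    _ ≤ _ := measure_mono fun x hx => hm x.1 _ (by rw [op_jn]; exact Set.subset_union_left) hx.1
lemma cT_mono {O O' : Set (Sym2 (V d))} (h : O ⊆ O') {x : V d} {T : Set (V d)} : cT O x T → cT O' x T :=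
  fun ⟨t, ht, hc⟩ => ⟨t, ht, hc.mono h⟩
lemma cT_step {O : Set (Sym2 (V d))} {x y : V d} {T : Set (V d)} (h : cn O x y) : cT O y T → cT O x T :=
  fun ⟨t, ht, hc⟩ => ⟨t, ht, h.trans hc⟩
def ES (Λ S : Finset (V d)) : Set (Config d) := {ω | ∀ x, x ∈ S ↔ x ∈ Λ ∧ ¬ cT (op ω) x (↑Λ)ᶜ}
lemma meas_ES (Λ S : Finset (V d)) : MeasurableSet (ES Λ S) := by
  have : ES Λ S = ⋂ x, {ω | x ∈ S ↔ x ∈ Λ ∧ ¬ cT (op ω) x (↑Λ)ᶜ} := by ext; simp [ES]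
  rw [this]
  refine MeasurableSet.iInter fun x => ?_
  by_cases h1 : x ∈ S <;> by_cases h2 : x ∈ Λ <;> simp only [h1, h2, true_and, false_and, true_iff, false_iff, not_not, MeasurableSet.const]
  exacts [(meas_cT _ _).compl, meas_cT _ _]
lemma dep_ES (Λ S : Finset (V d)) : dep (ins (S : Set (V d)))ᶜ (ES Λ S) := by
  intro ω ω' h hω
  have sub : ∀ x ∈ Λ, x ∉ S → cT (op ω') x (↑Λ)ᶜ := fun x hx hxS => by
    have : cT (op ω) x (↑Λ)ᶜ := by
      by_contra h'; exact hxS ((hω x).2 ⟨hx, h'⟩)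
    obtain ⟨t, ht, hc⟩ := this
    refine ⟨t, ht, cn_ind (Q := fun x => cn (op ω') x t) .refl (fun a b hab hb ih => (cn.one (O := op ω') ?_).trans ih) hc⟩
    have ha : a ∉ S := fun haS => ((hω a).1 haS).2 ⟨t, ht, (cn.one (O := op ω) hab).trans hb⟩
    have : s(a, b) ∈ (ins (S : Set (V d)))ᶜ := fun h => ha (mem_ins.1 h).1
    exact (h _ this).symm.trans hab
  intro x
  by_cases hxS : x ∈ S
  · refine ⟨fun _ => ⟨((hω x).1 hxS).1, ?_⟩, fun _ => hxS⟩
    rintro ⟨t, ht, hc⟩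
    have := cn_ind (Q := fun x => x ∉ S) (fun h => ht ((hω t).1 h).1) (fun a b hab hb ih haS => ?_) hc
    · exact this hxS
    · have he : s(a, b) ∈ (ins (S : Set (V d)))ᶜ := fun h => ih (mem_ins.1 h).2
      have hab' : s(a, b) ∈ op ω := (h _ he).trans hab
      refine ((hω a).1 haS).2 (cT_step (cn.one hab') ?_)
      by_cases hb : b ∈ Λ
      · by_contra h'; exact ih ((hω b).2 ⟨hb, h'⟩)
      · exact ⟨b, hb, .refl⟩
  · exact ⟨fun h => absurd h hxS, fun h' => absurd (sub x h'.1 hxS) h'.2⟩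
lemma dep_cn (F : Sw (V d)) (x y : V d) : dep F {ω : Config d | cn (op ω ∩ F) x y} := by
  intro ω ω' h hω
  exact cn.mono (O := op ω ∩ F) (O' := op ω' ∩ F) (fun e he => ⟨(h e he.2).symm.trans he.1, he.2⟩) hω
lemma pivot_sum (hJ : KernelHyp d J α c C) (hP : IsLRP J P) (hβ : 0 ≤ β) (Λ : Finset (V d)) (h0 : 0 ∈ Λ) (hφ : ∀ S : Finset (V d), 0 ∈ S → 1 ≤ phi J P β S) :
    1 - P β {ω | cT (op ω) 0 (↑Λ)ᶜ} ≤ oR β * ∑' u, ∑' v, oR (J u v) *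
      P β {ω | cn (op ω) 0 u ∧ cT (op ω) v (↑Λ)ᶜ ∧ ¬ cT (op ω) 0 (↑Λ)ᶜ} := by
  classical
  have B := bern hJ hP hβ
  have := B.prob
  set PS := Λ.powerset.filter (fun S => 0 ∈ S)
  have h1 : 1 - P β {ω | cT (op ω) 0 (↑Λ)ᶜ} ≤ ∑ S ∈ PS, P β (ES Λ S) := by
    rw [← prob_compl_eq_one_sub (meas_cT _ _)]
    refine (measure_mono fun ω hω => ?_).trans (measure_biUnion_finset_le PS (ES Λ))
    simp only [Qy]
    refine ⟨Λ.filter (fun x => ¬ cT (op ω) x (↑Λ)ᶜ), ?_, fun x => by simp⟩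
    simp only [PS, Qf, QH, Zx, true_and]
    exact ⟨h0, hω⟩
  have h2 : ∀ u v, ∑ S ∈ PS, (if u ∈ S ∧ v ∉ S then tau (P β) (ins S) 0 u else 0) * P β (ES Λ S) ≤
      P β {ω | cn (op ω) 0 u ∧ cT (op ω) v (↑Λ)ᶜ ∧ ¬ cT (op ω) 0 (↑Λ)ᶜ} := by
    intro u v
    calc _ = ∑ S ∈ PS, P β (if u ∈ S ∧ v ∉ S then {ω | cn (op ω ∩ ins S) 0 u} ∩ ES Λ S else ∅) := by
          refine Qi rfl fun S _ => ?_
          split_ifs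
          · exact (B.indep (meas_cn _ _ _) (meas_ES _ _) (dep_cn _ _ _) (dep_ES _ _) disjoint_compl_right).symm
          · simp
      _ = P β (⋃ S ∈ PS, if u ∈ S ∧ v ∉ S then {ω | cn (op ω ∩ ins S) 0 u} ∩ ES Λ S else ∅) := by
          refine (measure_biUnion_finset ?_ ?_).symm
          · intro S _ S' _ hne
            refine Set.disjoint_left.2 fun ω hω hω' => hne ?_
            dsimp only at hω hω'
            split_ifs at hω hω' <;> try exact absurd ‹ω ∈ (∅ : Set _)› (Set.notMem_empty _)
            ext x; rw [hω.2 x, hω'.2 x]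
          · intro S _
            split_ifs
            · exact (meas_cn _ _ _).inter (meas_ES _ _)
            · exact .empty
      _ ≤ _ := by
          refine measure_mono (Set.iUnion₂_subset fun S hS ω hω => ?_)
          split_ifs at hω with hc
          · obtain ⟨ha, hb⟩ := hω
            have h0S := (Qf.1 hS).2
            refine ⟨cn.mono QZ ha, ?_, ((hb 0).1 h0S).2⟩
            by_cases hv : v ∈ Λ
            · by_contra h'; exact hc.2 ((hb v).2 ⟨hv, h'⟩)
            · exact ⟨v, hv, .refl⟩
          · exact absurd hω (Set.notMem_empty _)
  refine h1.trans ?_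
  calc ∑ S ∈ PS, P β (ES Λ S) ≤ ∑ S ∈ PS, phi J P β S * P β (ES Λ S) :=
        Qj fun S hS => le_mul_of_one_le_left zero_le (hφ S (Qf.1 hS).2)
    _ = ∑' u, ∑' v, oR (β * J u v) * ∑ S ∈ PS, (if u ∈ S ∧ v ∉ S then tau (P β) (ins S) 0 u else 0) * P β (ES Λ S) := by
        simp only [phi, ← Qn]
        rw [← QE fun _ _ => QF]
        refine tsum_congr fun u => ?_
        rw [← QE fun _ _ => QF]
        refine tsum_congr fun v => ?_
        rw [Qv]
        refine Qi rfl fun S _ => ?_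
        split_ifs
        · ring
        · simp
    _ ≤ _ := by
        rw [← Qg]
        refine Qd fun u => ?_
        rw [← Qg]
        refine Qd fun v => ?_
        rw [Qa hβ, mul_assoc]
        exact mul_le_mul_right (mul_le_mul_right (h2 u v) _) _
lemma sprinkle' (hJ : KernelHyp d J α c C) (hP : IsLRP J P) (hβ : 0 ≤ β) (T : Set (V d)) {k : ℝ}
    (hk : oR k < ∑' u, ∑' v, oR (J u v) * P β {ω | cn (op ω) 0 u ∧ cT (op ω) v T ∧ ¬ cT (op ω) 0 T}) :
    ∃ δ₀ > 0, ∀ δ, 0 ≤ δ → δ ≤ δ₀ → P β {ω | cT (op ω) 0 T} + oR (k * δ) ≤ P (β + δ) {ω | cT (op ω) 0 T} := by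
  rw [← ENNReal.tsum_prod, ENNReal.tsum_eq_iSup_sum, lt_iSup_iff] at hk
  obtain ⟨E, hE⟩ := hk
  have B := (bern hJ hP hβ).prob
  set M := ∑ e ∈ E, J e.1 e.2
  set R := ∑ e ∈ E, oR (J e.1 e.2) * P β {ω | cn (op ω) 0 e.1 ∧ cT (op ω) e.2 T ∧ ¬ cT (op ω) 0 T}
  have hM : 0 ≤ M := Zl fun e _ => hJ.nonneg _ _
  have hR : R ≠ ∞ := (ENNReal.sum_lt_top.2 fun e _ => ENNReal.mul_lt_top sy (measure_lt_top _ _)).ne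
  have hkR : k < R.toReal ∧ 0 < R.toReal := by
    have h0 : 0 < R := zero_le.trans_lt hE
    exact ⟨lt_of_not_ge fun h => hE.not_ge ((ENNReal.le_ofReal_iff_toReal_le hR (QK.trans h)).2 h), ENNReal.toReal_pos h0.ne' hR⟩
  have : QX (fun δ : ℝ => Qc (-δ * M) * R.toReal) (nhds 0) (nhds (Qc (-0 * M) * R.toReal)) :=
    Continuous.tendsto (by fun_prop) 0
  have := this.eventually (lt_mem_nhds (show k < Qc (-0 * M) * R.toReal by simpa using hkR.1))
  obtain ⟨ε, hε, hb⟩ := Metric.eventually_nhds_iff.1 this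
  refine ⟨ε / 2, by positivity, fun δ h0 h1 => (add_le_add le_rfl ?_).trans (sprinkle hJ hP hβ h0 T E)⟩
  have := hb (y := δ) (by rw [Real.dist_eq, sub_zero, abs_of_nonneg h0]; linarith)
  change _ ≤ _ * R
  rw [← QA hR, ← Qa (mul_nonneg h0 (Qq _).le)]
  exact Qe (by nlinarith)
lemma theta_fin (hJ : KernelHyp d J α c C) (hP : IsLRP J P) {a b : ℝ} (ha : 0 < a) (hab : a ≤ b) (hχ : ∀ t, a ≤ t → ch P t = ∞)
    (Λ : Finset (V d)) (h0 : 0 ∈ Λ) : oR (min (1/2) ((b - a) / (2 * b))) ≤ P b {ω | cT (op ω) 0 (↑Λ)ᶜ} := by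
  set g : ℝ → ℝ := fun t => (P t {ω | cT (op ω) 0 (↑Λ)ᶜ}).toReal
  have hb : 0 < b := ha.trans_le hab
  have pb : ∀ {t}, 0 ≤ t → IsProbabilityMeasure (P t) := fun ht => (bern hJ hP ht).prob
  have fin : ∀ t, 0 ≤ t → P t {ω | cT (op ω) 0 (↑Λ)ᶜ} ≠ ∞ := fun t ht => by
    have := pb ht; exact measure_ne_top _ _
  have mono : ∀ s t, 0 ≤ s → s ≤ t → g s ≤ g t := fun s t hs hst =>
    QS (fin t (hs.trans hst)) (meas_dec_mono hJ hP hs hst (meas_cT _ _) fun ω ω' h => cT_mono h)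
  have e : P b {ω | cT (op ω) 0 (↑Λ)ᶜ} = oR (g b) := (QA (fin b hb.le)).symm
  rw [e]
  refine Qe ?_
  by_cases hg : 1/2 ≤ g b
  · exact (min_le_left _ _).trans hg
  push Not at hg
  refine (min_le_right _ _).trans ?_
  have key : ∀ k, 0 ≤ k → k < 1 / (2 * b) → g a + k * (b - a) ≤ g b := by
    intro k hk0 hk
    refine dini hab (fun s hs t _ hst => mono s t (ha.le.trans hs.1) hst) fun t hat htb => ?_
    have ht : 0 < t := ha.trans_le hat
    have := pb ht.le
    have h1 := pivot_sum hJ hP ht.le Λ h0 fun S hS => by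
      by_contra h; exact sharp hJ hP ht.le S hS (not_le.1 h) (hχ t hat)
    have h2 : oR k < ∑' u, ∑' v, oR (J u v) * P t {ω | cn (op ω) 0 u ∧ cT (op ω) v (↑Λ)ᶜ ∧ ¬ cT (op ω) 0 (↑Λ)ᶜ} := by
      by_contra h
      have h3 := h1.trans (mul_le_mul_right (not_lt.1 h) _)
      have e : P t {ω | cT (op ω) 0 (↑Λ)ᶜ} = oR (g t) := (QA (fin t ht.le)).symm
      rw [e, ← Qa ht.le, ← QP, ← Zk _ QK,
        Zn py] at h3
      have h4 := mono t b ht.le htb.le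
      rw [lt_div_iff₀ py] at hk
      nlinarith
    obtain ⟨δ, hδ, h⟩ := sprinkle' hJ hP ht.le _ h2
    have h5 := h (min δ (b - t)) (le_min hδ.le ly) (min_le_left _ _)
    have hpos : 0 < min δ (b - t) := lt_min hδ ly
    refine ⟨t + min δ (b - t), by linarith, by linarith [min_le_right δ (b - t)], ?_⟩
    have h6 := QS (fin _ ly) h5
    rw [ENNReal.toReal_add (fin t ht.le) sy, ENNReal.toReal_ofReal py] at h6
    simpa using h6
  have ga : 0 ≤ g a := QK
  refine le_of_forall_pos_lt_add fun ε hε => ?_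
  rcases hab.eq_or_lt with rfl | hlt
  · simp; positivity
  have h1 : 0 < 1 / (2 * b) := by positivity
  set η := min (1 / (2 * b)) (ε / (b - a)) / 2
  have hba : 0 < b - a := by linarith
  have hη : 0 < η := by have : 0 < ε / (b - a) := py; positivity
  have h2 := key (1 / (2 * b) - η) (by have := min_le_left (1 / (2 * b)) (ε / (b - a)); simp only [η] at hη ⊢; linarith) ly
  have h3 : η * (b - a) < ε := by
    have : η < ε / (b - a) := by have := min_le_right (1 / (2 * b)) (ε / (b - a)); simp only [η] at hη ⊢; linarith
    rwa [lt_div_iff₀ hba] at this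
  have : (b - a) / (2 * b) = 1 / (2 * b) * (b - a) := by ring
  rw [this]; nlinarith
lemma inf_iff {ω : Config d} {x : V d} : (cluster ω x).Infinite ↔ ∀ n, cT (op ω) x (↑(box d n))ᶜ := by
  constructor
  · intro h n
    obtain ⟨y, hy, hy'⟩ := h.exists_notMem_finset (box d n)
    exact ⟨y, hy', cn_conn.2 hy⟩
  · intro h hf
    obtain ⟨n, hn⟩ : ∃ n, ∀ y ∈ cluster ω x, normInf y ≤ n := by
      obtain ⟨n, hn⟩ := (hf.image normInf).bddAbove
      exact ⟨n, fun y hy => hn ⟨y, hy, rfl⟩⟩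
    obtain ⟨y, hy, hc⟩ := h n
    exact hy (mem_box.2 (hn y (cn_conn.1 hc)))
lemma theta_lb (hJ : KernelHyp d J α c C) (hP : IsLRP J P) {a b : ℝ} (ha : 0 < a) (hab : a ≤ b) (hχ : ∀ t, a ≤ t → ch P t = ∞) :
    oR (min (1/2) ((b - a) / (2 * b))) ≤ P b {ω | (cluster ω 0).Infinite} := by
  have := (bern hJ hP (ha.le.trans hab)).prob
  have e : {ω : Config d | (cluster ω 0).Infinite} = ⋂ n, {ω | cT (op ω) 0 (↑(box d n))ᶜ} := by
    ext ω; simp [inf_iff]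
  have mono : Antitone fun n => {ω : Config d | cT (op ω) 0 (↑(box d n))ᶜ} := fun m n h ω ⟨t, ht, hc⟩ =>
    ⟨t, fun h' => ht (mem_box.2 ((mem_box.1 h').trans h)), hc⟩
  rw [e]
  refine ge_of_tendsto' (tendsto_measure_iInter_atTop (fun n => (meas_cT _ _).nullMeasurableSet) mono ⟨0, measure_ne_top _ _⟩) fun n => ?_
  exact theta_fin hJ hP ha hab hχ (box d n) (mem_box.2 (by simp [nI_zero]))
lemma ch_mono (hJ : KernelHyp d J α c C) (hP : IsLRP J P) (hβ : 0 ≤ β) (hδ : β ≤ δ) : ch P β ≤ ch P δ :=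
  Qd fun x => meas_dec_mono hJ hP hβ hδ (meas_cn _ _ _) fun ω ω' h hc => hc.mono (Set.inter_subset_inter_left _ h)
lemma ch_inf (hJ : KernelHyp d J α c C) (hP : IsLRP J P) (hβ : 0 ≤ β) (h : 0 < P β {ω | ∃ x, (cluster ω x).Infinite}) : ch P β = ∞ := by
  obtain ⟨x, hx⟩ : ∃ x, 0 < P β {ω | (cluster ω x).Infinite} := by
    by_contra! h'
    have : P β (⋃ x, {ω | (cluster ω x).Infinite}) = 0 := measure_iUnion_null fun x => le_antisymm (h' x) zero_le
    refine h.ne' (le_antisymm ((measure_mono ?_).trans this.le) zero_le)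
    intro ω ⟨x, hx⟩; exact Qy.2 ⟨x, hx⟩
  rw [← ch_shift hJ hP hβ x]
  have e : ∀ y, tau (P β) Set.univ x y = ∫⁻ ω, {ω | cn (op ω ∩ Set.univ) x y}.indicator 1 ω ∂(P β) := fun y =>
    (lintegral_indicator_one (meas_cn _ _ _)).symm
  simp_rw [e]
  rw [← lintegral_tsum fun y => (measurable_one.indicator (meas_cn _ _ _)).aemeasurable]
  refine top_le_iff.1 (le_trans ?_ (lintegral_mono (f := {ω | (cluster ω x).Infinite}.indicator fun _ => ∞) fun ω => ?_))
  · have hm : MeasurableSet {ω : Config d | (cluster ω x).Infinite} := by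
      have e : {ω : Config d | (cluster ω x).Infinite} = ⋂ n, {ω | cT (op ω) x (↑(box d n))ᶜ} := by
        ext ω; simp [inf_iff]
      rw [e]; exact MeasurableSet.iInter fun n => meas_cT _ _
    rw [lintegral_indicator_const hm, ENNReal.top_mul hx.ne']
  · by_cases hω : (cluster ω x).Infinite
    · rw [QC (show ω ∈ {ω | (cluster ω x).Infinite} from hω)]
      have := hω.to_subtype
      calc ∞ = ∑' y : cluster ω x, (1 : ℝ≥0∞) := (ENNReal.tsum_const_eq_top_of_ne_zero one_ne_zero).symm
        _ ≤ ∑' y : cluster ω x, {ω | cn (op ω ∩ Set.univ) x y}.indicator 1 ω := Qd fun y => by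
            rw [QC (show ω ∈ {ω | cn (op ω ∩ Set.univ) x y} by simpa using cn_conn.2 y.2)]; rfl
        _ ≤ _ := ENNReal.tsum_comp_le_tsum_of_injective Subtype.val_injective _
    · rw [QD (show ω ∉ {ω | (cluster ω x).Infinite} from hω)]; exact zero_le
noncomputable def JJ (J : V d → V d → ℝ) : ℝ := ∑' x, J 0 x
lemma JJ_pos (hJ : KernelHyp d J α c C) : 0 < JJ J := by
  obtain ⟨x, hx⟩ : ∃ x : V d, 0 ≠ x := by
    refine ⟨fun _ => 1, fun h => ?_⟩
    have := congrFun h ⟨0, hJ.d_pos⟩; simp at this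
  refine hJ.integrable.tsum_pos (fun x => hJ.nonneg _ _) x (lt_of_lt_of_le ?_ (hJ.lower 0 x hx))
  have : normInf (0 - x) ≠ 0 := fun h => hx (sub_eq_zero.1 (nI_eq0.1 h))
  have := hJ.c_pos
  positivity
lemma JJ_sum (hJ : KernelHyp d J α c C) (x : V d) : ∑' y, oR (J x y) = oR (JJ J) := by
  rw [JJ, ENNReal.ofReal_tsum_of_nonneg (fun y => hJ.nonneg _ _) hJ.integrable, ← (Equiv.subRight x).tsum_eq (fun y => oR (J 0 y))]
  refine tsum_congr fun y => ?_
  have := hJ.transInv 0 (y - x) x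
  simp at this; simp [this]
lemma ch_small (hJ : KernelHyp d J α c C) (hP : IsLRP J P) (hβ : 0 ≤ β) (h : β * JJ J < 1) : ch P β ≠ ∞ := by
  refine sharp hJ hP hβ {0} sy ?_
  calc phi J P β {0} ≤ ∑' v, oR (β * J 0 v) := by
        rw [phi, tsum_eq_single 0 (fun u hu => by simp [hu])]
        refine Qd fun v => ?_
        split_ifs
        · exact mul_le_of_le_one_left zero_le (tau_le_one (bern hJ hP hβ) _ _ _)
        · exact zero_le
    _ = oR (β * JJ J) := by
        simp_rw [Qa hβ]; rw [Qg, JJ_sum hJ]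
    _ < 1 := by simpa using h
lemma bc_lt (hJ : KernelHyp d J α c C) (hP : IsLRP J P) (hβ : 0 ≤ β) (h : β < betaC P) : ch P β ≠ ∞ := by
  intro hχ
  have hb : 0 < β := lt_of_le_of_ne hβ fun h => ch_small hJ hP hβ (by rw [← h]; simp) hχ
  have h1 := theta_lb hJ hP hb (b := (β + betaC P) / 2) ly fun t ht => top_le_iff.1 (hχ ▸ ch_mono hJ hP hβ ht)
  have h2 : betaC P ≤ (β + betaC P) / 2 := csInf_le ⟨0, fun t ht => ht.1⟩ ⟨by linarith, lt_of_lt_of_le (ENNReal.ofReal_pos.2 (lt_min ny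
    (div_pos ly ly))) (h1.trans (measure_mono fun ω h => ⟨0, h⟩))⟩
  linarith
lemma bc_gt (hJ : KernelHyp d J α c C) (hP : IsLRP J P) (hex : ∃ β, 0 ≤ β ∧ ch P β = ∞) (h : betaC P < β) : ch P β = ∞ := by
  obtain ⟨β₁, h0, h1⟩ := hex
  have hb : 0 < β₁ := lt_of_le_of_ne h0 fun h => ch_small hJ hP h0 (by rw [← h]; simp) h1
  have h2 := theta_lb hJ hP hb (b := β₁ + 1) ly fun t ht => top_le_iff.1 (h1 ▸ ch_mono hJ hP h0 ht)
  obtain ⟨b, hb1, hb2⟩ := exists_lt_of_csInf_lt (s := {β : ℝ | 0 ≤ β ∧ 0 < P β {ω | ∃ x, (cluster ω x).Infinite}}) ⟨β₁ + 1, by linarith,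
    lt_of_lt_of_le (ENNReal.ofReal_pos.2 (lt_min ny (div_pos ly ly))) (h2.trans (measure_mono fun ω h => ⟨0, h⟩))⟩ h
  exact top_le_iff.1 (ch_inf hJ hP hb1.1 hb1.2 ▸ ch_mono hJ hP hb1.1 hb2.le)
lemma bc_pos (hJ : KernelHyp d J α c C) (hP : IsLRP J P) (hex : ∃ β, 0 ≤ β ∧ ch P β = ∞) : 1 / JJ J ≤ betaC P := by
  by_contra! h
  obtain ⟨b, h1, h2⟩ := exists_between h
  have h0 : 0 ≤ betaC P := Real.sInf_nonneg fun t ht => ht.1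
  exact ch_small hJ hP (h0.trans h1.le) (by rwa [lt_div_iff₀ (JJ_pos hJ)] at h2) (bc_gt hJ hP hex h1)
lemma theta_bc (hJ : KernelHyp d J α c C) (hP : IsLRP J P) (hex : ∃ β, 0 ≤ β ∧ ch P β = ∞) {ε : ℝ} (hε : 0 < ε) :
    oR (min (1/2) (ε / (4 * (betaC P + ε)))) ≤ P (betaC P + ε) {ω | (cluster ω 0).Infinite} := by
  have h0 : 0 < betaC P := lt_of_lt_of_le (by have := JJ_pos hJ; positivity) (bc_pos hJ hP hex)
  refine le_trans (Qe (min_le_min le_rfl (le_of_eq ?_))) (theta_lb hJ hP (a := betaC P + ε / 2) ly ly fun t ht => bc_gt hJ hP hex ly)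
  field_simp; ring
end P6
section P7
variable {d : ℕ} {J : V d → V d → ℝ} {α c C : ℝ} {P : ℝ → Measure (Config d)} {β δ : ℝ}
noncomputable def bx (d L : ℕ) (z : V d) : Finset (V d) := Fintype.piFinset fun i => ZE (z i) (z i + L)
lemma mem_bx {L : ℕ} {x z : V d} : x ∈ bx d L z ↔ ∀ i, z i ≤ x i ∧ x i < z i + L := by simp [bx]
lemma card_bx (L : ℕ) (z : V d) : (bx d L z).card = L ^ d := by simp [bx, Fintype.card_piFinset]
lemma bx_add {L : ℕ} {x z w : V d} : x + w ∈ bx d L (z + w) ↔ x ∈ bx d L z := by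
  simp only [mem_bx, Pi.add_apply]; exact forall_congr' fun i => by omega
def Fl (d L : ℕ) : Set (Sym2 (V d)) := {e | ∃ x y, e = s(x, y) ∧ normInf (x - y) ≤ L}
lemma mem_Fl {L : ℕ} {x y : V d} : s(x, y) ∈ Fl d L ↔ normInf (x - y) ≤ L := by
  constructor
  · rintro ⟨a, b, h, hl⟩
    rcases Zi.1 h with ⟨rfl, rfl⟩ | ⟨rfl, rfl⟩
    · exact hl
    · rwa [nI_sub_comm]
  · exact fun h => ⟨x, y, rfl, h⟩
lemma TI_Fl (L : ℕ) : TI (Fl d L) := fun z => by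
  ext e; induction e with | _ x y => simp [sh, mem_Fl]
lemma Fl_mono {L L' : ℕ} (h : L ≤ L') : Fl d L ⊆ Fl d L' := fun _ ⟨x, y, e, hl⟩ => ⟨x, y, e, hl.trans h⟩
lemma mk_sh (L : ℕ) (O : Sw (V d)) (x z w : V d) : mk (bx d L (w + z)) O (x + z) = mk (bx d L w) (sh z ⁻¹' O) x := by
  classical
  unfold mk
  refine (Finset.card_bij (fun y _ => y + z) (fun y hy => ?_) (fun _ _ _ _ h => add_right_cancel h) fun y hy => ⟨y - z, ?_, sub_add_cancel _ _⟩).symm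
  · simp only [Qf] at hy ⊢
    exact ⟨bx_add.2 hy.1, cn_sh.1 hy.2⟩
  · simp only [Qf] at hy ⊢
    exact ⟨bx_add (w := z).1 (by simpa using hy.1), cn_sh.2 (by simpa using hy.2)⟩
lemma meas_qq (b : Finset (V d)) (F : Sw (V d)) (n : ℕ) : MeasurableSet {ω : Config d | ∃ x, n ≤ mk b (op ω ∩ F) x} := by
  rw [← Dn_famQ]; exact meas_Dn _
lemma meas_mk (b : Finset (V d)) (F : Sw (V d)) (n : ℕ) (x : V d) : MeasurableSet {ω : Config d | n ≤ mk b (op ω ∩ F) x} := by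
  rw [← Dn_famM]; exact meas_Dn _
lemma qq_sh (hJ : KernelHyp d J α c C) (hP : IsLRP J P) (hβ : 0 ≤ β) {F : Set (Sym2 (V d))} (hF : TI F) (L n : ℕ) (z : V d) :
    qq (P β) (bx d L z) F n = qq (P β) (bx d L 0) F n := by
  have hm : Measurable (fun (ω : Config d) e => ω (sh z e)) := measurable_pi_iff.2 fun e => measurable_pi_apply _
  conv_rhs => rw [qq, ← map_sh hJ hP hβ z, Measure.map_apply hm (meas_qq _ _ _)]
  unfold qq; congr 1; ext ω
  have : op (fun e => ω (sh z e)) ∩ F = sh z ⁻¹' (op ω ∩ F) := by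
    rw [Set.preimage_inter, hF z]; rfl
  simp only [Ql, Set.mem_preimage, this, ← mk_sh, zero_add]
  exact ⟨fun ⟨x, h⟩ => ⟨x - z, by simpa using h⟩, fun ⟨x, h⟩ => ⟨x + z, h⟩⟩
lemma cross (hJ : KernelHyp d J α c C) (hP : IsLRP J P) (hβ : 0 ≤ β) (S S' : Finset (V d)) (hd : Disjoint S S') {q : ℝ}
    (hq : ∀ a ∈ S, ∀ b ∈ S', q ≤ J a b) :
    P β {ω | ∀ a ∈ S, ∀ b ∈ S', s(a, b) ∉ op ω} ≤ oR (Qc (-β * (q * (S.card * S'.card)))) := by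
  classical
  have e : {ω : Config d | ∀ a ∈ S, ∀ b ∈ S', s(a, b) ∉ op ω} = {ω | ∀ e ∈ (S ×ˢ S').image (fun e => s(e.1, e.2)), ω e = false} := by
    ext ω; simp only [op, Ql, Zm, Finset.mem_product, Bool.not_eq_true]
    exact ⟨by rintro h _ ⟨x, hx, rfl⟩; exact h _ hx.1 _ hx.2, fun h a ha b hb => h _ ⟨(a, b), ⟨ha, hb⟩, rfl⟩⟩
  rw [e, (bern hJ hP hβ).closed, Finset.prod_image, ← ENNReal.ofReal_prod_of_nonneg fun e _ => by simp [pr, (Qq _).le]]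
  · refine Qe ?_
    calc ∏ e ∈ S ×ˢ S', (1 - pr J β s(e.1, e.2)) = Qc (∑ e ∈ S ×ˢ S', -β * J e.1 e.2) := by
          rw [Real.exp_sum]; exact QW rfl fun e _ => by simp [pr, jw_mk hJ]
      _ ≤ _ := by
          refine QJ.2 ?_
          rw [← Qv]
          have : (S ×ˢ S').card • q ≤ ∑ e ∈ S ×ˢ S', J e.1 e.2 := Zo _ _ _ fun e he =>
            hq _ (Finset.mem_product.1 he).1 _ (Finset.mem_product.1 he).2
          rw [Finset.card_product, nsmul_eq_mul] at this; push_cast at this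
          nlinarith
  · rintro ⟨a, b⟩ h ⟨a', b'⟩ h' he
    simp only [Finset.coe_product, Set.mem_prod, Finset.mem_coe] at h h'
    rcases Zi.1 he with ⟨rfl, rfl⟩ | ⟨h1, h2⟩
    · rfl
    · dsimp only at h1 h2 h h'
      exact absurd h'.2 (Zf.1 hd (h1 ▸ h.1))
noncomputable def sb (d L : ℕ) {M : ℕ} (i : Fin d → Fin M) : Finset (V d) := bx d L fun t => 2 * L * (i t : ℤ)
lemma sb_sub {L M : ℕ} (i : Fin d → Fin M) : sb d L i ⊆ bx d (2 * M * L) 0 := by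
  intro x hx
  rw [sb, mem_bx] at hx
  refine mem_bx.2 fun t => ?_
  have h1 := hx t
  have h2 : (i t : ℤ) + 1 ≤ M := by have := (i t).2; omega
  have h3 : (0 : ℤ) ≤ (i t : ℕ) := by positivity
  have h4 : (0 : ℤ) ≤ L := by positivity
  simp only [Pi.zero_apply]; push_cast
  constructor <;> nlinarith
lemma sb_geo {L M : ℕ} {i j : Fin d → Fin M} (hij : i ≠ j) {x y : V d} (hx : x ∈ sb d L i) (hy : y ∈ sb d L j) :
    L < normInf (x - y) ∧ normInf (x - y) ≤ 2 * M * L := by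
  constructor
  · by_contra! h
    refine hij (funext fun t => ?_)
    by_contra hne
    rw [sb, mem_bx] at hx hy
    have h1 := hx t; have h2 := hy t
    have h3 := nI_le.1 h t
    simp only [Pi.sub_apply] at h3
    have hL : (0 : ℤ) ≤ L := by positivity
    rcases lt_or_gt_of_ne hne with h | h
    · have : (i t : ℤ) + 1 ≤ j t := by have := Fin.lt_def.1 h; omega
      have : 2 * (L : ℤ) * (i t : ℕ) + 2 * L ≤ 2 * L * (j t : ℕ) := by nlinarith
      omega
    · have : (j t : ℤ) + 1 ≤ i t := by have := Fin.lt_def.1 h; omega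
      have : 2 * (L : ℤ) * (j t : ℕ) + 2 * L ≤ 2 * L * (i t : ℕ) := by nlinarith
      omega
  · refine nI_le.2 fun t => ?_
    have h1 := mem_bx.1 (sb_sub i hx) t; have h2 := mem_bx.1 (sb_sub j hy) t
    simp only [Pi.zero_apply, Pi.sub_apply] at *
    omega
lemma cross_mix {F G : Set (Sym2 (V d))} (hFG : F ⊆ G) {ω₁ ω₂ : Config d} {x a b y : V d} (h1 : cn (op ω₁ ∩ F) x a) (h2 : cn (op ω₁ ∩ F) b y)
    (h3 : s(a, b) ∈ op ω₂) (h4 : s(a, b) ∈ G \ F) : cn (op (mix F (ω₁, ω₂)) ∩ G) x y := by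
  have h : op ω₁ ∩ F ⊆ op (mix F (ω₁, ω₂)) ∩ G := fun e he => ⟨by simpa [op, mix, he.2] using he.1, hFG he.2⟩
  exact (h1.mono h).trans ((cn.one (O := op (mix F (ω₁, ω₂)) ∩ G) ⟨by simpa [op, mix, h4.2] using h3, h4.1⟩).trans (h2.mono h))
lemma ren_step (hJ : KernelHyp d J α c C) (hP : IsLRP J P) (hβ : 0 ≤ β) {M L m n : ℕ} {q : ℝ} (hM : 1 ≤ M)
    (H : oR (15/16) ≤ qq (P β) (bx d L 0) (Fl d L) m) (hq0 : 0 ≤ q)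
    (hq : ∀ x y : V d, x ≠ y → normInf (x - y) ≤ 2 * M * L → q ≤ J x y)
    (hΛ : (M : ℝ) ^ d * Qc (-β * (q * (m * m))) ≤ 1 / 8) (hn1 : 1 ≤ n) (hn : 2 * n ≤ M ^ d) :
    oR (1/2) ≤ qq (P β) (bx d (2 * M * L) 0) (Fl d (2 * M * L)) (n * m) := by
  classical
  have B := bern hJ hP hβ
  have := B.prob
  set F := Fl d L
  set F' := Fl d (2 * M * L)
  have hFF : F ⊆ F' := Fl_mono (by nlinarith)
  set A : (Fin d → Fin M) → Set (Config d) := fun i => {ω | ∃ x, m ≤ mk (sb d L i) (op ω ∩ F) x}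
  have mA : ∀ i, MeasurableSet (A i) := fun i => meas_qq _ _ _
  have hA : ∀ i, P β (A i)ᶜ ≤ oR (1/16) := fun i => by
    have h : oR (15/16) ≤ P β (A i) := by
      have := qq_sh hJ hP hβ (TI_Fl (d := d) L) L m (fun t => 2 * L * (i t : ℤ))
      rw [← this] at H; exact H
    rw [prob_compl_eq_one_sub (mA i)]
    refine (tsub_le_tsub_left h _).trans ?_
    rw [← QP, ← Zk _ ny]; norm_num
  set X : Set (Config d) := {ω | n ≤ (Finset.univ.filter fun i => ω ∈ A i).card}
  have cI : (Finset.univ : Finset (Fin d → Fin M)).card = M ^ d := by simp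
  have hcard : ∀ ω, (Finset.univ.filter fun i => ω ∈ A i).card + (Finset.univ.filter fun i => ω ∉ A i).card = M ^ d := fun ω => by
    rw [Finset.card_filter_add_card_filter_not, cI]
  have sumind : ∀ ω, ∑ i, (A i)ᶜ.indicator (1 : Config d → ℝ≥0∞) ω = (Finset.univ.filter fun i => ω ∉ A i).card := fun ω => by
    simp only [Zp, ZD, Pi.one_apply, ZF, ZG, add_zero, QG, nsmul_eq_mul, mul_one]
  have hX : P β Xᶜ ≤ oR (1/8) := by
    have h1 := mul_meas_ge_le_lintegral (μ := P β) (f := fun ω => ∑ i, (A i)ᶜ.indicator (1 : Config d → ℝ≥0∞) ω)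
      (Zb _ fun i _ => measurable_one.indicator (mA i).compl) (oR ((M : ℝ) ^ d / 2))
    rw [lintegral_finsetSum _ fun i _ => measurable_one.indicator (mA i).compl] at h1
    have h2 : ∑ i, ∫⁻ ω, (A i)ᶜ.indicator (1 : Config d → ℝ≥0∞) ω ∂(P β) ≤ oR ((M : ℝ) ^ d / 2) * oR (1/8) := by
      refine (QR _ _ (oR (1/16)) fun i _ => ?_).trans_eq ?_
      · rw [lintegral_indicator_one (mA i).compl]; exact hA i
      · rw [cI, nsmul_eq_mul, ← Qw, ← Qa py, ← Qa py]
        push_cast; ring_nf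
    have h3 := (ENNReal.mul_le_mul_iff_right (by simp; positivity) sy).1 (h1.trans h2)
    refine (measure_mono fun ω hω => ?_).trans h3
    simp only [Ql, sumind]
    rw [← Qw]
    refine Qe ?_
    have h4 := hcard ω
    have h5 : (Finset.univ.filter fun i => ω ∈ A i).card < n := not_le.1 hω
    have : M ^ d ≤ 2 * (Finset.univ.filter fun i => ω ∉ A i).card := by omega
    have : (M : ℝ) ^ d ≤ 2 * (Finset.univ.filter fun i => ω ∉ A i).card := by exact_mod_cast this
    linarith
  have hlb : ∀ Z : Set (Config d), P β Z ≤ oR (1/8) → oR (7/8) ≤ P β Zᶜ := fun Z hZ => by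
    have h1 : 1 ≤ P β Z + P β Zᶜ := by rw [← measure_univ (μ := P β), ← Set.union_compl_self Z]; exact measure_union_le _ _
    have h2 : oR (7/8) + oR (1/8) ≤ P β Zᶜ + oR (1/8) := by
      rw [← Qo ny ny]; norm_num
      rw [add_comm]; exact h1.trans (add_le_add (by simpa using hZ) le_rfl)
    exact (ENNReal.add_le_add_iff_right sy).1 h2
  have hX' : oR (7/8) ≤ P β X := by simpa using hlb _ hX
  set Y : Set (Config d) := {ω | ∃ x, n * m ≤ mk (bx d (2 * M * L) 0) (op ω ∩ F') x}
  have mY : MeasurableSet Y := meas_qq _ _ _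
  have mX : MeasurableSet X := by
    have : Measurable fun ω => ∑ i, (A i).indicator (1 : Config d → ℝ≥0∞) ω := Zb _ fun i _ => measurable_one.indicator (mA i)
    have e : X = {ω | (n : ℝ≥0∞) ≤ ∑ i, (A i).indicator (1 : Config d → ℝ≥0∞) ω} := by
      ext ω
      simp only [X, Ql, Zp, Pi.one_apply, ZF, ZG, add_zero, QG, nsmul_eq_mul, mul_one, Zq]
    rw [e]; exact measurableSet_le measurable_const this
  have key : ∀ ω ∈ X, oR (7/8) ≤ P β (Prod.mk ω ⁻¹' (mix F ⁻¹' Y)) := by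
    intro ω hω
    set Gd := Finset.univ.filter fun i => ω ∈ A i
    have hne : Gd.Nonempty := Finset.card_pos.1 (lt_of_lt_of_le hn1 hω)
    obtain ⟨i₀, hi₀⟩ := hne
    have : ∀ i, ∃ x, i ∈ Gd → m ≤ mk (sb d L i) (op ω ∩ F) x := fun i => by
      by_cases h : i ∈ Gd
      · obtain ⟨x, hx⟩ := (Qf.1 h).2; exact ⟨x, fun _ => hx⟩
      · exact ⟨0, fun h' => absurd h' h⟩
    choose x hx using this
    set S := fun i => (sb d L i).filter fun y => cn (op ω ∩ F) (x i) y
    have hS : ∀ i ∈ Gd, m ≤ (S i).card := fun i hi => by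
      have := hx i hi; unfold mk at this; convert this
    have hdis : ∀ i j, i ≠ j → Disjoint (S i) (S j) := fun i j hij => Zf.2 fun a ha hb => by
      have := (sb_geo hij (Qf.1 ha).1 (Qf.1 hb).1).1
      simp [nI_zero] at this
    set Z : Set (Config d) := ⋃ i ∈ Gd.erase i₀, {ω' | ∀ a ∈ S i₀, ∀ b ∈ S i, s(a, b) ∉ op ω'}
    have hZ : P β Z ≤ oR (1/8) := by
      refine (measure_biUnion_finset_le _ _).trans ((QR _ _ (oR (Qc (-β * (q * (m * m))))) fun i hi => ?_).trans ?_)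
      · obtain ⟨hi1, hi2⟩ := Finset.mem_erase.1 hi
        refine (cross hJ hP hβ (S i₀) (S i) (hdis _ _ hi1.symm) (q := q) fun a ha b hb => ?_).trans (Qe (QJ.2 ?_))
        · have := sb_geo hi1.symm (Qf.1 ha).1 (Qf.1 hb).1
          refine hq a b (fun h => ?_) this.2
          rw [h, sub_self, nI_zero] at this; omega
        · have h1 : (m : ℝ) ≤ (S i₀).card := by exact_mod_cast hS _ hi₀
          have h2 : (m : ℝ) ≤ (S i).card := by exact_mod_cast hS _ hi2
          have h3 : (m : ℝ) * m ≤ (S i₀).card * (S i).card := mul_le_mul h1 h2 py py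
          nlinarith [mnl h3 hq0]
      · rw [nsmul_eq_mul, ← Qw, ← Qa py]
        refine Qe (le_trans (mnr ?_ (Qq _).le) hΛ)
        have : (Gd.erase i₀).card ≤ M ^ d := cI ▸ Finset.card_le_univ _
        exact_mod_cast this
    refine (hlb Z hZ).trans (measure_mono fun ω' hω' => ⟨x i₀, ?_⟩)
    calc n * m ≤ Gd.card * m := ZH _ hω
      _ ≤ ∑ i ∈ Gd, (S i).card := by rw [← smul_eq_mul]; exact Zo _ _ _ hS
      _ = (Gd.biUnion S).card := (Finset.card_biUnion fun i _ j _ hij => hdis i j hij).symm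
      _ ≤ _ := by
        unfold mk
        refine QB fun y hy => ?_
        obtain ⟨i, hi, hy⟩ := Finset.mem_biUnion.1 hy
        have hy' := Qf.1 hy
        refine Qf.2 ⟨sb_sub i hy'.1, ?_⟩
        by_cases e : i = i₀
        · subst e
          exact cn.mono (O := op ω ∩ F) (O' := op (mix F (ω, ω')) ∩ F') (fun e he => ⟨by simpa [op, mix, he.2] using he.1, hFF he.2⟩) hy'.2
        · have h1 : ω' ∉ {ω' : Config d | ∀ a ∈ S i₀, ∀ b ∈ S i, s(a, b) ∉ op ω'} := fun h => hω' (Set.mem_biUnion (Finset.mem_erase.2 ⟨e, hi⟩) h)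
          simp only [Ql, not_forall, not_not] at h1
          obtain ⟨a, ha, b, hb, hab⟩ := h1
          have ha' := Qf.1 ha; have hb' := Qf.1 hb
          have hg := sb_geo (Ne.symm e) ha'.1 hb'.1
          exact cross_mix hFF ha'.2 (hb'.2.symm.trans hy'.2) hab ⟨mem_Fl.2 hg.2, fun h => (mem_Fl.1 h).not_gt hg.1⟩
  have mm := meas_mix F
  have e : qq (P β) (bx d (2 * M * L) 0) F' (n * m) = ∫⁻ ω, P β (Prod.mk ω ⁻¹' (mix F ⁻¹' Y)) ∂(P β) := by
    rw [← Measure.prod_apply (mm mY), ← Measure.map_apply mm mY, B.mix]; rfl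
  rw [e]
  calc oR (1/2) ≤ oR (7/8) * oR (7/8) := by
        rw [← Qa ny]; exact Qe ny
    _ ≤ oR (7/8) * P β X := mul_le_mul_right hX' _
    _ = ∫⁻ ω, X.indicator (fun _ => oR (7/8)) ω ∂(P β) := (lintegral_indicator_const mX _).symm
    _ ≤ _ := lintegral_mono fun ω => by
        by_cases h : ω ∈ X
        · rw [QC h]; exact key ω h
        · rw [QD h]; exact zero_le
end P7
section P8
variable {d : ℕ} {J : V d → V d → ℝ} {α c C : ℝ} {P : ℝ → Measure (Config d)} {β δ : ℝ}
lemma mk_sum (b : Finset (V d)) (F : Sw (V d)) (x : V d) (ω : Config d) :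
    ∑ y ∈ b, {ω | cn (op ω ∩ F) x y}.indicator (1 : Config d → ℝ≥0∞) ω = mk b (op ω ∩ F) x := by
  classical
  simp only [Zp, Ql, Pi.one_apply, ZF, ZG, add_zero, QG, nsmul_eq_mul, mul_one]
  unfold mk; congr!
lemma mk_int (b : Finset (V d)) (F : Sw (V d)) (x : V d) :
    ∑ y ∈ b, tau (P β) F x y = ∫⁻ ω, (mk b (op ω ∩ F) x : ℝ≥0∞) ∂(P β) := by
  simp_rw [← mk_sum]
  rw [lintegral_finsetSum _ fun y _ => measurable_one.indicator (meas_cn _ _ _)]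
  exact Qi rfl fun y _ => (lintegral_indicator_one (meas_cn _ _ _)).symm
lemma min_sum (b : Finset (V d)) (F : Sw (V d)) (x : V d) (ω : Config d) (n : ℕ) :
    ∑ l ∈ Qs n, {ω | l + 1 ≤ mk b (op ω ∩ F) x}.indicator (1 : Config d → ℝ≥0∞) ω = (min (mk b (op ω ∩ F) x) n : ℕ) := by
  classical
  simp only [Zp, Ql, Pi.one_apply, ZF, ZG, add_zero, QG, nsmul_eq_mul, mul_one]
  have : (Qs n).filter (fun l => l + 1 ≤ mk b (op ω ∩ F) x) = Qs (min (mk b (op ω ∩ F) x) n) := by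
    ext l; simp; omega
  rw [this, Finset.card_range]
lemma min_int (b : Finset (V d)) (F : Sw (V d)) (x : V d) (n : ℕ) :
    ∑ l ∈ Qs n, P β {ω | l + 1 ≤ mk b (op ω ∩ F) x} = ∫⁻ ω, ((min (mk b (op ω ∩ F) x) n : ℕ) : ℝ≥0∞) ∂(P β) := by
  simp_rw [← min_sum]
  rw [lintegral_finsetSum _ fun y _ => measurable_one.indicator (meas_mk _ _ _ _)]
  exact Qi rfl fun y _ => (lintegral_indicator_one (meas_mk _ _ _ _)).symm
lemma mk_card (b : Finset (V d)) (O : Sw (V d)) (x : V d) : mk b O x ≤ b.card := by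
  classical
  unfold mk; exact Finset.card_filter_le _ _
lemma meas_mk' (b : Finset (V d)) (F : Sw (V d)) (x : V d) : Measurable fun ω : Config d => (mk b (op ω ∩ F) x : ℝ≥0∞) := by
  simp_rw [← mk_sum]; exact Zb _ fun y _ => measurable_one.indicator (meas_cn _ _ _)
lemma meas_min (b : Finset (V d)) (F : Sw (V d)) (x : V d) (n : ℕ) : Measurable fun ω : Config d => ((min (mk b (op ω ∩ F) x) n : ℕ) : ℝ≥0∞) := by
  simp_rw [← min_sum]; exact Zb _ fun y _ => measurable_one.indicator (meas_mk _ _ _ _)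
noncomputable def AA (P : ℝ → Measure (Config d)) (β : ℝ) (F : Sw (V d)) (b : Finset (V d)) : ℝ≥0∞ := ∑ x ∈ b, ∑ y ∈ b, tau (P β) F x y
lemma AA_ch (hJ : KernelHyp d J α c C) (hP : IsLRP J P) (hβ : 0 ≤ β) (F : Sw (V d)) (b : Finset (V d)) : AA P β F b ≤ b.card * ch P β := by
  rw [← nsmul_eq_mul]
  refine QR _ _ _ fun x _ => (ENNReal.sum_le_tsum _).trans ?_
  rw [← ch_shift hJ hP hβ x]
  exact Qd fun y => tau_mono (QO _) _ _
lemma qq_AA (b : Finset (V d)) (F : Sw (V d)) (n : ℕ) : (n : ℝ≥0∞) ^ 2 * qq (P β) b F n ≤ AA P β F b := by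
  classical
  unfold AA
  simp_rw [mk_int]
  rw [← lintegral_finsetSum _ fun x _ => meas_mk' b F x, qq, ← lintegral_indicator_const (meas_qq b F n)]
  refine lintegral_mono fun ω => ?_
  by_cases h : ∃ x, n ≤ mk b (op ω ∩ F) x
  · rw [QC (show ω ∈ {ω | ∃ x, n ≤ mk b (op ω ∩ F) x} from h)]
    obtain ⟨x, hx⟩ := h
    have : n ^ 2 ≤ ∑ x ∈ b, mk b (op ω ∩ F) x := by
      calc n ^ 2 = n * n := sq n
        _ ≤ (b.filter fun y => cn (op ω ∩ F) x y).card * n := ZH _ (by unfold mk at hx; convert hx)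
        _ ≤ ∑ y ∈ b.filter (fun y => cn (op ω ∩ F) x y), mk b (op ω ∩ F) y := by
            rw [← smul_eq_mul]
            refine Zo _ _ _ fun y hy => hx.trans ?_
            unfold mk
            refine QB fun z hz => ?_
            simp only [Qf] at hz hy ⊢
            exact ⟨hz.1, hy.2.symm.trans hz.2⟩
        _ ≤ _ := QL (Zx _ _)
    have := Zq (α := ℝ≥0∞) |>.2 this
    push_cast at this; exact this
  · rw [QD (show ω ∉ {ω | ∃ x, n ≤ mk b (op ω ∩ F) x} from h)]; exact zero_le
lemma half_min (hJ : KernelHyp d J α c C) (hP : IsLRP J P) (hβ : 0 ≤ β) (b : Finset (V d)) (F : Sw (V d)) (x : V d) {m : ℕ} (hm : 1 ≤ m)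
    (hq : qq (P β) b F m ≤ 1 / 2) : (∑ y ∈ b, tau (P β) F x y) / 2 ≤ ∑ l ∈ Qs (2 * m), P β {ω | l + 1 ≤ mk b (op ω ∩ F) x} := by
  have B := bern hJ hP hβ
  set E := ∑ y ∈ b, tau (P β) F x y
  have hE : E ≠ ∞ := (ENNReal.sum_lt_top.2 fun y _ => (tau_le_one B _ _ _).trans_lt sy).ne
  have e : ∀ n, ∑ l ∈ Qs n, P β {ω | l + 1 ≤ mk b (op ω ∩ F) x} ≤ E := fun n => by
    rw [min_int]; simp only [E, mk_int]; exact lintegral_mono fun ω => Zq.2 (min_le_left _ _)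
  have e2 : E = ∑ l ∈ Qs b.card, P β {ω | l + 1 ≤ mk b (op ω ∩ F) x} := by
    rw [min_int]; simp only [E, mk_int, min_eq_left (mk_card _ _ _)]
  have h : E ≤ ∑ l ∈ Qs (2 * m), P β {ω | l + 1 ≤ mk b (op ω ∩ F) x} + E / 2 := by
    calc E ≤ ∑ l ∈ Qs (2 * m + b.card), P β {ω | l + 1 ≤ mk b (op ω ∩ F) x} := by
          conv_lhs => rw [e2]
          exact QL (Finset.range_mono oy)
      _ ≤ _ := by
          rw [Finset.sum_range_add]
          refine add_le_add le_rfl ?_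
          calc _ ≤ ∑ l ∈ Qs b.card, P β {ω | l + 1 ≤ mk b (op ω ∩ F) x} * (1 / 2) := Qj fun l _ => by
                have := mark1 B b F (l + 1) hm x
                rw [show l + 1 + 2 * m = 2 * m + l + 1 by ring] at this
                exact this.trans (mul_le_mul_right hq _)
            _ = E * (1 / 2) := by rw [← Finset.sum_mul, ← e2]
            _ = E / 2 := by rw [div_eq_mul_inv, div_eq_mul_inv, one_mul]
  have h2 : E / 2 + E / 2 ≤ ∑ l ∈ Qs (2 * m), P β {ω | l + 1 ≤ mk b (op ω ∩ F) x} + E / 2 := by rwa [ENNReal.add_halves]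
  exact (ENNReal.add_le_add_iff_right (ENNReal.div_ne_top hE sy)).1 h2
lemma AA_sh (hJ : KernelHyp d J α c C) (hP : IsLRP J P) (hβ : 0 ≤ β) {F : Set (Sym2 (V d))} (hF : TI F) (L : ℕ) (z : V d) :
    AA P β F (bx d L z) = AA P β F (bx d L 0) := by
  unfold AA
  have key : ∀ f : V d → ℝ≥0∞, ∑ x ∈ bx d L z, f x = ∑ x ∈ bx d L 0, f (x + z) := fun f => by
    refine (Finset.sum_bij (fun x _ => x + z) (fun x hx => ?_) (fun _ _ _ _ h => add_right_cancel h) (fun y hy => ⟨y - z, ?_, sub_add_cancel _ _⟩) fun _ _ => rfl).symm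
    · have := bx_add (w := z).2 hx; rwa [zero_add] at this
    · exact bx_add (w := z).1 (by simpa using hy)
  rw [key]; simp_rw [key, tau_ti hJ hP hβ hF]
lemma a_step (hJ : KernelHyp d J α c C) (hP : IsLRP J P) (hβ : 0 ≤ β) {M L m : ℕ} {q : ℝ} (hM : 2 ≤ M) (hm : 1 ≤ m)
    (H : qq (P β) (bx d L 0) (Fl d L) m ≤ 1 / 2) (hq0 : 0 ≤ q)
    (hq : ∀ x y : V d, x ≠ y → normInf (x - y) ≤ 2 * M * L → q ≤ J x y) :
    oR (β * q * Qc (-β * (q * ((2 * m) * (2 * m)))) / 4) * AA P β (Fl d L) (bx d L 0) ^ 2 ≤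
      AA P β (Fl d (2 * M * L)) (bx d (2 * M * L) 0) := by
  classical
  have B := bern hJ hP hβ
  have := B.prob
  set F := Fl d L
  set F' := Fl d (2 * M * L)
  have hFF : F ⊆ F' := Fl_mono (by nlinarith)
  set κ := β * q * Qc (-β * (q * ((2 * m) * (2 * m))))
  have hκ : 0 ≤ κ := by positivity
  set i : Fin d → Fin M := fun _ => ⟨0, by omega⟩
  set j : Fin d → Fin M := fun _ => ⟨1, by omega⟩
  have hij : i ≠ j := fun h => by have := congrFun h ⟨0, hJ.d_pos⟩; simp [i, j] at this
  have Hz : ∀ z, qq (P β) (bx d L z) F m ≤ 1 / 2 := fun z => by rw [qq_sh hJ hP hβ (TI_Fl L)]; exact H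
  have pt : ∀ x ∈ sb d L i, ∀ y ∈ sb d L j, oR κ * ((∑ l ∈ Qs (2 * m), P β {ω | l + 1 ≤ mk (sb d L i) (op ω ∩ F) x}) *
      ∑ l ∈ Qs (2 * m), P β {ω | l + 1 ≤ mk (sb d L j) (op ω ∩ F) y}) ≤ tau (P β) F' x y := by
    intro x hx y hy
    set f := fun ω : Config d => min (mk (sb d L i) (op ω ∩ F) x) (2 * m)
    set g := fun ω : Config d => min (mk (sb d L j) (op ω ∩ F) y) (2 * m)
    have e : tau (P β) F' x y = ∫⁻ ω, P β (Prod.mk ω ⁻¹' (mix F ⁻¹' {ω | cn (op ω ∩ F') x y})) ∂(P β) := by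
      rw [← Measure.prod_apply (meas_mix F (meas_cn _ _ _)), ← Measure.map_apply (meas_mix F) (meas_cn _ _ _), B.mix]; rfl
    calc _ ≤ oR κ * ∫⁻ ω, (f ω : ℝ≥0∞) * (g ω : ℝ≥0∞) ∂(P β) := by
          have hmm : ∀ l l', Measurable fun ω => {ω | l + 1 ≤ mk (sb d L i) (op ω ∩ F) x}.indicator (1 : Config d → ℝ≥0∞) ω *
              {ω | l' + 1 ≤ mk (sb d L j) (op ω ∩ F) y}.indicator (1 : Config d → ℝ≥0∞) ω := fun l l' =>
            (measurable_one.indicator (meas_mk _ _ _ _)).mul (measurable_one.indicator (meas_mk _ _ _ _))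
          refine mul_le_mul_right ?_ _
          simp only [f, g, ← min_sum, Finset.sum_mul_sum]
          rw [lintegral_finsetSum _ fun l _ => Zb _ fun l' _ => hmm l l']
          refine Qj fun l _ => ?_
          rw [lintegral_finsetSum _ fun l' _ => hmm l l']
          refine Qj fun l' _ => ?_
          have := B.harris (famM (sb d L i) F (l + 1) x) (famM (sb d L j) F (l' + 1) y)
          rw [Dn_famM, Dn_famM] at this
          refine this.trans_eq ?_
          rw [← lintegral_indicator_one ((meas_mk _ _ _ _).inter (meas_mk _ _ _ _))]
          refine lintegral_congr fun ω => ?_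
          rw [Set.inter_indicator_one]; rfl
      _ = ∫⁻ ω, oR κ * ((f ω : ℝ≥0∞) * (g ω : ℝ≥0∞)) ∂(P β) := (lintegral_const_mul _ ((meas_min _ _ _ _).mul (meas_min _ _ _ _))).symm
      _ ≤ _ := by
        rw [e]
        refine lintegral_mono fun ω => ?_
        set S := (sb d L i).filter fun z => cn (op ω ∩ F) x z
        set S' := (sb d L j).filter fun z => cn (op ω ∩ F) y z
        have hS : (f ω) ≤ S.card := (min_le_left _ _).trans (by unfold mk; exact le_of_eq (by congr!))
        have hS' : (g ω) ≤ S'.card := (min_le_left _ _).trans (by unfold mk; exact le_of_eq (by congr!))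
        have hdis : Disjoint S S' := Zf.2 fun a ha hb => by
          have := (sb_geo hij (Qf.1 ha).1 (Qf.1 hb).1).1
          simp [nI_zero] at this
        have hcr := cross hJ hP hβ S S' hdis (q := q) fun a ha b hb => by
          have := sb_geo hij (Qf.1 ha).1 (Qf.1 hb).1
          refine hq a b (fun h => ?_) this.2
          rw [h, sub_self, nI_zero] at this; omega
        set Z : Set (Config d) := {ω' | ∀ a ∈ S, ∀ b ∈ S', s(a, b) ∉ op ω'}
        have h1 : 1 ≤ P β Z + P β Zᶜ := by rw [← measure_univ (μ := P β), ← Set.union_compl_self Z]; exact measure_union_le _ _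
        calc oR κ * ((f ω : ℝ≥0∞) * (g ω : ℝ≥0∞)) = oR (κ * (f ω * g ω)) := by
              rw [Qa hκ, Qa (p := (f ω : ℝ)) py, Qw, Qw]
          _ ≤ oR (1 - Qc (-β * (q * (S.card * S'.card)))) := by
              refine Qe ?_
              have a1 : (f ω : ℝ) ≤ 2 * m := by exact_mod_cast min_le_right _ _
              have a2 : (g ω : ℝ) ≤ 2 * m := by exact_mod_cast min_le_right _ _
              have a3 : (f ω : ℝ) ≤ S.card := by exact_mod_cast hS
              have a4 : (g ω : ℝ) ≤ S'.card := by exact_mod_cast hS'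
              have b1 : (f ω : ℝ) * g ω ≤ (2 * m) * (2 * m) := mul_le_mul a1 a2 py py
              have b2 : (f ω : ℝ) * g ω ≤ S.card * S'.card := mul_le_mul a3 a4 py py
              set t := (f ω : ℝ) * g ω
              have t0 : 0 ≤ t := by positivity
              have bq : 0 ≤ β * q := by positivity
              have c1 : Qc (-β * (q * (S.card * S'.card))) ≤ Qc (-(β * q * t)) := QJ.2 (by nlinarith)
              have c2 : Qc (-β * (q * ((2 * m) * (2 * m)))) ≤ Qc (-(β * q * t)) := QJ.2 (by nlinarith)
              have c3 : (β * q * t + 1) * Qc (-(β * q * t)) ≤ 1 := by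
                calc _ ≤ Qc (β * q * t) * Qc (-(β * q * t)) := mnr (ZC _) (Qq _).le
                  _ = 1 := by rw [← Za]; simp
              have c4 : κ * t ≤ β * q * t * Qc (-(β * q * t)) := by
                have := mnl c2 (mul_nonneg bq t0)
                simp only [κ]; linarith
              linarith
          _ ≤ 1 - P β Z := by
              rw [Zk _ (Qq _).le, QP]; exact tsub_le_tsub_left hcr _
          _ ≤ P β Zᶜ := tsub_le_iff_left.2 h1
          _ ≤ _ := by
              refine measure_mono fun ω' hω' => ?_
              simp only [Z, ZD, Ql, not_forall, not_not] at hω'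
              obtain ⟨a, ha, b, hb, hab⟩ := hω'
              have ha' := Qf.1 ha; have hb' := Qf.1 hb
              have hg := sb_geo hij ha'.1 hb'.1
              exact cross_mix hFF ha'.2 hb'.2.symm hab ⟨mem_Fl.2 hg.2, fun h => (mem_Fl.1 h).not_gt hg.1⟩
  set X := AA P β F (bx d L 0)
  have ai : ∀ i : Fin d → Fin M, X / 2 ≤ ∑ x ∈ sb d L i, ∑ l ∈ Qs (2 * m), P β {ω | l + 1 ≤ mk (sb d L i) (op ω ∩ F) x} := fun i => by
    simp only [X]; rw [← AA_sh hJ hP hβ (TI_Fl L) L (fun t => 2 * L * (i t : ℤ)), AA, div_eq_mul_inv, Finset.sum_mul]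
    refine Qj fun x _ => ?_
    rw [← div_eq_mul_inv]
    exact half_min hJ hP hβ _ _ _ hm (Hz _)
  calc _ = oR κ * ((X / 2) * (X / 2)) := by
        rw [ENNReal.ofReal_div_of_pos ny, div_eq_mul_inv, div_eq_mul_inv]
        have : (oR 4)⁻¹ = 2⁻¹ * 2⁻¹ := by
          rw [← ENNReal.mul_inv sy sy]; congr 1
          rw [← ENNReal.ofReal_ofNat 2, ← Qa ny]; norm_num
        rw [this]; ring
    _ ≤ oR κ * ((∑ x ∈ sb d L i, ∑ l ∈ Qs (2 * m), P β {ω | l + 1 ≤ mk (sb d L i) (op ω ∩ F) x}) *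
        ∑ x ∈ sb d L j, ∑ l ∈ Qs (2 * m), P β {ω | l + 1 ≤ mk (sb d L j) (op ω ∩ F) x}) := mul_le_mul_right (mul_le_mul' (ai i) (ai j)) _
    _ ≤ ∑ x ∈ sb d L i, ∑ y ∈ sb d L j, tau (P β) F' x y := by
        rw [Finset.sum_mul_sum, Qv]
        refine Qj fun x hx => ?_
        rw [Qv]
        exact Qj fun y hy => pt x hx y hy
    _ ≤ _ := (Qj fun x _ => QL (sb_sub j)).trans (QL (sb_sub i))
end P8
section P9
variable {d : ℕ} {J : V d → V d → ℝ} {α c C : ℝ} {P : ℝ → Measure (Config d)} {β δ : ℝ}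
lemma exMG (hα : α = (d : ℝ) / 3) (hd : 1 ≤ d) : ∃ M G : ℕ, 2 ≤ M ∧ 1 ≤ G ∧ 62 * G ≤ M ^ d ∧ ((2 * M : ℕ) : ℝ) ^ ((d : ℝ) + α) ≤ (G : ℝ) ^ 2 := by
  refine ⟨248 ^ 3, 496 ^ (2 * d), by norm_num, ZI _ _ ny, ?_, ?_⟩
  · have : 62 ≤ 62 ^ d := by simpa using Zc (show 0 < 62 by norm_num) hd
    calc 62 * 496 ^ (2 * d) ≤ 62 ^ d * 496 ^ (2 * d) := ZH _ this
      _ = (248 ^ 3) ^ d := by rw [pow_mul, ← mul_pow]; norm_num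
  · calc ((2 * 248 ^ 3 : ℕ) : ℝ) ^ ((d : ℝ) + α) ≤ ((496 : ℝ) ^ (3 : ℝ)) ^ ((d : ℝ) + α) :=
          Real.rpow_le_rpow py ny (by rw [hα]; positivity)
      _ = (496 : ℝ) ^ (((4 * d : ℕ)) : ℝ) := by
          rw [← QM ny, hα]; congr 1; push_cast; ring
      _ = _ := by rw [Qx]; push_cast; rw [← pow_mul]; congr 1; ring
lemma q_lb (hJ : KernelHyp d J α c C) (n : ℕ) : ∀ x y : V d, x ≠ y → normInf (x - y) ≤ n → c * (n : ℝ) ^ (-(d : ℝ) - α) ≤ J x y := by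
  intro x y h hn
  refine le_trans (mnl ?_ hJ.c_pos.le) (hJ.lower x y h)
  have h0 : 0 < normInf (x - y) := Nat.pos_of_ne_zero fun h' => h (sub_eq_zero.1 (nI_eq0.1 h'))
  exact Qt (by exact_mod_cast h0) (by exact_mod_cast hn) (by have := hJ.alpha_pos; have : (0 : ℝ) ≤ d := py; linarith)
def cd (d : ℕ) (α c β : ℝ) (M L m : ℕ) : Prop := Qb (8 * (M : ℝ) ^ d) ≤ β * (c * ((2 * M * L : ℕ) : ℝ) ^ (-(d : ℝ) - α) * (m * m))
lemma ren1 (hJ : KernelHyp d J α c C) (hP : IsLRP J P) (hβ : 0 ≤ β) {M G L m : ℕ} (hM : 2 ≤ M) (hG : 1 ≤ G) (hMG : 62 * G ≤ M ^ d)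
    (hm : 1 ≤ m) (H : oR (15/16) ≤ qq (P β) (bx d L 0) (Fl d L) m) (hc : cd d α c β M L m) :
    oR (15/16) ≤ qq (P β) (bx d (2 * M * L) 0) (Fl d (2 * M * L)) (G * m) := by
  have h := ren_step hJ hP hβ oy H (mul_nonneg hJ.c_pos.le (ZJ (ZK _) _)) (q_lb hJ (2 * M * L)) ?_ (n := 31 * G) oy oy
  · by_contra h'
    push Not at h'
    have h2 := mark3 (bern hJ hP hβ) (bx d (2 * M * L) 0) (Fl d (2 * M * L)) (m := G * m) (ZL hG hm) 15
    rw [show (2 * 15 + 1) * (G * m) = 31 * G * m by ring] at h2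
    have h3 := (h.trans h2).trans (pow_le_pow_left₀ (zero_le) h'.le _)
    rw [← Zr ny, Zn py] at h3
    norm_num at h3
  · have hM0 : (0 : ℝ) < 8 * (M : ℝ) ^ d := by have : 0 < M := oy; positivity
    have : Qc (-β * (c * ((2 * M * L : ℕ) : ℝ) ^ (-(d : ℝ) - α) * (m * m))) ≤ (8 * (M : ℝ) ^ d)⁻¹ := by
      rw [← Real.exp_log hM0, ← Real.exp_neg]; exact QJ.2 (by have := hc; unfold cd at this; linarith)
    calc _ ≤ (M : ℝ) ^ d * (8 * (M : ℝ) ^ d)⁻¹ := mnl this py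
      _ = 1 / 8 := by field_simp
lemma cd_step (hβ : 0 ≤ β) (hc : 0 ≤ c) {M G L m : ℕ} (hM : 2 ≤ M) (hs : ((2 * M : ℕ) : ℝ) ^ ((d : ℝ) + α) ≤ (G : ℝ) ^ 2)
    (h : cd d α c β M L m) : cd d α c β M (2 * M * L) (G * m) := by
  unfold cd at *
  refine h.trans (mnl ?_ hβ)
  rw [mul_assoc c, mul_assoc c]
  refine mnl ?_ hc
  have hN : (0 : ℝ) < ((2 * M : ℕ) : ℝ) := by exact_mod_cast oy
  rw [show ((2 * M * (2 * M * L) : ℕ) : ℝ) = ((2 * M : ℕ) : ℝ) * ((2 * M * L : ℕ) : ℝ) by push_cast; ring,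
    Qp hN.le py, show -(d : ℝ) - α = -((d : ℝ) + α) by ring, Qu hN.le]
  have h1 : 1 ≤ (((2 * M : ℕ) : ℝ) ^ ((d : ℝ) + α))⁻¹ * (G : ℝ) ^ 2 := by
    rw [← inv_mul_cancel₀ (ZM hN ((d : ℝ) + α)).ne']
    exact mnl hs py
  have h0 : 0 ≤ ((2 * M * L : ℕ) : ℝ) ^ (-((d : ℝ) + α)) * ((m : ℝ) * m) := mul_nonneg (ZJ (ZK _) _) py
  calc _ ≤ ((((2 * M : ℕ) : ℝ) ^ ((d : ℝ) + α))⁻¹ * (G : ℝ) ^ 2) * (((2 * M * L : ℕ) : ℝ) ^ (-((d : ℝ) + α)) * ((m : ℝ) * m)) := le_mul_of_one_le_left h0 h1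
    _ = _ := by push_cast; ring
lemma ren_iter (hJ : KernelHyp d J α c C) (hP : IsLRP J P) (hβ : 0 ≤ β) {M G L m : ℕ} (hM : 2 ≤ M) (hG : 1 ≤ G) (hMG : 62 * G ≤ M ^ d)
    (hs : ((2 * M : ℕ) : ℝ) ^ ((d : ℝ) + α) ≤ (G : ℝ) ^ 2)
    (hm : 1 ≤ m) (H : oR (15/16) ≤ qq (P β) (bx d L 0) (Fl d L) m) (hc : cd d α c β M L m) (k : ℕ) :
    oR (15/16) ≤ qq (P β) (bx d ((2 * M) ^ k * L) 0) (Fl d ((2 * M) ^ k * L)) (G ^ k * m) ∧ cd d α c β M ((2 * M) ^ k * L) (G ^ k * m) := by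
  induction k with
  | zero => simpa using ⟨H, hc⟩
  | succ k ih =>
    have h1 := ren1 hJ hP hβ hM hG hMG (ZL (Nat.pow_pos hG) hm) ih.1 ih.2
    have h2 := cd_step hβ hJ.c_pos.le hM hs ih.2
    rw [← mul_assoc, ← mul_assoc, ← pow_succ', ← pow_succ'] at h1 h2
    exact ⟨h1, h2⟩
lemma ren_top (hJ : KernelHyp d J α c C) (hP : IsLRP J P) (hβ : 0 ≤ β) {M G L m : ℕ} (hM : 2 ≤ M) (hG : 1 ≤ G) (hMG : 62 * G ≤ M ^ d)
    (hs : ((2 * M : ℕ) : ℝ) ^ ((d : ℝ) + α) ≤ (G : ℝ) ^ 2)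
    (hm : 1 ≤ m) (H : oR (15/16) ≤ qq (P β) (bx d L 0) (Fl d L) m) (hc : cd d α c β M L m) : ch P β = ∞ := by
  by_contra hx
  have key : ∀ k : ℕ, (((2 * M : ℕ) : ℝ) ^ α) ^ k ≤ 2 * (L : ℝ) ^ d * (ch P β).toReal := fun k => by
    have h1 := (ren_iter hJ hP hβ hM hG hMG hs hm H hc k).1
    have h2 := (qq_AA (P := P) (β := β) (bx d ((2 * M) ^ k * L) 0) (Fl d ((2 * M) ^ k * L)) (G ^ k * m)).trans (AA_ch hJ hP hβ _ _)
    rw [card_bx] at h2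
    have h3 := (mul_le_mul_right h1 _).trans h2
    have h4 := QS (ENNReal.mul_ne_top (ZN _) hx) h3
    rw [ZO, ZO, ENNReal.toReal_ofReal ny] at h4
    simp only [ENNReal.toReal_pow, ENNReal.toReal_natCast] at h4
    push_cast at h4
    have hN : (0 : ℝ) < ((2 * M : ℕ) : ℝ) := by exact_mod_cast oy
    have h5 : (((2 * M : ℕ) : ℝ) ^ d) ^ k * (((2 * M : ℕ) : ℝ) ^ α) ^ k ≤ ((G : ℝ) ^ k) ^ 2 := by
      rw [← mul_pow, ← Qx _ d, ← Qk hN, ← pow_mul, mul_comm k, pow_mul]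
      exact pow_le_pow_left₀ py hs _
    have h6 : (1 : ℝ) ≤ (m : ℝ) := by exact_mod_cast hm
    have hx0 : 0 ≤ (ch P β).toReal := QK
    set y := (((2 * M : ℕ) : ℝ) ^ α) ^ k
    have h7 : ((G : ℝ) ^ k) ^ 2 ≤ ((G : ℝ) ^ k * m) ^ 2 := pow_le_pow_left₀ py (le_mul_of_one_le_right py h6) _
    have h8 : (0 : ℝ) < (((2 * M : ℕ) : ℝ) ^ d) ^ k := by positivity
    have h9 : (((2 * (M : ℝ)) ^ k * (L : ℝ)) ^ d) = (((2 * M : ℕ) : ℝ) ^ d) ^ k * (L : ℝ) ^ d := by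
      rw [mul_pow, ← pow_mul, ← pow_mul, mul_comm k]; push_cast; rfl
    rw [h9] at h4
    have hL : 0 ≤ (L : ℝ) ^ d * (ch P β).toReal := by positivity
    refine le_of_mul_le_mul_left ?_ h8
    nlinarith [mul_nonneg h8.le hL]
  have h1 : (1 : ℝ) < ((2 * M : ℕ) : ℝ) ^ α := Real.one_lt_rpow (by exact_mod_cast oy) hJ.alpha_pos
  obtain ⟨k, hk⟩ := pow_unbounded_of_one_lt (2 * (L : ℝ) ^ d * (ch P β).toReal) h1
  exact absurd (key k) ly
lemma hex_ (hJ : KernelHyp d J α c C) (hP : IsLRP J P) (hα : α = (d : ℝ) / 3) : ∃ β, 0 ≤ β ∧ ch P β = ∞ := by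
  obtain ⟨M, G, hM, hG, hMG, hs⟩ := exMG hα hJ.d_pos
  have hN : (0 : ℝ) < ((2 * M : ℕ) : ℝ) := by exact_mod_cast oy
  have hM1 : (1 : ℝ) ≤ M := by exact_mod_cast oy
  have hl : 0 ≤ Qb (8 * (M : ℝ) ^ d) := Qz (by nlinarith [one_le_pow₀ hM1 (n := d)])
  set b := Qb (8 * (M : ℝ) ^ d) * ((2 * M : ℕ) : ℝ) ^ ((d : ℝ) + α) / c
  have hb : 0 ≤ b := div_nonneg (mul_nonneg hl (ZJ hN.le _)) hJ.c_pos.le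
  refine ⟨b, hb, ren_top hJ hP hb (L := 1) (m := 1) hM hG hMG hs le_rfl ?_ ?_⟩
  · have := (bern hJ hP hb).prob
    have : qq (P b) (bx d 1 0) (Fl d 1) 1 = 1 := by
      unfold qq
      rw [← measure_univ (μ := P b)]; congr 1
      refine Set.eq_univ_of_forall fun ω => ⟨0, ?_⟩
      unfold mk
      classical
      exact Finset.card_pos.2 ⟨0, by rw [Qf]; exact ⟨mem_bx.2 fun i => by simp, .refl⟩⟩
    rw [this]; exact ENNReal.ofReal_le_one.2 ny
  · unfold cd
    have hc := hJ.c_pos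
    have : ((2 * M : ℕ) : ℝ) ^ ((d : ℝ) + α) * ((2 * M : ℕ) : ℝ) ^ (-(d : ℝ) - α) = 1 := by
      rw [← Qk hN]; simp
    have e : b * (c * ((2 * M * 1 : ℕ) : ℝ) ^ (-(d : ℝ) - α) * ((1 : ℕ) * (1 : ℕ))) =
        Qb (8 * (M : ℝ) ^ d) * (((2 * M : ℕ) : ℝ) ^ ((d : ℝ) + α) * ((2 * M : ℕ) : ℝ) ^ (-(d : ℝ) - α)) := by
      simp only [b, mul_one]; field_simp; push_cast; ring
    rw [e, this, mul_one]
lemma tight (hJ : KernelHyp d J α c C) (hP : IsLRP J P) (hβ : 0 ≤ β) {M G L m : ℕ} (hM : 2 ≤ M) (hG : 1 ≤ G) (hMG : 62 * G ≤ M ^ d)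
    (hs : ((2 * M : ℕ) : ℝ) ^ ((d : ℝ) + α) ≤ (G : ℝ) ^ 2) (hx : ch P β ≠ ∞)
    (hm : 1 ≤ m) (hc : cd d α c β M L m) : qq (P β) (bx d L 0) (Fl d L) (31 * m) ≤ 1 / 2 := by
  by_contra h
  refine hx (ren_top hJ hP hβ hM hG hMG hs hm (L := L) ?_ hc)
  by_contra h'
  push Not at h h'
  have h2 := mark3 (bern hJ hP hβ) (bx d L 0) (Fl d L) hm 15
  have h3 := (h.trans_le h2).trans_le (pow_le_pow_left₀ (zero_le) h'.le _)
  rw [← Zr ny, show (1 / 2 : ℝ≥0∞) = oR (1/2) by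
    rw [ENNReal.ofReal_div_of_pos ny]; norm_num, ENNReal.ofReal_lt_ofReal_iff py] at h3
  norm_num at h3
lemma a_rec (hJ : KernelHyp d J α c C) (hP : IsLRP J P) {b0 b1 : ℝ} (hb0 : 0 < b0) {M G : ℕ} (hM : 2 ≤ M) (hG : 1 ≤ G) (hMG : 62 * G ≤ M ^ d)
    (hs : ((2 * M : ℕ) : ℝ) ^ ((d : ℝ) + α) ≤ (G : ℝ) ^ 2) : ∃ c1 > 0, ∀ β, b0 ≤ β → β ≤ b1 → ch P β ≠ ∞ → ∀ L, 1 ≤ L →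
      oR (c1 * ((2 * M * L : ℕ) : ℝ) ^ (-(d : ℝ) - α)) * AA P β (Fl d L) (bx d L 0) ^ 2 ≤ AA P β (Fl d (2 * M * L)) (bx d (2 * M * L) 0) := by
  set Λ := Qb (8 * (M : ℝ) ^ d)
  have hc := hJ.c_pos
  have hM1 : (1 : ℝ) ≤ M := by exact_mod_cast oy
  have hl : 0 ≤ Λ := Qz (by nlinarith [one_le_pow₀ hM1 (n := d)])
  set κ := 62 ^ 2 * (2 * Λ + 2 * (b1 * c))
  refine ⟨b0 * c * Qc (-κ) / 4, by positivity, fun β h0 h1 hx L hL => ?_⟩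
  have hβ : 0 < β := hb0.trans_le h0
  have hNL : 1 ≤ 2 * M * L := ZL oy hL
  set r := ((2 * M * L : ℕ) : ℝ) ^ (-(d : ℝ) - α) with hr
  have hr0 : 0 < r := ZM (by exact_mod_cast hNL) _
  have hr1 : r ≤ 1 := QT (by exact_mod_cast hNL) (by have := hJ.alpha_pos; have : (0 : ℝ) ≤ d := py; linarith)
  set q := c * r
  have hq : 0 < q := by positivity
  set X := Λ / (β * q)
  have hX : 0 ≤ X := by positivity
  set m := ⌊Zs X⌋₊ + 1
  have hm1 : Zs X ≤ m := by have := (Nat.lt_floor_add_one (Zs X)).le; push_cast [m]; exact this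
  have hm2 : (m : ℝ) ≤ Zs X + 1 := by push_cast [m]; have := Nat.floor_le (ZP X); linarith
  have hsX := Zt hX
  have hsn := ZP X
  have m1 : X ≤ m * m := by nlinarith
  have m2 : (m : ℝ) * m ≤ 2 * X + 2 := by nlinarith [sq_nonneg (Zs X - 1)]
  have eX : β * q * X = Λ := by simp only [X]; field_simp
  have bq : 0 < β * q := by positivity
  have hcd : cd d α c β M L m := by
    unfold cd; rw [← hr]
    calc Λ = β * q * X := eX.symm
      _ ≤ β * q * (m * m) := mnl m1 bq.le
      _ = _ := by ring
  have := a_step hJ hP hβ.le hM (m := 31 * m) oy (tight hJ hP hβ.le hM hG hMG hs hx oy hcd) hq.le (q_lb hJ (2 * M * L))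
  refine le_trans (mul_le_mul_left (Qe ?_) _) this
  have k1 : β * (q * (2 * ((31 * m : ℕ) : ℝ) * (2 * ((31 * m : ℕ) : ℝ)))) ≤ κ := by
    have : β * q ≤ b1 * c := by
      have : q ≤ c := by simp only [q]; nlinarith
      exact mul_le_mul h1 this hq.le (hβ.le.trans h1)
    push_cast
    have := mnl m2 bq.le
    simp only [κ]; nlinarith
  have k2 : Qc (-κ) ≤ Qc (-β * (q * (2 * ((31 * m : ℕ) : ℝ) * (2 * ((31 * m : ℕ) : ℝ))))) := QJ.2 ly
  have k3 : b0 * q * Qc (-κ) ≤ β * q * Qc (-β * (q * (2 * ((31 * m : ℕ) : ℝ) * (2 * ((31 * m : ℕ) : ℝ))))) :=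
    mul_le_mul (mnr h0 hq.le) k2 (Qq _).le py
  have e : b0 * c * Qc (-κ) / 4 * r = b0 * q * Qc (-κ) / 4 := by simp only [q]; ring
  rw [e]; linarith
lemma sq_bd {w : ℕ → ℝ} (hw : ∀ k, w k ^ 2 ≤ w (k + 1)) {B r : ℝ} (hr0 : 0 ≤ r) (hr : r < 1) (hb : ∀ k, w k ≤ B * r ^ k) (k : ℕ) : w k ≤ 1 := by
  by_contra h
  push Not at h
  have : ∀ j, 1 < w (k + j) := fun j => by
    induction j with
    | zero => simpa
    | succ j ih => have := hw (k + j); rw [← add_assoc]; nlinarith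
  have ht : QX (fun n => B * r ^ n) Zz (nhds (B * 0)) := (tendsto_pow_atTop_nhds_zero_of_lt_one hr0 hr).const_mul B
  rw [mul_zero] at ht
  obtain ⟨n, hn⟩ := (ht.eventually_lt_const (show (0 : ℝ) < 1 by norm_num)).exists_forall_of_atTop
  have h1 := hn (k + n) oy; have h2 := this n; have h3 := hb (k + n); linarith
lemma a_bd (hJ : KernelHyp d J α c C) (hP : IsLRP J P) (hβ : 0 ≤ β) {N : ℕ} (hN : 2 ≤ N) (hx : ch P β ≠ ∞) {c1 : ℝ} (hc1 : 0 < c1)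
    (h : ∀ L, 1 ≤ L → oR (c1 * ((N * L : ℕ) : ℝ) ^ (-(d : ℝ) - α)) * AA P β (Fl d L) (bx d L 0) ^ 2 ≤ AA P β (Fl d (N * L)) (bx d (N * L) 0)) (k : ℕ) :
    AA P β (Fl d (N ^ k)) (bx d (N ^ k) 0) ≤ oR (((N : ℝ) ^ ((d : ℝ) + α)) ^ 2 / c1 * ((N : ℝ) ^ ((d : ℝ) + α)) ^ k) := by
  have hN0 : (0 : ℝ) < N := by exact_mod_cast oy
  set s := (N : ℝ) ^ ((d : ℝ) + α)
  have hs : 0 < s := ZM hN0 _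
  have fin : ∀ k, AA P β (Fl d (N ^ k)) (bx d (N ^ k) 0) ≤ ((N ^ k) ^ d : ℕ) * ch P β := fun k => by
    have := AA_ch hJ hP hβ (Fl d (N ^ k)) (bx d (N ^ k) 0); rwa [card_bx] at this
  have fin' : ∀ k, ((((N ^ k) ^ d : ℕ) : ℝ≥0∞) * ch P β) ≠ ∞ := fun k => ENNReal.mul_ne_top (ZN _) hx
  set a : ℕ → ℝ := fun k => (AA P β (Fl d (N ^ k)) (bx d (N ^ k) 0)).toReal
  have hrec : ∀ k, c1 / s ^ (k + 1) * a k ^ 2 ≤ a (k + 1) := fun k => by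
    have := h (N ^ k) (ZI _ _ oy)
    rw [← pow_succ'] at this
    have := QS (ne_top_of_le_ne_top (fin' _) (fin _)) this
    have e : ((N ^ (k + 1) : ℕ) : ℝ) ^ (-(d : ℝ) - α) = (s ^ (k + 1))⁻¹ := by
      push_cast
      rw [show -(d : ℝ) - α = -((d : ℝ) + α) by ring, Qu py, ← Qx, ← QM hN0.le, mul_comm, QM hN0.le, Qx]
    rw [ZO, ENNReal.toReal_ofReal py, ENNReal.toReal_pow, e] at this
    exact this
  have key := sq_bd (w := fun k => c1 / s ^ 2 * a k / s ^ k) (B := c1 / s ^ 2 * (ch P β).toReal) (r := (N : ℝ) ^ (-α)) ?_ py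
    (Zd (by exact_mod_cast oy) (by linarith [hJ.alpha_pos])) ?_ k
  · rw [← QA (ne_top_of_le_ne_top (fin' k) (fin k))]
    refine Qe ?_
    rw [div_le_one py] at key
    change a k ≤ _
    calc a k = s ^ 2 / c1 * (c1 / s ^ 2 * a k) := by field_simp
      _ ≤ _ := mnl key py
  · intro k
    calc _ = c1 / s ^ 2 * (c1 / s ^ (k + 1) * a k ^ 2) / s ^ (k + 1) := by field_simp; ring
      _ ≤ _ := div_le_div_of_nonneg_right (mnl (hrec k) py) py
  · intro k
    have h1 := QS (fin' k) (fin k)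
    rw [ZO, ENNReal.toReal_natCast] at h1
    have h2 : ((N : ℝ) ^ (-α)) ^ k = (((N ^ k) ^ d : ℕ) : ℝ) / s ^ k := by
      push_cast
      rw [← pow_mul, mul_comm k, pow_mul, ← div_pow]; congr 1
      rw [← Qx, ← Real.rpow_sub hN0]; congr 1; ring
    rw [h2]
    calc c1 / s ^ 2 * a k / s ^ k ≤ c1 / s ^ 2 * ((((N ^ k) ^ d : ℕ) : ℝ) * (ch P β).toReal) / s ^ k :=
          div_le_div_of_nonneg_right (mnl h1 py) py
      _ = _ := by ring
lemma AA_box (hJ : KernelHyp d J α c C) (hP : IsLRP J P) (hβ : 0 ≤ β) {N R : ℕ} (hN : 4 ≤ N) {F : Set (Sym2 (V d))} (hF : TI F) :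
    ((R ^ d : ℕ) : ℝ≥0∞) * ∑ y ∈ box d R, tau (P β) F 0 y ≤ AA P β F (bx d (N * R) 0) := by
  set z : V d := fun _ => R
  have hin : ∀ x ∈ bx d R z, ∀ y ∈ box d R, x ∈ bx d (N * R) 0 ∧ x + y ∈ bx d (N * R) 0 := fun x hx y hy => by
    have h1 := mem_bx.1 hx; have h2 := nI_le.1 (mem_box.1 hy)
    have h3 : (4 : ℤ) * R ≤ N * R := by exact_mod_cast ZH R hN
    refine ⟨mem_bx.2 fun i => ?_, mem_bx.2 fun i => ?_⟩ <;> have a := h1 i <;> have b := h2 i <;> simp only [z, Pi.zero_apply, Pi.add_apply] at * <;> push_cast <;> omega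
  calc _ = ∑ x ∈ bx d R z, ∑ y ∈ box d R, tau (P β) F x (x + y) := by
        rw [← card_bx R z, ← nsmul_eq_mul, ← QG]
        refine Qi rfl fun x _ => Qi rfl fun y _ => ?_
        rw [tau_ti0 hJ hP hβ hF x, add_sub_cancel_left]
    _ ≤ ∑ x ∈ bx d R z, ∑ y ∈ bx d (N * R) 0, tau (P β) F x y := Qj fun x hx => by
        classical
        rw [← Finset.sum_image (f := fun y => tau (P β) F x y) (g := fun y => x + y) (s := box d R) (fun _ _ _ _ h => add_left_cancel h)]
        exact QL fun y hy => by
          obtain ⟨w, hw, rfl⟩ := Zm.1 hy; exact (hin x hx w hw).2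
    _ ≤ _ := QL fun x hx => (hin x hx 0 (mem_box.2 (by simp [nI_zero]))).1
lemma S4 (hJ : KernelHyp d J α c C) (hP : IsLRP J P) (hα : α = (d : ℝ) / 3) {b0 b1 : ℝ} (hb0 : 0 < b0) : ∃ N : ℕ, 4 ≤ N ∧ ∃ A : ℝ, 0 < A ∧
    ∀ β, b0 ≤ β → β ≤ b1 → ch P β ≠ ∞ → ∀ k ρ : ℕ, N ^ k ≤ ρ → ∑ x ∈ box d ρ, tau (P β) (Fl d (N ^ k)) 0 x ≤ oR (A * (ρ : ℝ) ^ α) := by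
  obtain ⟨M, G, hM, hG, hMG, hs⟩ := exMG hα hJ.d_pos
  obtain ⟨c1, hc1, h⟩ := a_rec hJ hP (b1 := b1) hb0 hM hG hMG hs
  set N := 2 * M
  have hN0 : (0 : ℝ) < N := by exact_mod_cast oy
  set s := (N : ℝ) ^ ((d : ℝ) + α)
  have hs : 0 < s := ZM hN0 _
  refine ⟨N, by omega, s ^ 2 / c1 * s * (N : ℝ) ^ α, by positivity, fun β h0 h1 hx k ρ hk => ?_⟩
  have hβ : 0 ≤ β := hb0.le.trans h0
  have hρ : 1 ≤ ρ := (ZI _ _ oy).trans hk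
  set i := Nat.log N ρ + 1
  have i1 : ρ ≤ N ^ i := (Nat.lt_pow_succ_log_self oy ρ).le
  have i2 : N ^ i ≤ N * ρ := by rw [pow_succ']; exact Nat.mul_le_mul_left _ (Nat.pow_log_le_self N oy)
  have i3 : k ≤ i + 1 := by have := Nat.le_log_of_pow_le (by omega : 1 < N) hk; omega
  have b1 := (AA_box hJ hP hβ (N := N) (R := N ^ i) oy (TI_Fl (N ^ (i + 1))))
  rw [← pow_succ'] at b1
  replace b1 := b1.trans (a_bd hJ hP hβ oy hx hc1 (h β h0 h1 hx) (i + 1))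
  have e1 : ((N ^ i) ^ d : ℕ) * (((N : ℝ) ^ α) ^ i) = s ^ i := by
    push_cast
    rw [← pow_mul, mul_comm i, pow_mul, ← mul_pow]; congr 1
    rw [← Qx, ← Qk hN0]
  have e2 : ((N : ℝ) ^ α) ^ i ≤ (N : ℝ) ^ α * (ρ : ℝ) ^ α := by
    rw [← Qp hN0.le py, ← Qx, ← QM hN0.le, mul_comm, QM hN0.le, Qx]
    exact Real.rpow_le_rpow py (by exact_mod_cast i2) hJ.alpha_pos.le
  calc ∑ x ∈ box d ρ, tau (P β) (Fl d (N ^ k)) 0 x ≤ ∑ x ∈ box d (N ^ i), tau (P β) (Fl d (N ^ (i + 1))) 0 x :=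
        (Qj fun x _ => tau_mono (Fl_mono (Zc oy i3)) _ _).trans
          (QL fun x hx => mem_box.2 ((mem_box.1 hx).trans i1))
    _ ≤ oR (s ^ 2 / c1 * s * ((N : ℝ) ^ α) ^ i) := by
        have hD0 : (((N ^ i) ^ d : ℕ) : ℝ≥0∞) ≠ 0 := Nat.cast_ne_zero.2 (by have : 0 < N := oy; positivity)
        rw [← ENNReal.mul_le_mul_iff_right hD0 (ZN _)]
        refine b1.trans_eq ?_
        rw [← Qw, ← Qa py]; congr 1
        rw [pow_succ s i, ← e1]; ring
    _ ≤ _ := Qe (by rw [mul_assoc _ ((N : ℝ) ^ α)]; exact mnl e2 py)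
end P9
section P10
variable {d : ℕ} {J : V d → V d → ℝ} {α c C : ℝ} {P : ℝ → Measure (Config d)} {β δ : ℝ}
open Classical in
lemma DD {ι κ : Type*} {f : ι → ℝ} {g : ι → ℝ≥0∞} {Q : ι → Prop} {s : ℝ} (hs : 0 ≤ s) {lo hi : κ → ℝ} (hlo : ∀ i, 0 < lo i)
    (h : ∀ u, Q u → ∃ i, lo i ≤ f u ∧ f u ≤ hi i) {T : κ → ℝ≥0∞} (hT : ∀ i, ∑' u, (if f u ≤ hi i then g u else 0) ≤ T i) :
    ∑' u, (if Q u then oR (f u ^ (-s)) * g u else 0) ≤ ∑' i, oR (lo i ^ (-s)) * T i := by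
  calc _ ≤ ∑' u, ∑' i, oR (lo i ^ (-s)) * (if f u ≤ hi i then g u else 0) := by
        refine Qd fun u => ?_
        split_ifs with hu
        · obtain ⟨i, h1, h2⟩ := h u hu
          refine le_trans ?_ (ENNReal.le_tsum i)
          rw [if_pos h2]
          exact mul_le_mul_left (Qe (Qt (hlo i) h1 ly)) _
        · exact zero_le
    _ ≤ _ := by
        rw [Qh]
        refine Qd fun i => ?_
        rw [Qg]; exact mul_le_mul_right (hT i) _
lemma geo_sum {K q : ℝ} (hK : 0 ≤ K) (h0 : 0 ≤ q) (h1 : q < 1) : ∑' i : ℕ, oR (K * q ^ i) = oR (K / (1 - q)) := by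
  rw [← ENNReal.ofReal_tsum_of_nonneg (fun i => by positivity) ((summable_geometric_of_lt_one h0 h1).mul_left K), tsum_mul_left, tsum_geometric_of_lt_one h0 h1]; rfl
open Classical in
lemma D1 {ι : Type*} {f : ι → ℝ} {g : ι → ℝ≥0∞} {A b s r : ℝ} (hr : 0 < r) (hA : 0 ≤ A) (hs : 0 ≤ s) (hbs : b < s)
    (h : ∀ ρ, r ≤ ρ → ∑' u, (if f u ≤ ρ then g u else 0) ≤ oR (A * ρ ^ b)) :
    ∑' u, (if r < f u then oR (f u ^ (-s)) * g u else 0) ≤ oR (2 ^ b / (1 - 2 ^ (b - s)) * A * r ^ (b - s)) := by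
  have h2 : (2 : ℝ) ^ (b - s) < 1 := Zd ny ly
  refine (DD hs (lo := fun i : ℕ => 2 ^ i * r) (hi := fun i => 2 ^ (i + 1) * r) (fun i => by positivity) (fun u hu => ?_) (fun i => h _ ?_)).trans ?_
  · obtain ⟨i, h1, h2⟩ := exists_nat_pow_near (x := f u / r) (y := 2) ((one_le_div hr).2 hu.le) ny
    exact ⟨i, (le_div_iff₀ hr).1 h1, ((div_lt_iff₀ hr).1 h2).le⟩
  · exact le_mul_of_one_le_left hr.le (one_le_pow₀ ny)
  · rw [show 2 ^ b / (1 - 2 ^ (b - s)) * A * r ^ (b - s) = (2 ^ b * A * r ^ (b - s)) / (1 - (2 : ℝ) ^ (b - s)) by ring, ← geo_sum py py h2]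
    refine Qd fun i => le_of_eq ?_
    rw [← Qa py]; congr 1
    rw [Qp py hr.le, Qp py hr.le, sub_eq_add_neg b s, Qk hr, Qk (by norm_num : (0 : ℝ) < 2), mul_pow,
      pow_succ, Qp py ny, ZQ ny, ZQ ny]
    ring
open Classical in
lemma D2 {ι : Type*} {f : ι → ℝ} {g : ι → ℝ≥0∞} {A b s r : ℝ} (hr : 0 < r) (hA : 0 ≤ A) (hs : 0 ≤ s) (hbs : s < b) (hf : ∀ u, 0 < f u)
    (h : ∀ ρ, 0 < ρ → ∑' u, (if f u ≤ ρ then g u else 0) ≤ oR (A * ρ ^ b)) :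
    ∑' u, (if f u ≤ r then oR (f u ^ (-s)) * g u else 0) ≤ oR (2 ^ s / (1 - 2 ^ (s - b)) * A * r ^ (b - s)) := by
  have h2 : (2 : ℝ) ^ (s - b) < 1 := Zd ny ly
  refine (DD hs (lo := fun i : ℕ => (2 ^ (i + 1))⁻¹ * r) (hi := fun i => (2 ^ i)⁻¹ * r) (fun i => by positivity) (fun u hu => ?_) (fun i => h _ py)).trans ?_
  · obtain ⟨i, h1, h2⟩ := exists_nat_pow_near (x := r / f u) (y := 2) ((one_le_div (hf u)).2 hu) ny
    rw [le_div_iff₀ (hf u)] at h1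
    rw [div_lt_iff₀ (hf u)] at h2
    refine ⟨i, ?_, ?_⟩
    · rw [inv_mul_le_iff₀ py]; exact h2.le
    · rw [le_inv_mul_iff₀ py]; exact h1
  · rw [show 2 ^ s / (1 - 2 ^ (s - b)) * A * r ^ (b - s) = (2 ^ s * A * r ^ (b - s)) / (1 - (2 : ℝ) ^ (s - b)) by ring, ← geo_sum py py h2]
    refine Qd fun i => le_of_eq ?_
    rw [← Qa py]; congr 1
    rw [Qp py hr.le, Qp py hr.le, sub_eq_add_neg b s, sub_eq_add_neg s b, Qk hr, Qk (by norm_num : (0 : ℝ) < 2), mul_pow,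
      Real.inv_rpow py, Real.inv_rpow py, Qu (by positivity : (0 : ℝ) ≤ 2 ^ (i + 1)), inv_inv,
      pow_succ, Qp py ny, ZQ ny, ZQ ny, Qu (by positivity : (0 : ℝ) ≤ 2 ^ i)]
    ring
open Classical in
lemma D3 {ι : Type*} {f : ι → ℝ} {g : ι → ℝ≥0∞} {A s r : ℝ} (hr : 1 ≤ r) (hA : 0 ≤ A) (hs : 0 ≤ s) (hf : ∀ u, 1 ≤ f u)
    (h : ∀ ρ, 0 < ρ → ∑' u, (if f u ≤ ρ then g u else 0) ≤ oR (A * ρ ^ s)) :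
    ∑' u, (if f u ≤ r then oR (f u ^ (-s)) * g u else 0) ≤ oR (2 ^ s * A * (2 * Qb r + 1)) := by
  obtain ⟨n, n1, n2⟩ := exists_nat_pow_near (x := r) (y := 2) hr ny
  refine (DD hs (κ := Fin (n + 1)) (lo := fun i => 2 ^ (i : ℕ)) (hi := fun i => 2 ^ (i + 1 : ℕ)) (fun i => by positivity) (fun u hu => ?_) (fun i => h _ py)).trans ?_
  · obtain ⟨i, h1, h2⟩ := exists_nat_pow_near (x := f u) (y := 2) (hf u) ny
    refine ⟨⟨i, ?_⟩, h1, h2.le⟩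
    by_contra h'
    have : (2 : ℝ) ^ (n + 1) ≤ 2 ^ i := pow_le_pow_right₀ ny oy
    linarith
  · rw [tsum_fintype]
    calc _ = ∑ i : Fin (n + 1), oR (2 ^ s * A) := Qi rfl fun i _ => by
          rw [← Qa py]; congr 1
          rw [pow_succ, Qp py ny, Qu py]
          have : (0 : ℝ) < (2 ^ (i : ℕ)) ^ s := by positivity
          field_simp
      _ = oR (2 ^ s * A * (n + 1)) := by
          simp only [QG, Finset.card_univ, Fintype.card_fin, nsmul_eq_mul]
          rw [← Qw, ← Qa py]; congr 1; push_cast; ring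
      _ ≤ _ := Qe (mnl (by
          have := ZR py n1
          rw [Real.log_pow] at this
          have h2 := Real.log_two_gt_d9
          have : (0 : ℝ) ≤ n := by positivity
          nlinarith) py)
noncomputable def br (x : V d) : ℝ := max 1 (normInf x)
lemma br1 (x : V d) : 1 ≤ br x := le_max_left _ _
lemma br0 (x : V d) : 0 < br x := one_pos.trans_le (br1 x)
lemma br_neg (x : V d) : br (-x) = br x := by simp [br, nI_neg]
lemma br_sub (x y : V d) : br (x - y) = br (y - x) := by rw [← br_neg, neg_sub]
lemma nI_br (x : V d) : (normInf x : ℝ) ≤ br x := le_max_right _ _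
lemma br_add (x y : V d) : br (x + y) ≤ br x + br y := by
  refine max_le (by linarith [br1 x, br1 y]) ?_
  have : (normInf (x + y) : ℝ) ≤ normInf x + normInf y := by exact_mod_cast nI_add x y
  linarith [nI_br x, nI_br y]
lemma br_le {x : V d} {ρ : ℝ} (h : 1 ≤ ρ) : br x ≤ ρ ↔ x ∈ box d ⌊ρ⌋₊ := by
  rw [mem_box, Nat.le_floor_iff ly, br]; simp [h]
open Classical in
lemma br_sum {ρ : ℝ} (h : 1 ≤ ρ) (g : V d → ℝ≥0∞) : ∑' u, (if br u ≤ ρ then g u else 0) = ∑ u ∈ box d ⌊ρ⌋₊, g u := by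
  simp_rw [br_le h]
  rw [tsum_eq_sum (s := box d ⌊ρ⌋₊) (fun u hu => if_neg hu)]
  exact Qi rfl fun u hu => if_pos hu
open Classical in
lemma cnt {ρ : ℝ} (h : 0 < ρ) : ∑' u : V d, (if br u ≤ ρ then (1 : ℝ≥0∞) else 0) ≤ oR (3 ^ d * ρ ^ (d : ℝ)) := by
  rcases lt_or_ge ρ 1 with h1 | h1
  · rw [ENNReal.tsum_eq_zero.2 fun u => if_neg (by linarith [br1 u])]; exact zero_le
  · rw [br_sum h1, QG, card_box, nsmul_eq_mul, mul_one, Qx, ← mul_pow, ← Qw]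
    refine Qe ?_
    push_cast
    refine pow_le_pow_left₀ py ?_ _
    have := Nat.floor_le h.le
    linarith
noncomputable def tb (P : ℝ → Measure (Config d)) (β : ℝ) (F : Sw (V d)) (R : ℕ) (x : V d) : ℝ≥0∞ := ∑ t ∈ box d R, tau (P β) F 0 (x + t)
lemma w_le (hJ : KernelHyp d J α c C) (hβ : 0 ≤ β) {b1 : ℝ} (h1 : β ≤ b1) {y z : V d} (h : y ≠ z) :
    oR (β * J y z) ≤ oR (b1 * C) * oR (br (z - y) ^ (-((d : ℝ) + α))) := by
  have hC : 0 ≤ C := hJ.c_pos.le.trans hJ.c_le_C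
  rw [← Qa (mul_nonneg (hβ.trans h1) hC), mul_assoc]
  refine Qe (mul_le_mul h1 ?_ (hJ.nonneg _ _) (hβ.trans h1))
  have h0 : 1 ≤ normInf (y - z) := Nat.pos_of_ne_zero fun h' => h (sub_eq_zero.1 (nI_eq0.1 h'))
  have : br (z - y) = normInf (y - z) := by rw [br_sub, br]; exact max_eq_right (by exact_mod_cast h0)
  rw [this, show -((d : ℝ) + α) = -(d : ℝ) - α by ring]; exact hJ.upper y z h
open Classical in
lemma pw1 (hJ : KernelHyp d J α c C) (hP : IsLRP J P) (hβ : 0 ≤ β) {F : Set (Sym2 (V d))} (hF : TI F) {R ρ : ℕ} {x : V d} (hx : ρ + R < normInf x) :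
    tb P β F R x ≤ ∑' y, ∑' z, (if y ∈ box d ρ ∧ z ∉ box d ρ then tau (P β) F 0 y * oR (β * J y z) * tb P β F R (x - z) else 0) := by
  have h0 : (0 : V d) ∈ (↑(box d ρ) : Set (V d)) := by simp [mem_box, nI_zero]
  have key : ∀ t ∈ box d R, tau (P β) F 0 (x + t) ≤ ∑' y, ∑' z, (if y ∈ box d ρ ∧ z ∉ box d ρ then tau (P β) F 0 y * oR (β * J y z) * tau (P β) F 0 (x - z + t) else 0) := by
    intro t ht
    have hn : x + t ∉ box d ρ := fun h => by
      have h1 := nI_tri x (-t)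
      rw [sub_neg_eq_add, nI_neg] at h1
      have := mem_box.1 h; have := mem_box.1 ht; omega
    refine (fe_in hJ hP hβ F (↑(box d ρ)) h0 (x + t)).trans ?_
    rw [tau_zero (S := ↑(box d ρ)) (fun a b hab _ => (mem_ins.1 hab.2).2) h0 (by simpa using hn), zero_add]
    refine Qd fun y => Qd fun z => ?_
    split_ifs with h1 h2 h2
    · rw [tau_ti0 hJ hP hβ hF z, show x + t - z = x - z + t by abel]
      exact mul_le_mul_left (mul_le_mul_left (tau_mono QZ _ _) _) _
    · exact absurd ⟨by simpa using h1.1, by simpa using h1.2.1⟩ h2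
    · simp
    · simp
  refine (Qj key).trans ?_
  rw [← QE fun _ _ => QF]
  refine Qd fun y => ?_
  rw [← QE fun _ _ => QF]
  refine Qd fun z => ?_
  split_ifs
  · rw [tb, Qv]
  · simp
open Classical in
lemma pw2 (hJ : KernelHyp d J α c C) (hP : IsLRP J P) (hβ : 0 ≤ β) {F : Set (Sym2 (V d))} (hF : TI F) {R h : ℕ} {x : V d} (hx : 4 * h ≤ normInf x) (hR : R ≤ h) :
    (h : ℝ≥0∞) * tb P β F R x ≤ ∑ y ∈ box d (2 * h), tau (P β) F 0 y * ∑' z, (if y ≠ z then oR (β * J y z) * (min (normInf (z - y)) h : ℕ) * tb P β F R (x - z) else 0) := by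
  have h1 : (h : ℝ≥0∞) * tb P β F R x = ∑ ρ ∈ ZE h (2 * h), tb P β F R x := by
    rw [QG, Nat.card_Ico, nsmul_eq_mul]; congr 2; omega
  rw [h1]
  refine (Qj fun ρ hρ => pw1 hJ hP hβ hF (ρ := ρ) (by have := Finset.mem_Ico.1 hρ; omega)).trans ?_
  rw [← QE fun _ _ => QF]
  rw [tsum_eq_sum (s := box d (2 * h))]
  · refine Qj fun y _ => ?_
    rw [← QE fun _ _ => QF, ← Qg]
    refine Qd fun z => ?_
    rw [← QV, QG, nsmul_eq_mul]
    by_cases hyz : y = z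
    · rw [Finset.filter_false_of_mem (fun ρ _ h => h.2 (hyz ▸ h.1))]; simp
    rw [if_pos hyz]
    have hc : ((ZE h (2 * h)).filter fun ρ => y ∈ box d ρ ∧ z ∉ box d ρ).card ≤ min (normInf (z - y)) h := by
      refine le_min ?_ ((Finset.card_filter_le _ _).trans (by rw [Nat.card_Ico]; omega))
      refine (QB (t := ZE (normInf y) (normInf z)) fun ρ hρ => ?_).trans (by rw [Nat.card_Ico]; have := nI_tri z y; omega)
      have := (Qf.1 hρ).2
      rw [mem_box, mem_box] at this
      exact Finset.mem_Ico.2 ⟨this.1, by omega⟩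
    calc _ ≤ ((min (normInf (z - y)) h : ℕ) : ℝ≥0∞) * (tau (P β) F 0 y * oR (β * J y z) * tb P β F R (x - z)) := mul_le_mul_left (Zq.2 hc) _
      _ = _ := by ring
  · intro y hy
    refine Finset.sum_eq_zero fun ρ hρ => ENNReal.tsum_eq_zero.2 fun z => if_neg fun h' => hy ?_
    have := Finset.mem_Ico.1 hρ
    exact mem_box.2 ((mem_box.1 h'.1).trans oy)
open Classical in
lemma pw3 (hJ : KernelHyp d J α c C) (hP : IsLRP J P) (hβ : 0 ≤ β) {b1 : ℝ} (hb1 : β ≤ b1) {F : Set (Sym2 (V d))} (hF : TI F) {R h : ℕ} {x : V d}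
    (hx : 4 * h ≤ normInf x) (hR : R ≤ h) (e : ℝ) :
    (h : ℝ≥0∞) * tb P β F R x ≤ oR (b1 * C) * ∑ y ∈ box d (2 * h), tau (P β) F 0 y * (
      ∑' u, (if br u ≤ e then oR (br u ^ (-((d : ℝ) + α - 1))) * tb P β F R (x - y - u) else 0) +
      h * ∑' u, (if e < br u then oR (br u ^ (-((d : ℝ) + α))) * tb P β F R (x - y - u) else 0)) := by
  refine (pw2 hJ hP hβ hF hx hR).trans ?_
  rw [Qv]
  refine Qj fun y _ => ?_
  rw [mul_left_comm]
  refine mul_le_mul_right ?_ _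
  rw [← (Equiv.addLeft y).tsum_eq, ← Qg, ← Qr, ← Qg]
  refine Qd fun u => ?_
  simp only [Equiv.coe_addLeft, add_sub_cancel_left]
  split_ifs with h1 h2 h3 h2 h3
  · linarith
  · rw [mul_zero, add_zero, ← mul_assoc, sub_sub]
    refine mul_le_mul_left ?_ _
    refine (mul_le_mul' (w_le hJ hβ hb1 h1) (show (((min (normInf u) h : ℕ)) : ℝ≥0∞) ≤ oR (br u) from ?_)).trans_eq ?_
    · rw [← Qw]; exact Qe (le_trans (by exact_mod_cast min_le_left _ _) (nI_br u))
    · rw [add_sub_cancel_left, mul_assoc, ← Qa (ZJ (br0 u).le _)]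
      congr 2
      rw [← Real.rpow_add_one (br0 u).ne']; congr 1; ring
  · rw [zero_add, sub_sub]
    calc _ ≤ (oR (b1 * C) * oR (br u ^ (-((d : ℝ) + α)))) * h * tb P β F R (x - (y + u)) := by
          refine mul_le_mul_left (mul_le_mul' ?_ (Zq.2 (min_le_right _ _))) _
          have := w_le hJ hβ hb1 h1; rwa [add_sub_cancel_left] at this
      _ = _ := by ring
  · exact absurd (lt_of_not_ge ‹¬br u ≤ e›) ‹_›
  all_goals exact zero_le
open Classical in
lemma tb_sum (hJ : KernelHyp d J α c C) (hP : IsLRP J P) {F : Set (Sym2 (V d))} {R h : ℕ} {v : V d} (hv : br v ≤ 9 * h) (h1 : 1 ≤ R) (hR : R ≤ h)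
    {A D ρ : ℝ} (hA : 0 ≤ A) (hα : 0 ≤ α) (hT : ∀ ρ : ℝ, R ≤ ρ → ∑' u, (if br u ≤ ρ then tau (P β) F 0 u else 0) ≤ oR (A * ρ ^ α)) (hD : 1 ≤ D) (hρ : h / D ≤ ρ) :
    ∑' u, (if br u ≤ ρ then tb P β F R (v - u) else 0) ≤ oR (3 ^ d * (R : ℝ) ^ d * A * (11 * D) ^ α * ρ ^ α) := by
  have h0 : (1 : ℝ) ≤ h := by exact_mod_cast h1.trans hR
  have hR' : (R : ℝ) ≤ h := by exact_mod_cast hR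
  have hR1 : (1 : ℝ) ≤ R := by exact_mod_cast h1
  have hρ0 : 0 < ρ := lt_of_lt_of_le py hρ
  rw [div_le_iff₀ py] at hρ
  have key : ∀ t ∈ box d R, ∑' u, (if br u ≤ ρ then tau (P β) F 0 (v - u + t) else 0) ≤ oR (A * (11 * D) ^ α * ρ ^ α) := fun t ht => by
    calc _ ≤ ∑' u, (if br (v + t - u) ≤ 11 * D * ρ then tau (P β) F 0 (v + t - u) else 0) := Qd fun u => by
          split_ifs with a b
          · rw [show v - u + t = v + t - u by abel]
          · exfalso; refine b ?_
            have b1 := br_add (v + t) (-u); have b2 := br_add v t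
            rw [br_neg, ← sub_eq_add_neg] at b1
            have b3 : br t ≤ R := max_le hR1 (by exact_mod_cast mem_box.1 ht)
            nlinarith
          · exact zero_le
          · exact zero_le
      _ = ∑' w, (if br w ≤ 11 * D * ρ then tau (P β) F 0 w else 0) := (Equiv.subLeft (v + t)).tsum_eq fun w => if br w ≤ 11 * D * ρ then tau (P β) F 0 w else 0
      _ ≤ oR (A * (11 * D * ρ) ^ α) := hT _ (by nlinarith)
      _ = _ := by rw [Qp py hρ0.le, mul_assoc]
  calc _ = ∑ t ∈ box d R, ∑' u, (if br u ≤ ρ then tau (P β) F 0 (v - u + t) else 0) := by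
        rw [← QE fun _ _ => QF]
        exact tsum_congr fun u => by split_ifs <;> simp [tb]
    _ ≤ (box d R).card • oR (A * (11 * D) ^ α * ρ ^ α) := QR _ _ _ key
    _ ≤ _ := by
        rw [card_box, nsmul_eq_mul, ← Qw, ← Qa py]
        refine Qe ?_
        rw [show 3 ^ d * (R : ℝ) ^ d * A * (11 * D) ^ α * ρ ^ α = (3 * (R : ℝ)) ^ d * (A * (11 * D) ^ α * ρ ^ α) by rw [mul_pow]; ring]
        refine mnr ?_ py
        push_cast
        exact pow_le_pow_left₀ py ly _
end P10
section P11
variable {d : ℕ} {J : V d → V d → ℝ} {α c C : ℝ} {P : ℝ → Measure (Config d)} {β δ : ℝ}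
open Classical in
lemma pw_step (hJ : KernelHyp d J α c C) (hP : IsLRP J P) (h1 : α < 1) (hβ : 0 ≤ β) {b1 : ℝ} (hb1 : β ≤ b1) {F : Set (Sym2 (V d))} (hF : TI F) {R h : ℕ} {x : V d}
    (hx : 4 * h ≤ normInf x) (hx' : normInf x ≤ 7 * h) (hR1 : 1 ≤ R) (hR : R ≤ h) {A D : ℝ} (hA : 0 ≤ A)
    (hT : ∀ ρ : ℝ, R ≤ ρ → ∑' u, (if br u ≤ ρ then tau (P β) F 0 u else 0) ≤ oR (A * ρ ^ α)) (hD : 1 ≤ D) {m : ℝ≥0∞} (hm : ∀ x', h ≤ normInf x' → tb P β F R x' ≤ m) :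
    tb P β F R x ≤ oR (b1 * C * A * 2 ^ α * (2 ^ ((d : ℝ) + α - 1) / (1 - 2 ^ ((d : ℝ) + α - 1 - d)) * 3 ^ d) * D ^ (α - 1)) * m +
      oR (b1 * C * A * 2 ^ α * (2 ^ α / (1 - 2 ^ (α - (d + α))) * (3 ^ d * A * (11 * D) ^ α) * D ^ (d : ℝ)) * (R : ℝ) ^ d * (h : ℝ) ^ (α - d)) := by
  have hC : 0 ≤ C := hJ.c_pos.le.trans hJ.c_le_C
  have hb : 0 ≤ b1 := hβ.trans hb1
  have hd1 : (1 : ℝ) ≤ d := by exact_mod_cast hJ.d_pos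
  have hα := hJ.alpha_pos
  have h0 : (1 : ℝ) ≤ h := by exact_mod_cast hR1.trans hR
  have hh : (0 : ℝ) < h := by linarith
  have hD0 : 0 < D := by linarith
  set K2 := (2 : ℝ) ^ ((d : ℝ) + α - 1) / (1 - 2 ^ ((d : ℝ) + α - 1 - d))
  set K1 := (2 : ℝ) ^ α / (1 - 2 ^ (α - (d + α)))
  have hK2 : 0 ≤ K2 := div_nonneg py (by
    have := QT (show (1 : ℝ) ≤ 2 by norm_num) (show (d : ℝ) + α - 1 - d ≤ 0 by linarith); linarith)
  have hK1 : 0 ≤ K1 := div_nonneg py (by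
    have := QT (show (1 : ℝ) ≤ 2 by norm_num) (show α - (d + α) ≤ 0 by linarith); linarith)
  have near : ∀ y ∈ box d (2 * h), ∑' u, (if br u ≤ h / D then oR (br u ^ (-((d : ℝ) + α - 1))) * tb P β F R (x - y - u) else 0) ≤
      oR (K2 * 3 ^ d * (h / D) ^ (1 - α)) * m := fun y hy => by
    have := D2 (f := br (d := d)) (g := fun _ => 1) (A := 3 ^ d) (b := d) (s := (d : ℝ) + α - 1) (r := h / D) py py ly ly br0 (fun ρ hρ => cnt hρ)
    rw [show (d : ℝ) - ((d : ℝ) + α - 1) = 1 - α by ring] at this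
    refine le_trans ?_ (mul_le_mul_left this _)
    rw [← Qn]
    refine Qd fun u => ?_
    split_ifs with hu
    · rw [mul_one]; refine mul_le_mul_right (hm _ ?_) _
      have e1 : (normInf u : ℝ) ≤ h := (nI_br u).trans (hu.trans (div_le_self hh.le hD))
      have e1' : normInf u ≤ h := by exact_mod_cast e1
      have e2 := mem_box.1 hy
      have e3 := nI_tri x (y + u); have e4 := nI_add y u
      rw [← sub_sub] at e3
      omega
    · simp
  have far : ∀ y ∈ box d (2 * h), ∑' u, (if h / D < br u then oR (br u ^ (-((d : ℝ) + α))) * tb P β F R (x - y - u) else 0) ≤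
      oR (K1 * (3 ^ d * (R : ℝ) ^ d * A * (11 * D) ^ α) * (h / D) ^ (-(d : ℝ))) := fun y hy => by
    have := D1 (f := br (d := d)) (g := fun u => tb P β F R (x - y - u)) (A := 3 ^ d * (R : ℝ) ^ d * A * (11 * D) ^ α) (b := α) (s := (d : ℝ) + α) (r := h / D) py py ly ly
      (fun ρ hρ => tb_sum hJ hP ?_ hR1 hR hA hα.le hT hD hρ)
    · rw [← show α - ((d : ℝ) + α) = -(d : ℝ) by ring]; exact this
    · refine max_le ly ?_
      have e2 := mem_box.1 hy; have e3 := nI_add x (-y)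
      rw [nI_neg, ← sub_eq_add_neg] at e3
      exact_mod_cast (by omega : normInf (x - y) ≤ 9 * h)
  have tot : ∑ y ∈ box d (2 * h), tau (P β) F 0 y ≤ oR (A * (2 * h) ^ α) := by
    have := hT (2 * h) (by have : (R : ℝ) ≤ h := (by exact_mod_cast hR); linarith)
    rw [br_sum ly] at this
    rwa [show ⌊(2 * h : ℝ)⌋₊ = 2 * h by exact_mod_cast Nat.floor_natCast (2 * h)] at this
  have fin := pw3 hJ hP hβ hb1 hF hx hR (h / D)
  refine (ENNReal.mul_le_mul_iff_right (a := (h : ℝ≥0∞)) (by exact_mod_cast (by omega : h ≠ 0)) (ZN _)).1 (fin.trans ?_)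
  calc _ ≤ oR (b1 * C) * ∑ y ∈ box d (2 * h), tau (P β) F 0 y * (oR (K2 * 3 ^ d * (h / D) ^ (1 - α)) * m +
        h * oR (K1 * (3 ^ d * (R : ℝ) ^ d * A * (11 * D) ^ α) * (h / D) ^ (-(d : ℝ)))) := by
        refine mul_le_mul_right (Qj fun y hy => mul_le_mul_right (add_le_add (near y hy) (mul_le_mul_right (far y hy) _)) _) _
    _ ≤ oR (b1 * C) * (oR (A * (2 * h) ^ α) * (oR (K2 * 3 ^ d * (h / D) ^ (1 - α)) * m +
        h * oR (K1 * (3 ^ d * (R : ℝ) ^ d * A * (11 * D) ^ α) * (h / D) ^ (-(d : ℝ))))) := by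
        rw [← Finset.sum_mul]; exact mul_le_mul_right (mul_le_mul_left tot _) _
    _ = _ := by
        have t1 : (h : ℝ) ^ α * (h : ℝ) ^ (1 - α) = h := by rw [← Qk hh]; simp
        have t2 : (h : ℝ) ^ α * (h : ℝ) ^ (-(d : ℝ)) = (h : ℝ) ^ (α - d) := by rw [← Qk hh]; rfl
        rw [mul_add, mul_add, mul_add, ← mul_assoc, ← mul_assoc, ← mul_assoc, ← Qw h, ← mul_assoc (oR h)]
        simp only [← Qa (by positivity : 0 ≤ b1 * C), ← Qa hh.le]
        rw [← Qa py, ← Qa py]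
        refine congrArg₂ (· + ·) (congrArg (fun t => oR t * m) ?_) (congrArg ENNReal.ofReal ?_)
        · rw [Qp ny hh.le, Ze hh.le hD0.le, show α - 1 = -(1 - α) by ring, Qu hD0.le]
          calc _ = b1 * C * A * 2 ^ α * (K2 * 3 ^ d) * (D ^ (1 - α))⁻¹ * ((h : ℝ) ^ α * (h : ℝ) ^ (1 - α)) := by ring
            _ = _ := by rw [t1]; ring
        · rw [Qp ny hh.le, Ze hh.le hD0.le, ← t2, Qu hD0.le]
          field_simp
open Classical in
lemma tb_triv {R : ℕ} (hR1 : 1 ≤ (R : ℕ)) {F : Set (Sym2 (V d))} {A : ℝ} (hT : ∀ ρ : ℝ, R ≤ ρ → ∑' u, (if br u ≤ ρ then tau (P β) F 0 u else 0) ≤ oR (A * ρ ^ α)) {x : V d}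
    (hx : normInf x ≤ 4 * R) : tb P β F R x ≤ oR (A * (5 * R) ^ α) := by
  have h1 : (1 : ℝ) ≤ R := by exact_mod_cast hR1
  refine le_trans ?_ (hT (5 * R) ly)
  rw [br_sum ly, show ⌊(5 * R : ℝ)⌋₊ = 5 * R by exact_mod_cast Nat.floor_natCast (5 * R), tb,
    ← Finset.sum_image (f := fun y => tau (P β) F 0 y) (g := fun t => x + t) (s := box d R) (fun _ _ _ _ h => add_left_cancel h)]
  refine QL fun y hy => ?_
  obtain ⟨t, ht, rfl⟩ := Zm.1 hy
  have := mem_box.1 ht; have := nI_add x t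
  exact mem_box.2 oy
open Classical in
lemma PW (hJ : KernelHyp d J α c C) (hP : IsLRP J P) (h1 : α < 1) {b1 A : ℝ} (hA : 0 < A) (hb : 0 ≤ b1) : ∃ B : ℝ, 0 < B ∧ ∀ β, 0 ≤ β → β ≤ b1 → ∀ F : Set (Sym2 (V d)), TI F → ∀ R : ℕ, 1 ≤ R →
    (∀ ρ : ℝ, R ≤ ρ → ∑' u, (if br u ≤ ρ then tau (P β) F 0 u else 0) ≤ oR (A * ρ ^ α)) →
    ∀ x, tb P β F R x ≤ oR (B * (R : ℝ) ^ d * (max (R : ℝ) (normInf x)) ^ (α - d)) := by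
  have hC : 0 ≤ C := hJ.c_pos.le.trans hJ.c_le_C
  have hαd : α - d < 0 := by linarith [hJ.alpha_lt_d]
  have hα := hJ.alpha_pos
  have hd1 : (1 : ℝ) ≤ d := by exact_mod_cast hJ.d_pos
  set s7 := (7 : ℝ) ^ (-(α - d)) with hs7
  have hs71 : 1 ≤ s7 := Real.one_le_rpow ny ly
  set η := b1 * C * A * 2 ^ α * (2 ^ ((d : ℝ) + α - 1) / (1 - 2 ^ ((d : ℝ) + α - 1 - d)) * 3 ^ d)
  obtain ⟨D, hD1, hD⟩ : ∃ D : ℝ, 1 ≤ D ∧ η * D ^ (α - 1) * s7 ≤ 1 / 2 := by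
    have ht := ((tendsto_rpow_neg_atTop (show 0 < 1 - α by linarith)).const_mul η).mul_const s7
    rw [mul_zero, zero_mul] at ht
    obtain ⟨D, h1, h2⟩ := ((ht.eventually_le_const (show (0 : ℝ) < 1 / 2 by norm_num)).and (Filter.eventually_ge_atTop 1)).exists
    exact ⟨D, h2, by rwa [neg_sub] at h1⟩
  have hη : 0 ≤ η := by
    have := QT (show (1 : ℝ) ≤ 2 by norm_num) (show (d : ℝ) + α - 1 - d ≤ 0 by linarith)
    have : 0 ≤ (2 : ℝ) ^ ((d : ℝ) + α - 1) / (1 - 2 ^ ((d : ℝ) + α - 1 - d)) := div_nonneg py ly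
    positivity
  set E := b1 * C * A * 2 ^ α * (2 ^ α / (1 - 2 ^ (α - (d + α))) * (3 ^ d * A * (11 * D) ^ α) * D ^ (d : ℝ))
  have hE : 0 ≤ E := by
    have := QT (show (1 : ℝ) ≤ 2 by norm_num) (show α - (d + α) ≤ 0 by linarith)
    have : 0 ≤ (2 : ℝ) ^ α / (1 - 2 ^ (α - (d + α))) := div_nonneg py ly
    positivity
  set B := 2 * E * s7 + A * 5 ^ α * 4 ^ (-(α - d))
  have hB : 0 < B := by positivity
  refine ⟨B, hB, fun β hβ hb1 F hF R hR hT => ?_⟩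
  have hR1 : (1 : ℝ) ≤ R := by exact_mod_cast hR
  have hR0 : (0 : ℝ) < R := by linarith
  have triv : ∀ x, normInf x ≤ 4 * R → tb P β F R x ≤ oR (B * (R : ℝ) ^ d * (max (R : ℝ) (normInf x)) ^ (α - d)) := fun x hx => by
    refine (tb_triv hR hT hx).trans (Qe ?_)
    have h4 : (4 * (R : ℝ)) ^ (α - d) ≤ (max (R : ℝ) (normInf x)) ^ (α - d) :=
      Qt (lt_max_of_lt_left hR0) (max_le ly (by exact_mod_cast hx)) hαd.le
    refine le_trans ?_ (mnl h4 py)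
    have e : (R : ℝ) ^ d * (R : ℝ) ^ (α - d) = (R : ℝ) ^ α := by rw [← Qx, ← Qk hR0]; congr 1; ring
    have e2 : (4 : ℝ) ^ (-(α - d)) * 4 ^ (α - d) = 1 := by rw [← Qk ny]; simp
    calc A * (5 * (R : ℝ)) ^ α = (A * 5 ^ α) * (4 ^ (-(α - d)) * 4 ^ (α - d)) * ((R : ℝ) ^ d * (R : ℝ) ^ (α - d)) := by
          rw [e, e2, Qp ny hR0.le]; ring
      _ = (A * 5 ^ α * 4 ^ (-(α - d))) * (R : ℝ) ^ d * (4 * (R : ℝ)) ^ (α - d) := by rw [Qp ny hR0.le]; ring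
      _ ≤ _ := by
          refine mnr (mnr ?_ py) py
          simp only [B]; have : 0 ≤ 2 * E * s7 := by positivity
          linarith
  set M0 : ℝ := ((box d R).card : ℝ)
  have hM0 : 0 ≤ M0 := ZK _
  have main : ∀ (j : ℕ) (x : V d), R ≤ normInf x → tb P β F R x ≤ oR (B * (R : ℝ) ^ d * (normInf x : ℝ) ^ (α - d) + (1 / 2) ^ j * M0) := by
    intro j
    induction j with
    | zero =>
      intro x _
      calc tb P β F R x ≤ ∑ t ∈ box d R, 1 := Qj fun t _ => tau_le_one (bern hJ hP hβ) _ _ _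
        _ = oR M0 := by rw [Qw]; simp
        _ ≤ _ := Qe (by simp only [pow_zero, one_mul]; have : 0 ≤ B * (R : ℝ) ^ d * (normInf x : ℝ) ^ (α - d) := py; linarith)
    | succ j ih =>
      intro x hx
      rcases le_total (normInf x) (4 * R) with h4 | h4
      · have := triv x h4
        rw [max_eq_right (by exact_mod_cast hx)] at this
        exact this.trans (Qe (by have : 0 ≤ (1 / 2 : ℝ) ^ (j + 1) * M0 := py; linarith))
      set h := normInf x / 4
      have hh : R ≤ h := by omega
      have hh0 : (0 : ℝ) < h := by exact_mod_cast oy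
      have st := pw_step hJ hP h1 hβ hb1 hF (x := x) (h := h) oy oy hR hh hA.le hT hD1
        (m := oR (B * (R : ℝ) ^ d * (h : ℝ) ^ (α - d) + (1 / 2) ^ j * M0)) (fun x' hx' => (ih x' (hh.trans hx')).trans (Qe (by
          have : (normInf x' : ℝ) ^ (α - d) ≤ (h : ℝ) ^ (α - d) := Qt hh0 (by exact_mod_cast hx') hαd.le
          have := mnl this (show 0 ≤ B * (R : ℝ) ^ d by positivity)
          linarith)))
      rw [← Qa py, ← Qo py py] at st
      refine st.trans (Qe ?_)
      change η * D ^ (α - 1) * _ + E * _ * _ ≤ _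
      set e := η * D ^ (α - 1)
      have he : 0 ≤ e := by positivity
      have hx7 : (h : ℝ) ^ (α - d) ≤ s7 * (normInf x : ℝ) ^ (α - d) := by
        have hx0 : (0 : ℝ) < normInf x := by exact_mod_cast oy
        have : ((normInf x : ℝ) / 7) ≤ h := by rw [div_le_iff₀ ny]; exact_mod_cast (by omega : normInf x ≤ h * 7)
        refine (Qt py this hαd.le).trans_eq ?_
        rw [Ze hx0.le ny, hs7, Qu ny]; field_simp
      set X := (normInf x : ℝ) ^ (α - d)
      have hX : 0 ≤ X := by positivity
      set Rd := (R : ℝ) ^ d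
      have hRd : 0 ≤ Rd := by positivity
      have he2 : e ≤ 1 / 2 := by nlinarith
      have f1 : e * (B * Rd * (h : ℝ) ^ (α - d)) ≤ 1 / 2 * (B * Rd * X) := by
        calc e * (B * Rd * (h : ℝ) ^ (α - d)) ≤ e * (B * Rd * (s7 * X)) := by gcongr
          _ = (e * s7) * (B * Rd * X) := by ring
          _ ≤ _ := mnr hD py
      have f2 : E * Rd * (h : ℝ) ^ (α - d) ≤ 1 / 2 * (B * Rd * X) := by
        calc E * Rd * (h : ℝ) ^ (α - d) ≤ E * Rd * (s7 * X) := by gcongr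
          _ = 1 / 2 * ((2 * E * s7) * Rd * X) := by ring
          _ ≤ _ := by
            have : 2 * E * s7 ≤ B := by simp only [B]; have : 0 ≤ A * 5 ^ α * (4 : ℝ) ^ (-(α - d)) := py; linarith
            gcongr
      have f3 : e * ((1 / 2) ^ j * M0) ≤ 1 / 2 * ((1 / 2) ^ j * M0) := mnr he2 py
      rw [pow_succ]
      linarith
  intro x
  rcases le_total (normInf x) R with hx | hx
  · exact triv x oy
  · rw [max_eq_right (by exact_mod_cast hx)]
    have ht : QX (fun j : ℕ => oR (B * (R : ℝ) ^ d * (normInf x : ℝ) ^ (α - d) + (1 / 2) ^ j * M0)) Zz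
        (nhds (oR (B * (R : ℝ) ^ d * (normInf x : ℝ) ^ (α - d) + 0 * M0))) :=
      (ENNReal.continuous_ofReal.tendsto _).comp (((_root_.tendsto_pow_atTop_nhds_zero_of_lt_one ny ny).mul_const M0).const_add _)
    rw [zero_mul, add_zero] at ht
    exact ge_of_tendsto' ht fun j => main j x hx
end P11
section P12
variable {d : ℕ} {J : V d → V d → ℝ} {α c C : ℝ} {P : ℝ → Measure (Config d)} {β δ : ℝ}
lemma inc1 (hJ : KernelHyp d J α c C) (hP : IsLRP J P) (hβ : 0 ≤ β) {b1 : ℝ} (hb1 : β ≤ b1) {M R : ℕ} (hM : 1 ≤ M) (y : V d) :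
    tau (P β) (Fl d R) 0 y ≤ tau (P β) (Fl d M) 0 y + oR (b1 * C) * oR ((M : ℝ) ^ (-((d : ℝ) + α))) * ∑' u, tau (P β) (Fl d M) 0 u * tb P β (Fl d R) R (u - y) := by
  have B := bern hJ hP hβ
  refine (first_edge B 0 y (F := Fl d M)).trans (add_le_add_right ?_ _)
  rw [← Qg]
  refine Qd fun u => ?_
  rw [← (Equiv.addLeft u).tsum_eq]
  simp only [Equiv.coe_addLeft, tb, Qv]
  rw [tsum_eq_sum (s := box d R)]
  · refine Qj fun t ht => ?_
    have e : tau (P β) (Fl d R) (u + t) y = tau (P β) (Fl d R) 0 (u - y + t) := by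
      rw [tau_symm, tau_ti0 hJ hP hβ (TI_Fl R)]; congr 1; abel
    rw [e, mul_comm (tau (P β) (Fl d M) 0 u), mul_assoc]
    refine mul_le_mul_left ?_ _
    by_cases h : s(u, u + t) ∈ Fl d R \ Fl d M
    · rw [QC h]
      have h2 := h.2
      rw [mem_Fl, sub_add_cancel_left, nI_neg, not_le] at h2
      refine (Qe ((pr_le β _).trans_eq (by rw [jw_mk hJ]))).trans ((w_le hJ hβ hb1 ?_).trans (mul_le_mul_right (Qe ?_) _))
      · intro h; rw [left_eq_add] at h; simp [h, nI_zero] at h2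
      · rw [add_sub_cancel_left]
        have hd : (0 : ℝ) ≤ d := ZK _
        exact Qt (by exact_mod_cast hM) (le_trans (by exact_mod_cast h2.le) (nI_br t)) (by linarith [hJ.alpha_pos])
    · rw [QD h]; exact zero_le
  · intro t ht
    rw [QD, mul_zero, zero_mul]
    intro h; have := h.1
    rw [mem_Fl, sub_add_cancel_left, nI_neg] at this
    exact ht (mem_box.2 this)
open Classical in
lemma inc2 (hJ : KernelHyp d J α c C) (hα : (d : ℝ) = 3 * α) {t : V d → ℝ≥0∞} {R : ℕ} (hR : 1 ≤ R) {A : ℝ} (hA : 0 ≤ A)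
    (hT : ∀ ρ : ℝ, R ≤ ρ → ∑' u, (if br u ≤ ρ then t u else 0) ≤ oR (A * ρ ^ α)) {y : V d} (hy : normInf y ≤ R) :
    ∑' u, t u * oR ((max (R : ℝ) (normInf (u - y))) ^ (-(2 * α))) ≤ oR (A * (2 ^ α + 2 ^ (2 * α) * (2 ^ α / (1 - 2 ^ (α - 2 * α))) * 2 ^ (-α)) * (R : ℝ) ^ (-α)) := by
  have a0 := hJ.alpha_pos
  have R0 : (0 : ℝ) < R := by exact_mod_cast hR
  have h1 := D1 (f := br) (g := t) (r := 2 * R) (s := 2 * α) py hA ly ly (fun ρ hρ => hT ρ ly)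
  have hK : 0 ≤ (2 : ℝ) ^ α / (1 - 2 ^ (α - 2 * α)) := div_nonneg py (by
    have := QT (show (1 : ℝ) ≤ 2 by norm_num) (show α - 2 * α ≤ 0 by linarith); linarith)
  set K := (2 : ℝ) ^ α / (1 - 2 ^ (α - 2 * α))
  calc _ ≤ ∑' u, (oR ((R : ℝ) ^ (-(2 * α))) * (if br u ≤ 2 * R then t u else 0) + oR (2 ^ (2 * α)) * (if 2 * R < br u then oR (br u ^ (-(2 * α))) * t u else 0)) := by
        refine Qd fun u => ?_
        rcases le_or_gt (br u) (2 * R) with h | h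
        · rw [if_pos h, if_neg h.not_gt, mul_zero, add_zero, mul_comm]
          exact mul_le_mul_left (Qe (Qt R0 (le_max_left _ _) ly)) _
        · rw [if_neg h.not_ge, if_pos h, mul_zero, zero_add, ← mul_assoc, mul_comm, ← Qa py]
          refine mul_le_mul_left (Qe ?_) _
          have h3 : br u / 2 ≤ max (R : ℝ) (normInf (u - y)) := by
            have e1 : br u = normInf u := max_eq_right (by by_contra h'; push Not at h'; have : br u = 1 := max_eq_left h'.le
                                                           have : (1 : ℝ) ≤ R := (by exact_mod_cast hR); linarith)
            have e2 : (normInf u : ℝ) ≤ normInf (u - y) + normInf y := by exact_mod_cast nI_tri u y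
            have e3 : (normInf y : ℝ) ≤ R := by exact_mod_cast hy
            exact le_max_of_le_right ly
          refine (Qt (by linarith [br0 u]) h3 ly).trans_eq ?_
          rw [Ze (br0 u).le ny, Qu zero_le_two]; field_simp
    _ ≤ oR ((R : ℝ) ^ (-(2 * α))) * oR (A * (2 * R) ^ α) + oR (2 ^ (2 * α)) * oR (K * A * (2 * R) ^ (α - 2 * α)) := by
        rw [Qr, Qg, Qg]
        exact add_le_add (mul_le_mul_right (hT _ ly) _) (mul_le_mul_right h1 _)
    _ = _ := by
        rw [← Qa py, ← Qa py, ← Qo py py]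
        congr 1
        rw [show α - 2 * α = -α by ring, Qp zero_le_two R0.le, Qp zero_le_two R0.le, show -α = -(2 * α) + α by ring, Qk R0]; ring
lemma tau_lim (P : Measure (Config d)) {a : ℕ → ℕ} (ha : Monotone a) (h' : ∀ n, n ≤ a n) (x : V d) {m : ℝ≥0∞} (h : ∀ n, tau P (Fl d (a n)) 0 x ≤ m) : tau P Set.univ 0 x ≤ m := by
  have e : {ω | cn (op ω ∩ Set.univ) 0 x} ⊆ ⋃ n, {ω : Config d | cn (op ω ∩ Fl d (a n)) 0 x} := by
    intro ω hω
    simp only [Qy, Ql]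
    refine cn_ind (O := op ω ∩ Set.univ) (Q := fun y => ∃ n, cn (op ω ∩ Fl d (a n)) y x) (z := x) ⟨0, .refl⟩ ?_ hω
    rintro u v hu - ⟨n, hn⟩
    have hm : ∀ k l, k ≤ l → Fl d (a k) ⊆ Fl d (a l) := fun k l h => Fl_mono (ha h)
    refine ⟨max n (normInf (u - v)), (cn.one (O := op ω ∩ Fl d _) ⟨hu.1, mem_Fl.2 ((le_max_right _ _).trans (h' _))⟩).trans (hn.mono (Set.inter_subset_inter_right _ (hm _ _ (le_max_left _ _))))⟩
  refine (measure_mono e).trans ?_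
  have mo : Monotone fun n => {ω : Config d | cn (op ω ∩ Fl d (a n)) 0 x} := fun k l hkl ω hω => cn.mono (Set.inter_subset_inter_right _ (Fl_mono (ha hkl))) hω
  rw [mo.measure_iUnion]
  exact iSup_le h
open Classical in
lemma S6 (hJ : KernelHyp d J α c C) (hP : IsLRP J P) (h1 : α < 1) (hα : α = (d : ℝ) / 3) {b0 b1 : ℝ} (hb0 : 0 < b0) (hb1 : b0 ≤ b1) :
    ∃ B : ℝ, 0 < B ∧ ∀ β, b0 ≤ β → β ≤ b1 → ch P β ≠ ∞ → ∀ x, tau (P β) Set.univ 0 x ≤ oR (B * br x ^ (-(2 * α))) := by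
  have hd : (d : ℝ) = 3 * α := by linarith
  have a0 := hJ.alpha_pos
  have hC : 0 ≤ C := hJ.c_pos.le.trans hJ.c_le_C
  have hb : 0 ≤ b1 := hb0.le.trans hb1
  obtain ⟨N, hN, A, hA, h4⟩ := S4 hJ hP hα (b1 := b1) hb0
  obtain ⟨B, hB, hpw⟩ := PW hJ hP h1 hA hb
  set K' : ℝ := 2 ^ α + 2 ^ (2 * α) * (2 ^ α / (1 - 2 ^ (α - 2 * α))) * 2 ^ (-α)
  have hK' : 0 ≤ K' := by
    have := QT (show (1 : ℝ) ≤ 2 by norm_num) (show α - 2 * α ≤ 0 by linarith)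
    have : (0 : ℝ) ≤ 1 - 2 ^ (α - 2 * α) := by linarith
    positivity
  have N0 : (0 : ℝ) < N := by exact_mod_cast oy
  set E := b1 * C * B * A * K' * (N : ℝ) ^ (2 * α)
  have hE : 0 ≤ E := by positivity
  set q := (N : ℝ) ^ (-(2 * α))
  have hq : 0 < q := by positivity
  have hq1 : q < 1 := Zd (by exact_mod_cast oy) ly
  have qk : ∀ k : ℕ, ((N : ℝ) ^ k) ^ (-(2 * α)) = q ^ k := fun k => by
    rw [← Qx, ← Qx, ← QM N0.le, ← QM N0.le, mul_comm]
  set E' := E / (1 - q)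
  have hE' : 0 ≤ E' := div_nonneg hE ly
  obtain ⟨B2, hB2, hpw2⟩ := PW hJ hP h1 (A := A + E' * (N : ℝ) ^ (2 * α) * 3 ^ d) py hb
  refine ⟨B2, hB2, fun β hβ0 hβ1 hch => ?_⟩
  have hβ : 0 ≤ β := hb0.le.trans hβ0
  have Np : ∀ k, 1 ≤ N ^ k := fun k => ZI _ _ oy
  have hT : ∀ (k : ℕ) (ρ : ℝ), ((N ^ k : ℕ) : ℝ) ≤ ρ → ∑' u, (if br u ≤ ρ then tau (P β) (Fl d (N ^ k)) 0 u else 0) ≤ oR (A * ρ ^ α) := fun k ρ hρ => by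
    have h1 : (1 : ℝ) ≤ ρ := le_trans (by exact_mod_cast Np k) hρ
    rw [br_sum h1]
    refine (h4 β hβ0 hβ1 hch k _ (Nat.le_floor hρ)).trans (Qe ?_)
    exact mnl (Real.rpow_le_rpow py (Nat.floor_le ly) a0.le) hA.le
  have inc : ∀ (k : ℕ) (y : V d), normInf y ≤ N ^ (k + 1) → tau (P β) (Fl d (N ^ (k + 1))) 0 y ≤ tau (P β) (Fl d (N ^ k)) 0 y + oR (E * q ^ k) := fun k y hy => by
    refine (inc1 hJ hP hβ hβ1 (Np k) y).trans (add_le_add_right ?_ _)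
    have M0 : (0 : ℝ) < N ^ k := by positivity
    have hle : N ^ k ≤ N ^ (k + 1) := Zc oy oy
    have i2 := inc2 hJ hd (Np (k + 1)) hA.le (fun ρ hρ => hT k ρ (le_trans (by exact_mod_cast hle) hρ)) hy
    calc _ ≤ oR (b1 * C) * oR (((N ^ k : ℕ) : ℝ) ^ (-((d : ℝ) + α))) * ∑' u, oR (B * ((N ^ (k + 1) : ℕ) : ℝ) ^ d) * (tau (P β) (Fl d (N ^ k)) 0 u * oR ((max (((N ^ (k + 1) : ℕ) : ℝ)) (normInf (u - y))) ^ (-(2 * α)))) := by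
          refine mul_le_mul_right (Qd fun u => ?_) _
          rw [mul_left_comm, ← Qa py]
          refine mul_le_mul_right ((hpw β hβ hβ1 _ (TI_Fl _) _ (Np _) (hT (k + 1)) _).trans_eq ?_) _
          rw [show α - d = -(2 * α) by linarith]
      _ ≤ oR (b1 * C) * oR (((N ^ k : ℕ) : ℝ) ^ (-((d : ℝ) + α))) * (oR (B * ((N ^ (k + 1) : ℕ) : ℝ) ^ d) * oR (A * K' * ((N ^ (k + 1) : ℕ) : ℝ) ^ (-α))) := by
          rw [Qg]; exact mul_le_mul_right (mul_le_mul_right i2 _) _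
      _ = _ := by
          rw [← Qa py, ← Qa py, ← Qa py]
          congr 1
          rw [← qk, ← Qx _ d, hd, show -(3 * α + α) = -(2 * α) + -(3 * α) + α by ring]
          push_cast
          rw [Qk M0, Qk M0, pow_succ, Qp M0.le N0.le, Qp M0.le N0.le, Qu M0.le (3 * α), Qu M0.le α, Qu N0.le α]
          simp only [E]
          rw [show (N : ℝ) ^ (3 * α) = N ^ (2 * α) * N ^ α by rw [← Qk N0]; congr 1; ring]
          field_simp
  have up : ∀ (k : ℕ) (y : V d), normInf y ≤ N ^ (k + 1) → tau (P β) Set.univ 0 y ≤ tau (P β) (Fl d (N ^ k)) 0 y + oR (E' * q ^ k) := fun k y hy => by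
    refine tau_lim (P β) (a := fun m => N ^ (k + m)) (fun a b h => Zc oy oy) (fun n => ((Nat.lt_pow_self oy).le.trans (Zc oy (by omega : n ≤ k + n)))) _ fun m => ?_
    have : tau (P β) (Fl d (N ^ (k + m))) 0 y ≤ tau (P β) (Fl d (N ^ k)) 0 y + oR (E' * q ^ k * (1 - q ^ m)) := by
      induction m with
      | zero => simp
      | succ m ih =>
        have qm : q ^ m ≤ 1 := pow_le_one₀ hq.le hq1.le
        refine (inc (k + m) y (hy.trans (Zc oy oy))).trans ((add_le_add_left ih _).trans_eq ?_)
        rw [add_assoc, ← Qo (mul_nonneg py ly) py]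
        congr 2
        simp only [E']; have : 1 - q ≠ 0 := by linarith
        field_simp; ring
    refine this.trans (add_le_add_right (Qe ?_) _)
    have : 0 < q ^ m := by positivity
    exact mul_le_of_le_one_right py ly
  intro x
  have := hpw2 β hβ hβ1 Set.univ TI_univ 1 le_rfl (fun ρ hρ => ?_) x
  · refine le_trans ?_ (this.trans_eq ?_)
    · refine le_trans (le_of_eq ?_) (Finset.single_le_sum (f := fun t => tau (P β) Set.univ 0 (x + t)) (fun _ _ => zero_le) (show (0 : V d) ∈ box d 1 by simp [mem_box, nI_zero]))
      simp
    · simp only [Nat.cast_one, one_pow, mul_one, br]; rw [show α - d = -(2 * α) by linarith]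
  · rw [Nat.cast_one] at hρ
    obtain ⟨k, k1, k2⟩ := exists_nat_pow_near hρ (show (1 : ℝ) < N by exact_mod_cast oy)
    have ρ0 : 0 < ρ := by linarith
    calc _ ≤ ∑' u, ((if br u ≤ ρ then tau (P β) (Fl d (N ^ k)) 0 u else 0) + oR (E' * q ^ k) * (if br u ≤ ρ then 1 else 0)) := by
          refine Qd fun u => ?_
          split_ifs with hu
          · rw [mul_one]; exact up k u (by have := (nI_br u).trans (hu.trans k2.le); exact_mod_cast this)
          · simp
      _ ≤ oR (A * ρ ^ α) + oR (E' * q ^ k) * oR (3 ^ d * ρ ^ (d : ℝ)) := by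
          rw [Qr, Qg]
          exact add_le_add (hT k ρ (by push_cast; exact k1)) (mul_le_mul_right (cnt ρ0) _)
      _ ≤ _ := by
          rw [← Qa py, ← Qo py py]
          refine Qe ?_
          have : q ^ k ≤ (N : ℝ) ^ (2 * α) * ρ ^ (-(2 * α)) := by
            rw [← qk]
            refine (Qt (x := ρ / N) py (by rw [div_le_iff₀ N0, ← pow_succ]; exact k2.le) ly).trans_eq ?_
            rw [Ze ρ0.le N0.le, Qu N0.le]; field_simp
          have e : ρ ^ α = ρ ^ (-(2 * α)) * ρ ^ (d : ℝ) := by rw [← Qk ρ0, hd]; congr 1; ring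
          calc A * ρ ^ α + E' * q ^ k * (3 ^ d * ρ ^ (d : ℝ)) ≤ A * ρ ^ α + E' * ((N : ℝ) ^ (2 * α) * ρ ^ (-(2 * α))) * (3 ^ d * ρ ^ (d : ℝ)) := by gcongr
            _ = _ := by rw [e]; ring
end P12
section P13
variable {d : ℕ} {J : V d → V d → ℝ} {α c C : ℝ} {P : ℝ → Measure (Config d)} {β δ : ℝ}
lemma ts_sub (t : V d → ℝ≥0∞) (u : V d) : ∑' v, t (v - u) = ∑' v, t v := (Equiv.subRight u).tsum_eq t
noncomputable def cv (t : V d → ℝ≥0∞) (v : V d) : ℝ≥0∞ := ∑' u, t u * t (v - u)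
lemma cv_sum (t : V d → ℝ≥0∞) : ∑' v, cv t v = (∑' v, t v) * ∑' v, t v := by
  simp only [cv]
  rw [Qh, ← Qn]
  refine tsum_congr fun u => ?_
  rw [Qg, ts_sub]
open Classical in
lemma S7a (a0 : 0 < α) (hd : (d : ℝ) = 3 * α) {B : ℝ} (hB : 0 < B) : ∃ C2 : ℝ, 0 < C2 ∧ ∀ t : V d → ℝ≥0∞, (∀ x, t x ≤ oR (B * br x ^ (-(2 * α)))) →
    ∀ v, cv t v ≤ oR (C2 * br v ^ (-α)) := by
  have k2 : (0 : ℝ) < 1 - 2 ^ (2 * α - d) := by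
    have := Zd (show (1 : ℝ) < 2 by norm_num) (show 2 * α - d < 0 by linarith); linarith
  have k1 : (0 : ℝ) < 1 - 2 ^ (d - 4 * α) := by
    have := Zd (show (1 : ℝ) < 2 by norm_num) (show d - 4 * α < 0 by linarith); linarith
  set K2 : ℝ := 2 ^ (2 * α) / (1 - 2 ^ (2 * α - d)) * 3 ^ d
  set K1 : ℝ := 2 ^ (d : ℝ) / (1 - 2 ^ (d - 4 * α)) * 3 ^ d
  refine ⟨2 * B ^ 2 * (2 ^ (2 * α) * K2 + K1), by positivity, fun t ht v => ?_⟩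
  have h2 := D2 (f := br (d := d)) (g := fun _ => 1) (A := 3 ^ d) (b := d) (s := 2 * α) (r := br v) (br0 v) py ly ly br0 (fun ρ hρ => cnt hρ)
  have h1 := D1 (f := br (d := d)) (g := fun _ => 1) (A := 3 ^ d) (b := d) (s := 4 * α) (r := br v) (br0 v) py ly ly (fun ρ hρ => cnt ((br0 v).trans_le hρ))
  simp only [mul_one] at h1 h2
  have half : ∑' u, (if br u ≤ br (v - u) then t u * t (v - u) else 0) ≤ oR (B ^ 2 * (2 ^ (2 * α) * K2 + K1) * br v ^ (-α)) := by
    calc _ ≤ ∑' u, (oR (B ^ 2 * 2 ^ (2 * α) * br v ^ (-(2 * α))) * (if br u ≤ br v then oR (br u ^ (-(2 * α))) else 0) + oR (B ^ 2) * (if br v < br u then oR (br u ^ (-(4 * α))) else 0)) := by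
          refine Qd fun u => ?_
          split_ifs with h h' h'' h''
          · linarith
          · rw [mul_zero, add_zero, ← Qa (by have := br0 v; positivity)]
            refine (mul_le_mul' (ht u) (ht _)).trans ?_
            rw [← Qa (by have := br0 u; positivity)]
            refine Qe ?_
            have e : br v / 2 ≤ br (v - u) := by have := br_add u (v - u); rw [add_sub_cancel] at this; linarith
            have e2 := Qt (by linarith [br0 v]) e (show -(2 * α) ≤ 0 by linarith)
            rw [Ze (br0 v).le zero_le_two, Qu zero_le_two, div_inv_eq_mul] at e2
            have := mnl e2 (show 0 ≤ B ^ 2 * br u ^ (-(2 * α)) by have := br0 u; positivity)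
            linarith
          · rw [mul_zero, zero_add, ← Qa py]
            refine (mul_le_mul' (ht u) (ht _)).trans ?_
            rw [← Qa (by have := br0 u; positivity)]
            refine Qe ?_
            have e2 := Qt (br0 u) h (show -(2 * α) ≤ 0 by linarith)
            rw [show -(4 * α) = -(2 * α) + -(2 * α) by ring, Qk (br0 u)]
            have := mnl e2 (show 0 ≤ B ^ 2 * br u ^ (-(2 * α)) by have := br0 u; positivity)
            linarith
          · exact absurd (lt_of_not_ge h') h''
          all_goals exact zero_le
      _ ≤ oR (B ^ 2 * 2 ^ (2 * α) * br v ^ (-(2 * α))) * oR (K2 * br v ^ (d - 2 * α)) + oR (B ^ 2) * oR (K1 * br v ^ (d - 4 * α)) := by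
          rw [Qr, Qg, Qg]
          exact add_le_add (mul_le_mul_right h2 _) (mul_le_mul_right h1 _)
      _ = _ := by
          have := br0 v
          rw [← Qa py, ← Qa py, ← Qo py py]
          congr 1
          rw [show d - 4 * α = -α by linarith, show br v ^ (-α) = br v ^ (-(2 * α)) * br v ^ (d - 2 * α) by rw [← Qk this]; congr 1; linarith]; ring
  have half' : ∑' u, (if br (v - u) ≤ br u then t u * t (v - u) else 0) ≤ oR (B ^ 2 * (2 ^ (2 * α) * K2 + K1) * br v ^ (-α)) := by
    rw [← (Equiv.subLeft v).tsum_eq]; simpa [mul_comm] using half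
  calc cv t v ≤ ∑' u, ((if br u ≤ br (v - u) then t u * t (v - u) else 0) + (if br (v - u) ≤ br u then t u * t (v - u) else 0)) := by
        refine Qd fun u => ?_
        rcases le_total (br u) (br (v - u)) with h | h
        · rw [if_pos h]; exact le_self_add
        · rw [if_pos h]; exact le_add_self
    _ ≤ _ := by
        rw [Qr]; refine (add_le_add half half').trans_eq ?_
        have := br0 v
        rw [← Qo py py]; congr 1; ring
open Classical in
lemma S7 (a0 : 0 < α) (hd : (d : ℝ) = 3 * α) {B : ℝ} (hB : 0 < B) : ∃ C7 : ℝ, 0 < C7 ∧ ∀ t : V d → ℝ≥0∞, (∀ x, t x ≤ oR (B * br x ^ (-(2 * α)))) →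
    ∀ X : ℝ, 1 ≤ X → ∑' x, t x = oR X → (∀ u, ∑' v, t (v - u) * cv t v ≤ oR (C7 * (1 + Qb X))) ∧ ∑' v, cv t v ^ 3 ≤ oR (C7 * (1 + Qb X)) := by
  obtain ⟨C2, hC2, h2⟩ := S7a a0 hd hB
  set K : ℝ := 2 ^ (d : ℝ) * 3 ^ d * (2 * α⁻¹ + 1)
  have hK : 0 < K := by positivity
  refine ⟨2 * (B * C2) * K + C2 + B + C2 ^ 3 * K + C2 ^ 2, by positivity, fun t ht X hX hs => ?_⟩
  have lX := Qz hX
  have X0 : 0 < X := by linarith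
  set R := X ^ α⁻¹
  have hR : 1 ≤ R := Real.one_le_rpow hX py
  have R0 : 0 < R := by linarith
  have Ra : R ^ (-α) = X⁻¹ := by simp only [R]; rw [← QM X0.le, mul_neg, inv_mul_cancel₀ a0.ne', Real.rpow_neg_one]
  have R2 : R ^ (-(2 * α)) = X⁻¹ * X⁻¹ := by rw [← Ra, ← Qk R0]; congr 1; ring
  have g3 : ∑' u : V d, (if br u ≤ R then oR (br u ^ (-(d : ℝ))) else 0) ≤ oR (K * (1 + Qb X)) := by
    have h := D3 (f := br (d := d)) (g := fun _ => 1) (A := 3 ^ d) (s := d) (r := R) hR py py br1 (fun ρ hρ => cnt hρ)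
    simp only [mul_one] at h
    refine h.trans (Qe ?_)
    rw [Real.log_rpow X0, mul_assoc]
    simp only [K]
    rw [mul_assoc, mul_assoc]
    refine mnl (mnl ?_ py) py
    have : 0 < α⁻¹ := by positivity
    nlinarith
  have pw3 : ∀ v : V d, br v ^ (-α) * br v ^ (-(2 * α)) = br v ^ (-(d : ℝ)) := fun v => by rw [← Qk (br0 v)]; congr 1; linarith
  have hS : ∑' v, cv t v = oR (X * X) := by rw [cv_sum, hs, Qa X0.le]
  constructor
  · intro u
    calc _ ≤ ∑' v, (oR (B * C2) * (if br (v - u) ≤ R then oR (br (v - u) ^ (-(d : ℝ))) else 0) + oR (B * C2) * (if br v ≤ R then oR (br v ^ (-(d : ℝ))) else 0) +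
          oR (C2 * R ^ (-α)) * t (v - u) + oR (B * R ^ (-(2 * α))) * cv t v) := by
          refine Qd fun v => ?_
          have b1 := br0 v; have b2 := br0 (v - u)
          by_cases hv : br v ≤ R
          · by_cases hw : br (v - u) ≤ R
            · rw [if_pos hv, if_pos hw]
              refine le_trans ?_ (le_self_add.trans le_self_add)
              rw [← mul_add, ← Qo py py, ← Qa py]
              refine (mul_le_mul' (ht _) (h2 t ht _)).trans ?_
              rw [← Qa py]
              refine Qe ?_
              rw [show B * br (v - u) ^ (-(2 * α)) * (C2 * br v ^ (-α)) = B * C2 * (br v ^ (-α) * br (v - u) ^ (-(2 * α))) by ring]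
              refine mnl ?_ py
              rw [← pw3, ← pw3]
              rcases le_total (br v) (br (v - u)) with h | h
              · have := Qt b1 h (show -(2 * α) ≤ 0 by linarith)
                have := mnl this (show 0 ≤ br v ^ (-α) by positivity)
                have : 0 ≤ br (v - u) ^ (-α) * br (v - u) ^ (-(2 * α)) := by positivity
                linarith
              · have := Qt b2 h (show -α ≤ 0 by linarith)
                have := mnr this (show 0 ≤ br (v - u) ^ (-(2 * α)) by positivity)
                have : 0 ≤ br v ^ (-α) * br v ^ (-(2 * α)) := by positivity
                linarith
            · refine le_trans (mul_le_mul_left ((ht _).trans (Qe (mnl ?_ hB.le))) _) le_add_self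
              exact Qt R0 (not_le.1 hw).le ly
          · refine le_trans ?_ (le_add_self.trans le_self_add)
            rw [mul_comm]
            exact mul_le_mul_left ((h2 t ht v).trans (Qe (mnl (Qt R0 (not_le.1 hv).le ly) hC2.le))) _
      _ ≤ oR (B * C2) * oR (K * (1 + Qb X)) + oR (B * C2) * oR (K * (1 + Qb X)) + oR (C2 * R ^ (-α)) * oR X + oR (B * R ^ (-(2 * α))) * oR (X * X) := by
          rw [Qr, Qr, Qr, Qg, Qg, Qg, Qg, hS, ts_sub t u, hs,
            ts_sub (fun v => if br v ≤ R then oR (br v ^ (-(d : ℝ))) else 0)]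
          gcongr
      _ ≤ _ := by
          rw [Ra, R2]
          rw [← Qa py, ← Qa py, ← Qa py, ← Qo py py, ← Qo py py, ← Qo py py]
          refine Qe ?_
          rw [show C2 * X⁻¹ * X = C2 by field_simp, show B * (X⁻¹ * X⁻¹) * (X * X) = B by field_simp]
          have : 0 ≤ (C2 + B) * Qb X + (C2 ^ 3 * K + C2 ^ 2) * (1 + Qb X) := by positivity
          linarith
  · calc _ ≤ ∑' v, (oR (C2 ^ 3) * (if br v ≤ R then oR (br v ^ (-(d : ℝ))) else 0) + oR (C2 ^ 2 * R ^ (-(2 * α))) * cv t v) := by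
          refine Qd fun v => ?_
          have b1 := br0 v
          have e2 : ∀ x : ℝ, 0 < x → (x ^ (-α)) ^ 2 = x ^ (-(2 * α)) := fun x hx => by rw [sq, ← Qk hx]; congr 1; ring
          by_cases hv : br v ≤ R
          · rw [if_pos hv]; refine le_trans ?_ le_self_add
            refine (pow_le_pow_left₀ zero_le (h2 t ht v) 3).trans_eq ?_
            rw [← Zr py, ← Qa py, mul_pow, ← pw3, ← e2 _ b1]; congr 1; ring
          · rw [pow_succ]; refine le_trans (mul_le_mul_left ?_ _) le_add_self
            refine (pow_le_pow_left₀ zero_le (h2 t ht v) 2).trans ?_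
            rw [← Zr py, mul_pow, e2 _ b1]
            exact Qe (mnl (Qt R0 (not_le.1 hv).le ly) py)
      _ ≤ oR (C2 ^ 3) * oR (K * (1 + Qb X)) + oR (C2 ^ 2 * R ^ (-(2 * α))) * oR (X * X) := by
          rw [Qr, Qg, Qg, hS]; gcongr
      _ ≤ _ := by
          rw [R2, ← Qa py, ← Qa py, ← Qo py py]
          refine Qe ?_
          rw [show C2 ^ 2 * (X⁻¹ * X⁻¹) * (X * X) = C2 ^ 2 by field_simp]
          have : 0 ≤ C2 ^ 2 * Qb X + (2 * (B * C2) * K + C2 + B) * (1 + Qb X) := by positivity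
          linarith
end P13
section P14
variable {d : ℕ} {J : V d → V d → ℝ} {α c C : ℝ} {P : ℝ → Measure (Config d)} {β δ : ℝ}
lemma sw4 {ι : Type*} (X : ι → ι → ℝ≥0∞) (p q : ι → ι → ι → ℝ≥0∞) :
    ∑' a, ∑' b, ∑' u, ∑' v, X u v * (p u v a * q u v b) = ∑' u, ∑' v, X u v * ((∑' a, p u v a) * ∑' b, q u v b) := by
  calc _ = ∑' a, ∑' u, ∑' b, ∑' v, X u v * (p u v a * q u v b) := tsum_congr fun a => Qh
    _ = ∑' u, ∑' a, ∑' b, ∑' v, X u v * (p u v a * q u v b) := Qh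
    _ = ∑' u, ∑' a, ∑' v, ∑' b, X u v * (p u v a * q u v b) := tsum_congr fun u => tsum_congr fun a => Qh
    _ = ∑' u, ∑' v, ∑' a, ∑' b, X u v * (p u v a * q u v b) := tsum_congr fun u => Qh
    _ = _ := tsum_congr fun u => tsum_congr fun v => by simp only [Qg, Qn]
lemma sft (t : V d → ℝ≥0∞) (F : V d → V d → ℝ≥0∞) : ∑' h, ∑' u, ∑' v, t u * F (h - u) (v - u) = (∑' u, t u) * ∑' h, ∑' v, F h v := by
  rw [Qh, ← Qn]
  refine tsum_congr fun u => ?_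
  simp only [Qg]
  rw [← ts_sub (fun h => ∑' v, F h v) u]
  exact congrArg _ (tsum_congr fun h => ts_sub (F (h - u)) u)
lemma four_sum (hJ : KernelHyp d J α c C) (hP : IsLRP J P) (hβ : 0 ≤ β) {L L' : ℝ≥0∞} (hL : ∀ u, ∑' v, tau (P β) Set.univ 0 (v - u) * cv (tau (P β) Set.univ 0) v ≤ L)
    (hL' : ∑' v, cv (tau (P β) Set.univ 0) v ^ 3 ≤ L') :
    ∑' h, ∑' a, ∑' b, P β {ω | cn (op ω) 0 h ∧ cn (op ω) 0 a ∧ cn (op ω) 0 b} * (tau (P β) Set.univ h a * tau (P β) Set.univ h b) ≤ ch P β * (2 * L ^ 2 + L') := by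
  set t := tau (P β) Set.univ 0 with ht
  have tT : ∀ x y, tau (P β) Set.univ x y = t (y - x) := tau_ti0 hJ hP hβ TI_univ
  have te : ∀ x, t (-x) = t x := fun x => by rw [ht, tau_symm, tT, zero_sub, neg_neg]
  have ts : ∀ x y, t (x - y) = t (y - x) := fun x y => by rw [← te, neg_sub]
  have hc : ∀ u h, ∑' a, t (a - u) * t (a - h) = cv t (h - u) := fun u h => by
    rw [cv, ← ts_sub (fun a => t a * t (h - u - a)) u]; exact tsum_congr fun a => by rw [ts a h, sub_sub_sub_cancel_right]
  have cs : ∀ x y, cv t (x - y) = cv t (y - x) := fun x y => by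
    rw [← hc, ← hc]; exact tsum_congr fun a => mul_comm _ _
  have m1 : ∑' h, ∑' v, t v * t (h - v) * (cv t h * cv t (h - v)) ≤ L ^ 2 := by
    calc _ = ∑' h, ∑' v, (t v * cv t v) * (t (h - v) * cv t h) := tsum_congr fun h => by
          rw [← (Equiv.subLeft h).tsum_eq]; refine tsum_congr fun v => ?_
          simp only [Equiv.subLeft_apply, _root_.sub_sub_cancel]; ring
      _ ≤ ∑' v, (t v * cv t v) * L := by
          rw [Qh]
          exact Qd fun v => by rw [Qg]; exact mul_le_mul_right (hL v) _
      _ ≤ _ := by rw [Qn, sq]; exact mul_le_mul_left (by simpa using hL 0) _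
  have m2 : ∑' h, ∑' v, t h * t v * (cv t (h - v) * cv t (h - v)) ≤ L' := by
    refine le_trans (le_of_eq ?_) hL'
    calc _ = ∑' h, ∑' v, t h * t (h - v) * (cv t v * cv t v) := tsum_congr fun h => by
          rw [← (Equiv.subLeft h).tsum_eq]; simp
      _ = _ := by
          rw [Qh]; refine tsum_congr fun v => ?_
          rw [Qn]
          have := hc 0 v; simp only [sub_zero] at this
          rw [this]; ring
  have k1 : ∀ h, ∑' a, ∑' b, ∑' u, ∑' v, (t u * (t (h - v) * t (v - u))) * ((t (a - u) * t (a - h)) * (t (b - v) * t (b - h))) = ∑' u, ∑' v, t u * (t (v - u) * t ((h - u) - (v - u)) * (cv t (h - u) * cv t ((h - u) - (v - u)))) := fun h => by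
    rw [sw4]; exact tsum_congr fun u => tsum_congr fun v => by rw [hc, hc, sub_sub_sub_cancel_right]; ring
  have k3 : ∀ h, ∑' a, ∑' b, ∑' u, ∑' v, (t u * (t (h - u) * t (v - u))) * ((t (a - v) * t (a - h)) * (t (b - v) * t (b - h))) = ∑' u, ∑' v, t u * (t (h - u) * t (v - u) * (cv t ((h - u) - (v - u)) * cv t ((h - u) - (v - u)))) := fun h => by
    rw [sw4]; exact tsum_congr fun u => tsum_congr fun v => by rw [hc, sub_sub_sub_cancel_right]; ring
  calc _ ≤ ∑' h, ∑' a, ∑' b, (∑' u, ∑' v, (t u * (t (h - v) * t (v - u))) * ((t (a - u) * t (a - h)) * (t (b - v) * t (b - h))) +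
        (∑' u, ∑' v, (t u * (t (h - v) * t (v - u))) * ((t (b - u) * t (b - h)) * (t (a - v) * t (a - h))) +
          ∑' u, ∑' v, (t u * (t (h - u) * t (v - u))) * ((t (a - v) * t (a - h)) * (t (b - v) * t (b - h))))) := by
        refine Qd fun h => Qd fun a => Qd fun b => ?_
        have e : {ω : Config d | cn (op ω) 0 h ∧ cn (op ω) 0 a ∧ cn (op ω) 0 b} = {ω | cn (op ω) h 0 ∧ cn (op ω) h a ∧ cn (op ω) h b} := by
          ext ω; exact ⟨fun ⟨h1, h2, h3⟩ => ⟨h1.symm, h1.symm.trans h2, h1.symm.trans h3⟩, fun ⟨h1, h2, h3⟩ => ⟨h1.symm, h1.symm.trans h2, h1.symm.trans h3⟩⟩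
        rw [e]
        refine (mul_le_mul_left (four_pt_prob (bern hJ hP hβ) h 0 a b) _).trans_eq ?_
        rw [← Qn]
        simp only [← Qn, tT, add_mul, Qr, zero_sub, te]
        refine congrArg₂ (· + ·) (tsum_congr fun u => tsum_congr fun v => ?_) (congrArg₂ (· + ·) ?_ (tsum_congr fun u => tsum_congr fun v => ?_))
        · ring
        · rw [Qh]; refine tsum_congr fun u => tsum_congr fun v => ?_
          rw [ts u v]; ring
        · ring
    _ ≤ ch P β * L ^ 2 + (ch P β * L ^ 2 + ch P β * L') := by
        simp only [Qr]
        have e2 : ∀ h, ∑' a, ∑' b, ∑' u, ∑' v, (t u * (t (h - v) * t (v - u))) * ((t (b - u) * t (b - h)) * (t (a - v) * t (a - h))) = ∑' a, ∑' b, ∑' u, ∑' v, (t u * (t (h - v) * t (v - u))) * ((t (a - u) * t (a - h)) * (t (b - v) * t (b - h))) := fun h => Qh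
        simp only [e2, k1, k3]
        rw [sft t (fun h v => t v * t (h - v) * (cv t h * cv t (h - v))), sft t (fun h v => t h * t v * (cv t (h - v) * cv t (h - v)))]
        exact add_le_add (mul_le_mul_right m1 _) (add_le_add (mul_le_mul_right m1 _) (mul_le_mul_right m2 _))
    _ = _ := by ring
end P14
section P15
variable {d : ℕ} {J : V d → V d → ℝ} {α c C : ℝ} {P : ℝ → Measure (Config d)} {β δ : ℝ}
def KA (A : Finset (V d)) : Set (Config d) := {ω | ∀ y, y ∈ A ↔ cn (op ω) 0 y}
lemma meas_KA (A : Finset (V d)) : MeasurableSet (KA A) := by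
  have : KA A = ⋂ y, {ω | y ∈ A ↔ cn (op ω) 0 y} := by ext; simp [KA]
  rw [this]
  refine MeasurableSet.iInter fun y => ?_
  by_cases h : y ∈ A <;> simp only [h, true_iff, false_iff]
  exacts [meas_conn _ _, (meas_conn _ _).compl]
lemma dep_KA (A : Finset (V d)) : dep (ins (A : Set (V d))ᶜ)ᶜ (KA A) := by
  intro ω ω' h hω y
  constructor
  · intro hy
    refine cn.symm (cn_ind (Q := fun x => cn (op ω') x 0) .refl (fun a b hab hb ih => (cn.one (O := op ω') ?_).trans ih) ((hω y).1 hy).symm)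
    have : s(a, b) ∈ (ins (A : Set (V d))ᶜ)ᶜ := fun h => (mem_ins.1 h).2 ((hω b).2 hb.symm)
    exact (h _ this).symm.trans hab
  · intro hy
    refine cn_ind (Q := fun x => x ∈ A) ((hω 0).2 .refl) (fun a b hab hb ih => ?_) hy.symm
    have : s(a, b) ∈ (ins (A : Set (V d))ᶜ)ᶜ := fun h => (mem_ins.1 h).2 ih
    exact (hω a).2 (((hω b).1 ih).trans (cn.one (O := op ω) ((h _ this).trans hab)).symm)
lemma kap_le (μ : Measure (Config d)) {E : Finset (V d) → Set (Config d)} (hE : ∀ A, MeasurableSet (E A)) {G : Set (Config d)} (h : ∀ A, KA A ∩ E A ⊆ G) :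
    ∑' A, μ (KA A ∩ E A) ≤ μ G := by
  refine (tsum_meas_le_meas_iUnion_of_disjoint μ (fun A => (meas_KA A).inter (hE A)) fun A A' hne => Set.disjoint_left.2 fun ω h1 h2 => hne ?_).trans (measure_mono (Set.iUnion_subset h))
  ext y; rw [h1.1 y, h2.1 y]
lemma kap_null (hch : ch P β ≠ ∞) : P β {ω | ¬ ∃ A, ω ∈ KA A} = 0 := by
  have h := ENNReal.tendsto_tsum_compl_atTop_zero hch
  refine le_antisymm (ge_of_tendsto' h fun Λ => ?_) zero_le
  refine (measure_mono fun ω hω => ?_).trans (measure_iUnion_le (fun x : {x // x ∉ Λ} => {ω : Config d | cn (op ω ∩ Set.univ) 0 x}))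
  by_contra h'
  simp only [Qy, not_exists, Set.inter_univ, Subtype.forall, Ql] at h' hω
  have hf : {y | cn (op ω) 0 y}.Finite := Λ.finite_toSet.subset fun y hy => by by_contra h2; exact h' y h2 hy
  exact hω hf.toFinset fun y => by simp
open Classical in
lemma kap_full (hch : ch P β ≠ ∞) (a : V d) : tau (P β) Set.univ 0 a ≤ ∑' A : Finset (V d), P β (KA A) * (if a ∈ A then 1 else 0) := by
  calc _ ≤ P β ({ω | ¬ ∃ A, ω ∈ KA A} ∪ ⋃ A : Finset (V d), if a ∈ A then KA A else ∅) := measure_mono fun ω hω => by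
        by_cases h : ∃ A, ω ∈ KA A
        · obtain ⟨A, hA⟩ := h
          rw [Ql, Set.inter_univ] at hω
          exact Or.inr (Qy.2 ⟨A, by rw [if_pos ((hA a).2 hω)]; exact hA⟩)
        · exact Or.inl h
    _ ≤ 0 + ∑' A : Finset (V d), P β (if a ∈ A then KA A else ∅) := (measure_union_le _ _).trans (add_le_add (kap_null hch).le (measure_iUnion_le _))
    _ = _ := by rw [zero_add]; exact tsum_congr fun A => by split_ifs <;> simp
lemma amgm {a b l : ℝ≥0∞} (h0 : l ≠ 0) (h1 : l ≠ ∞) : a * b ≤ l * a * a + l⁻¹ * (b * b) := by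
  rcases le_total b (l * a) with h | h
  · exact (mul_le_mul_right h a).trans ((mul_comm _ _).le.trans le_self_add)
  · refine le_trans ?_ le_add_self
    have : a ≤ l⁻¹ * b := by
      calc a = l⁻¹ * (l * a) := by rw [← mul_assoc, ENNReal.inv_mul_cancel h0 h1, one_mul]
        _ ≤ _ := mul_le_mul_right h _
    exact (mul_le_mul_left this b).trans_eq (mul_assoc _ _ _)
open Classical in
noncomputable def WW (J : V d → V d → ℝ) (P : ℝ → Measure (Config d)) (β : ℝ) (A : Finset (V d)) (v : V d) : ℝ≥0∞ :=
  ∑' z, ∑' u, (if z ∉ A ∧ u ∉ A then tau (P β) (ins (A : Set (V d))ᶜ) z u * oR (β * J u v) else 0)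
lemma WW_le (hJ : KernelHyp d J α c C) (hP : IsLRP J P) (hβ : 0 ≤ β) (A : Finset (V d)) (v : V d) : WW J P β A v ≤ oR β * oR (JJ J) * ch P β := by
  calc _ ≤ ∑' z, ∑' u, tau (P β) Set.univ z u * oR (β * J u v) := Qd fun z => Qd fun u => by
        split_ifs
        · exact mul_le_mul_left (tau_mono (QO _) _ _) _
        · exact zero_le
    _ = ∑' u, oR (β * J u v) * ch P β := by
        rw [Qh]; refine tsum_congr fun u => ?_
        rw [Qn, mul_comm, ← ch_shift hJ hP hβ u]; congr 1; exact tsum_congr fun z => tau_symm _ _ _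
    _ = _ := by
        rw [Qn, ← JJ_sum hJ v, ← Qg]; congr 1
        exact tsum_congr fun u => by rw [Qa hβ, hJ.symm]
open Classical in
lemma ch_A (hJ : KernelHyp d J α c C) (hP : IsLRP J P) (hβ : 0 ≤ β) (A : Finset (V d)) {a : V d} (ha : a ∈ A) :
    ch P β ≤ ∑' v, (if v ∈ A then 1 else 0) * ((1 + WW J P β A v) * tau (P β) Set.univ v a) := by
  calc ch P β = ∑' z, tau (P β) Set.univ z a := by rw [← ch_shift hJ hP hβ a]; exact tsum_congr fun z => tau_symm _ _ _
    _ ≤ ∑' z, ∑' v, (if v ∈ A then 1 else 0) * (((if z = v then 1 else 0) + ∑' u, (if z ∉ A ∧ u ∉ A then tau (P β) (ins (A : Set (V d))ᶜ) z u * oR (β * J u v) else 0)) * tau (P β) Set.univ v a) := by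
        refine Qd fun z => ?_
        by_cases hz : z ∈ A
        · refine le_trans ?_ (ENNReal.le_tsum z)
          rw [if_pos hz, if_pos rfl, one_mul]; exact le_mul_of_one_le_left zero_le le_self_add
        · refine (fe_in hJ hP hβ Set.univ (S := (A : Set (V d))ᶜ) (by simpa using hz) a).trans ?_
          rw [tau_zero (S := (A : Set (V d))ᶜ) (fun x y hxy hx => (mem_ins.1 hxy.2).2) (by simpa using hz) (by simpa using ha), zero_add, Qh]
          refine Qd fun v => ?_
          rw [Qn]
          by_cases hv : v ∈ A
          · simp only [hv, if_true, one_mul, Set.univ_inter, Set.mem_univ, and_true, ZD, Finset.mem_coe, not_true, not_false_iff, hz, true_and]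
            exact mul_le_mul_left le_add_self _
          · simp [hv]
    _ = _ := by
        rw [Qh]; refine tsum_congr fun v => ?_
        rw [Qg, Qn, Qr, WW, tsum_ite_eq]
end P15
section P16
variable {d : ℕ} {J : V d → V d → ℝ} {α c C : ℝ} {P : ℝ → Measure (Config d)} {β δ : ℝ}
lemma kap1 (μ : Measure (Config d)) (R : Finset (V d) → Prop) [DecidablePred R] {G : Set (Config d)} (h : ∀ A, R A → KA A ⊆ G) :
    ∑' A, μ (KA A) * (if R A then 1 else 0) ≤ μ G := by
  refine le_trans (le_of_eq (tsum_congr fun A => ?_)) (kap_le μ (E := fun A => if R A then Set.univ else ∅) (fun A => ?_) (G := G) fun A => ?_)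
  all_goals by_cases hA : R A <;> simp [hA]
  exact h A hA
noncomputable def DZ (J : V d → V d → ℝ) (P : ℝ → Measure (Config d)) (β : ℝ) (z : V d) : ℝ≥0∞ :=
  ∑' u, ∑' v, oR (J u v) * P β {ω | cn (op ω) 0 u ∧ cT (op ω) v {z} ∧ ¬ cT (op ω) 0 {z}}
open Classical in
lemma S8a (hJ : KernelHyp d J α c C) (hP : IsLRP J P) (hβ : 0 ≤ β) (hch : ch P β ≠ ∞) {l : ℝ≥0∞} (h0 : l ≠ 0) (h1 : l ≠ ∞) :
    ch P β * ch P β ≤ l * (1 + oR β * oR (JJ J) * ch P β) * (ch P β + oR β * ∑' z, DZ J P β z) + l⁻¹ *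
      ∑' h, ∑' a, ∑' b, P β {ω | cn (op ω) 0 h ∧ cn (op ω) 0 a ∧ cn (op ω) 0 b} * (tau (P β) Set.univ h a * tau (P β) Set.univ h b) := by
  set M := 1 + oR β * oR (JJ J) * ch P β
  set T := tau (P β) Set.univ
  set κ := fun A : Finset (V d) => P β (KA A)
  set i := fun (A : Finset (V d)) v => if v ∈ A then (1 : ℝ≥0∞) else 0 with hi
  set W := WW J P β
  set S := fun (A : Finset (V d)) v => ∑' a, i A a * T v a
  have e2 : ch P β * ch P β ≤ ∑' A, κ A * ∑' v, i A v * ((1 + W A v) * S A v) := by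
    calc ch P β * ch P β = ∑' a, T 0 a * ch P β := by rw [Qn]; rfl
      _ ≤ ∑' a, ∑' A, κ A * (i A a * ch P β) := Qd fun a => by
          refine (mul_le_mul_left (kap_full hch a) _).trans_eq ?_
          rw [← Qn]; exact tsum_congr fun A => mul_assoc _ _ _
      _ ≤ ∑' a, ∑' A, κ A * (i A a * ∑' v, i A v * ((1 + W A v) * T v a)) := Qd fun a => Qd fun A => by
          by_cases ha : a ∈ A
          · exact mul_le_mul_right (mul_le_mul_right (ch_A hJ hP hβ A ha) _) _
          · simp [hi, ha]
      _ = _ := by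
          rw [Qh]; refine tsum_congr fun A => ?_
          rw [Qg]; congr 1
          simp_rw [← Qg]
          rw [Qh]; refine tsum_congr fun v => ?_
          simp only [S, ← Qg]
          exact tsum_congr fun a => by ring
  have e4 : ∑' A, κ A * ∑' v, i A v ≤ ch P β := by
    simp_rw [← Qg]
    rw [Qh]
    refine Qd fun v => kap1 (P β) (fun A => v ∈ A) (G := {ω | cn (op ω ∩ Set.univ) 0 v}) fun A hA ω hω => ?_
    have := (hω v).1 hA
    simpa using this
  have e5 : ∑' A, κ A * ∑' v, i A v * W A v ≤ oR β * ∑' z, DZ J P β z := by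
    calc _ = ∑' v, ∑' z, ∑' u, ∑' A, κ A * (i A v * (if z ∉ A ∧ u ∉ A then tau (P β) (ins (A : Set (V d))ᶜ) z u * oR (β * J u v) else 0)) := by
          simp only [W, WW, ← Qg]
          rw [Qh]; refine tsum_congr fun v => ?_
          rw [Qh]; refine tsum_congr fun z => ?_
          rw [Qh]
      _ ≤ ∑' v, ∑' z, ∑' u, oR (β * J u v) * P β {ω | cn (op ω) 0 v ∧ cT (op ω) u {z} ∧ ¬ cT (op ω) 0 {z}} := by
          refine Qd fun v => Qd fun z => Qd fun u => ?_
          set E : Finset (V d) → Set (Config d) := fun A => if v ∈ A ∧ z ∉ A ∧ u ∉ A then {ω | cn (op ω ∩ ins (A : Set (V d))ᶜ) z u} else ∅ with hE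
          refine le_trans (le_of_eq ?_) (mul_le_mul_right (kap_le (P β) (E := E) (fun A => ?_) fun A => ?_) _)
          · rw [← Qg]; refine tsum_congr fun A => ?_
            by_cases hA : v ∈ A ∧ z ∉ A ∧ u ∉ A
            · simp only [hE, hi, κ, if_pos hA, if_pos hA.1, if_pos hA.2]
              rw [(bern hJ hP hβ).indep (meas_KA A) (meas_cn _ _ _) (dep_KA A) (dep_cn _ _ _) disjoint_compl_left]
              simp only [tau]; ring
            · simp only [hE, if_neg hA, Set.inter_empty, measure_empty, mul_zero]
              by_cases hv : v ∈ A
              · rw [if_neg fun h => hA ⟨hv, h⟩]; simp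
              · simp [hi, hv]
          · simp only [hE]; split_ifs
            exacts [meas_cn _ _ _, MeasurableSet.empty]
          · simp only [hE]; split_ifs with hA
            · rintro ω ⟨hω, hc⟩
              refine ⟨(hω v).1 hA.1, ⟨z, rfl, cn.symm (cn.mono QZ hc)⟩, ?_⟩
              rintro ⟨t, rfl, ht⟩
              exact hA.2.1 ((hω _).2 ht)
            · simp
      _ = _ := by
          rw [Qh, ← Qg]; refine tsum_congr fun z => ?_
          rw [DZ, ← Qg]; refine tsum_congr fun v => ?_
          rw [← Qg]; refine tsum_congr fun u => ?_
          rw [Qa hβ, hJ.symm, mul_assoc]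
  have e6 : ∑' A, κ A * ∑' v, i A v * (S A v * S A v) ≤ ∑' h, ∑' a, ∑' b, P β {ω | cn (op ω) 0 h ∧ cn (op ω) 0 a ∧ cn (op ω) 0 b} * (T h a * T h b) := by
    calc _ = ∑' h, ∑' a, ∑' b, ∑' A, κ A * (if h ∈ A ∧ a ∈ A ∧ b ∈ A then 1 else 0) * (T h a * T h b) := by
          simp only [S, ← Qg, ← Qn]
          rw [Qh]; refine tsum_congr fun v => ?_
          rw [Qh]; refine tsum_congr fun a => ?_
          rw [Qh]; refine tsum_congr fun b => tsum_congr fun A => ?_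
          by_cases h1 : v ∈ A <;> by_cases h2 : a ∈ A <;> by_cases h3 : b ∈ A <;> simp [hi, h1, h2, h3, mul_comm]
      _ ≤ _ := Qd fun v => Qd fun a => Qd fun b => by
          rw [Qn]
          exact mul_le_mul_left (kap1 (P β) (fun A => v ∈ A ∧ a ∈ A ∧ b ∈ A) (G := {ω | cn (op ω) 0 v ∧ cn (op ω) 0 a ∧ cn (op ω) 0 b}) fun A hA ω hω => ⟨(hω _).1 hA.1, (hω _).1 hA.2.1, (hω _).1 hA.2.2⟩) _
  refine e2.trans ((?_ : _ ≤ l * M * (∑' A, κ A * ∑' v, i A v + ∑' A, κ A * ∑' v, i A v * W A v) + l⁻¹ * ∑' A, κ A * ∑' v, i A v * (S A v * S A v)).trans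
    (add_le_add (mul_le_mul_right (add_le_add e4 e5) _) (mul_le_mul_right e6 _)))
  rw [← Qr, ← Qg, ← Qg, ← Qr]
  refine Qd fun A => ?_
  calc _ ≤ κ A * ∑' v, (l * M * (i A v + i A v * W A v) + l⁻¹ * (i A v * (S A v * S A v))) := by
        refine mul_le_mul_right (Qd fun v => ?_) _
        calc _ ≤ i A v * (l * (1 + W A v) * (1 + W A v) + l⁻¹ * (S A v * S A v)) := mul_le_mul_right (amgm h0 h1) _
          _ ≤ i A v * (l * M * (1 + W A v) + l⁻¹ * (S A v * S A v)) := mul_le_mul_right (add_le_add_left (mul_le_mul_left (mul_le_mul_right (add_le_add_right (WW_le hJ hP hβ A v) _) _) _) _) _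
          _ = _ := by ring
    _ = _ := by
        rw [Qr, Qg, Qg, Qr]; ring
end P16
section P17
variable {d : ℕ} {J : V d → V d → ℝ} {α c C : ℝ} {P : ℝ → Measure (Config d)} {β δ : ℝ}
lemma tau_cT (z : V d) : tau (P β) Set.univ 0 z = P β {ω | cT (op ω) 0 {z}} := by simp [tau, cT]
lemma spr_sum (hJ : KernelHyp d J α c C) (hP : IsLRP J P) (hβ : 0 ≤ β) (Z : Finset (V d)) : ∀ {k : ℝ}, 0 ≤ k → oR k < ∑ z ∈ Z, DZ J P β z →
    ∃ δ₀ > 0, ∀ δ, 0 ≤ δ → δ ≤ δ₀ → ∑ z ∈ Z, tau (P β) Set.univ 0 z + oR (k * δ) ≤ ∑ z ∈ Z, tau (P (β + δ)) Set.univ 0 z := by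
  classical
  have hm : ∀ δ, 0 ≤ δ → ∀ z, tau (P β) Set.univ 0 z ≤ tau (P (β + δ)) Set.univ 0 z := fun δ hδ z => meas_dec_mono hJ hP hβ ly (meas_cn _ _ _) fun ω ω' h hc => hc.mono (Set.inter_subset_inter_left _ h)
  induction Z using Zu with
  | empty => simp
  | insert z Z hz ih =>
    intro k hk h
    simp only [Finset.sum_insert hz] at h ⊢
    by_cases h0 : DZ J P β z = 0
    · rw [h0, zero_add] at h
      obtain ⟨δ₀, h1, h2⟩ := ih hk h
      exact ⟨δ₀, h1, fun δ a b => by rw [add_assoc]; exact add_le_add (hm δ a z) (h2 δ a b)⟩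
    by_cases h0' : ∑ z ∈ Z, DZ J P β z = 0
    · rw [h0', add_zero] at h
      obtain ⟨δ₀, h1, h2⟩ := sprinkle' hJ hP hβ {z} h
      exact ⟨δ₀, h1, fun δ a b => by rw [add_right_comm, tau_cT, tau_cT]; exact add_le_add (h2 δ a b) (Qj fun z _ => hm δ a z)⟩
    obtain ⟨x, hx, y, hy, hxy⟩ := ENNReal.exists_lt_add_of_lt_add h h0 h0'
    obtain ⟨δ₁, h1, h2⟩ := sprinkle' hJ hP hβ {z} (k := x.toReal) (by rwa [QA hx.ne_top])
    obtain ⟨δ₂, h3, h4⟩ := ih QK (k := y.toReal) (by rwa [QA hy.ne_top])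
    refine ⟨min δ₁ δ₂, lt_min h1 h3, fun δ a b => ?_⟩
    rw [tau_cT, tau_cT]
    refine le_trans ?_ (add_le_add (h2 δ a (b.trans (min_le_left _ _))) (h4 δ a (b.trans (min_le_right _ _))))
    rw [add_add_add_comm]
    refine add_le_add_right ?_ _
    rw [← Qo py py, ← add_mul]
    refine Qe (mnr ?_ a)
    rw [← ENNReal.toReal_add hx.ne_top hy.ne_top]
    exact (ENNReal.ofReal_le_iff_le_toReal (ENNReal.add_ne_top.2 ⟨hx.ne_top, hy.ne_top⟩)).1 hxy.le
lemma spr_ch (hJ : KernelHyp d J α c C) (hP : IsLRP J P) (hβ : 0 ≤ β) {k : ℝ} (hk : 0 ≤ k) (h : oR k < ∑' z, DZ J P β z) :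
    ∃ δ₀ > 0, ∀ δ, 0 ≤ δ → δ ≤ δ₀ → ch P β + oR (k * δ) ≤ ch P (β + δ) := by
  rw [ENNReal.tsum_eq_iSup_sum, lt_iSup_iff] at h
  obtain ⟨Z, hZ⟩ := h
  obtain ⟨δ₀, h1, h2⟩ := spr_sum hJ hP hβ Z hk hZ
  refine ⟨δ₀, h1, fun δ a b => ?_⟩
  classical
  have hm : ∀ z, tau (P β) Set.univ 0 z ≤ tau (P (β + δ)) Set.univ 0 z := fun z => meas_dec_mono hJ hP hβ ly (meas_cn _ _ _) fun ω ω' h hc => hc.mono (Set.inter_subset_inter_left _ h)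
  have hs : ∀ b, ch P b = ∑ z ∈ Z, tau (P b) Set.univ 0 z + ∑' z, if z ∈ Z then 0 else tau (P b) Set.univ 0 z := fun b => by
    have : ∑ z ∈ Z, tau (P b) Set.univ 0 z = ∑' z, if z ∈ Z then tau (P b) Set.univ 0 z else 0 := by
      rw [tsum_eq_sum (s := Z) fun z hz => if_neg hz]; exact Qi rfl fun z hz => (if_pos hz).symm
    rw [this, ← Qr, ch]; exact tsum_congr fun z => by split_ifs <;> simp
  rw [hs, hs, add_right_comm]
  exact add_le_add (h2 δ a b) (Qd fun z => by split_ifs; exacts [le_rfl, hm z])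
lemma ell4 {X : ℝ} (hX : 1 ≤ X) : (1 + Qb X) ^ 2 ≤ 25 * √X := by
  have h1 := Real.log_le_rpow_div (x := X) (ε := 1/4) ly ny
  have h2 : 1 ≤ X ^ (1/4 : ℝ) := Real.one_le_rpow hX ny
  have h3 : √X = X ^ (1/4 : ℝ) * X ^ (1/4 : ℝ) := by rw [← Qk ly, Real.sqrt_eq_rpow]; norm_num
  have h4 := Qz hX
  rw [h3]; nlinarith
lemma ch_one (hJ : KernelHyp d J α c C) (hP : IsLRP J P) (hβ : 0 ≤ β) : 1 ≤ ch P β := by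
  exact (le_of_eq (tau_self (bern hJ hP hβ) _ _).symm).trans (ENNReal.le_tsum (0 : V d))
lemma S8b (hJ : KernelHyp d J α c C) (hP : IsLRP J P) (h1 : α < 1) (hα : α = (d : ℝ) / 3) {b0 b1 : ℝ} (hb0 : 0 < b0) (hb1 : b0 ≤ b1) :
    ∃ k X0 : ℝ, 0 < k ∧ 1 ≤ X0 ∧ ∀ β, b0 ≤ β → β ≤ b1 → ∀ X, X0 ≤ X → ch P β = oR X → oR (k * (X ^ 2 / (1 + Qb X) ^ 2)) < ∑' z, DZ J P β z := by
  obtain ⟨B, hB, hB'⟩ := S6 hJ hP h1 hα hb0 hb1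
  obtain ⟨C7, h7, h7'⟩ := S7 hJ.alpha_pos (show (d : ℝ) = 3 * α by linarith) hB
  have hj := JJ_pos hJ
  have hb1' : 0 < b1 := hb0.trans_le hb1
  set Cq := 2 * C7 ^ 2 + C7
  set m := 1 + b1 * JJ J
  set K := 4 * Cq * m
  have hCq : 0 < Cq := by positivity
  have hm : 0 < m := by positivity
  have hK : 0 < K := by positivity
  refine ⟨1 / (4 * K * b1), max 1 ((50 * K) ^ 2), by positivity, le_max_left _ _, fun β h2 h3 X hX hch => ?_⟩
  have hX1 := (le_max_left _ _).trans hX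
  have hX0 : 0 < X := by linarith
  have hl0 := Qz hX1
  have h4 := ell4 hX1
  have hβ : 0 ≤ β := by linarith
  set ℓ := 1 + Qb X
  have hℓ : 1 ≤ ℓ := by linarith
  have hne : ch P β ≠ ∞ := by rw [hch]; exact ENNReal.ofReal_ne_top
  obtain ⟨e1, e2⟩ := h7' (tau (P β) Set.univ 0) (hB' β h2 h3 hne) X hX1 hch
  have e3 := four_sum hJ hP hβ e1 e2
  have e4 := S8a hJ hP hβ hne (l := oR (2 * Cq * ℓ ^ 2 / X)) (by simp; positivity) ENNReal.ofReal_ne_top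
  have hlog : 2 * K * ℓ ^ 2 ≤ X := by
    have : 50 * K ≤ √X := Real.le_sqrt_of_sq_le ((le_max_right _ _).trans hX)
    nlinarith [Zt hX0.le, mnr this (ZP X)]
  by_contra! hD
  set D := ∑' z, DZ J P β z
  have hQ : ch P β * (2 * oR (C7 * ℓ) ^ 2 + oR (C7 * ℓ)) ≤ oR (X * (Cq * ℓ ^ 2)) := by
    rw [hch, ← Zr py, show (2 : ℝ≥0∞) = oR 2 by simp, ← Qa py, ← Qo py py, ← Qa py]
    refine Qe (mnl ?_ hX0.le)
    simp only [Cq]; nlinarith [mnl hℓ (show 0 ≤ C7 * ℓ by positivity)]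
  have e5 := e4.trans (add_le_add (mul_le_mul_right (add_le_add_right (mul_le_mul_right hD _) _) _) (mul_le_mul_right (e3.trans hQ) _))
  rw [hch, ← Qa hX0.le, ← ENNReal.ofReal_inv_of_pos py, ← Qa hβ, ← Qa py, ← QP, ← Qo py py,
    ← Qa hβ, ← Qo hX0.le py, ← Qa py, ← Qa py, ← Qa py, ← Qo py py,
    Zn py] at e5
  have f1 : (2 * Cq * ℓ ^ 2 / X)⁻¹ * (X * (Cq * ℓ ^ 2)) = X ^ 2 / 2 := by field_simp
  have f2 : X + β * (1 / (4 * K * b1) * (X ^ 2 / ℓ ^ 2)) ≤ 3 / 4 * (X ^ 2 / (K * ℓ ^ 2)) := by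
    have g1 : X ≤ 1 / 2 * (X ^ 2 / (K * ℓ ^ 2)) := by
      rw [← mul_div_assoc, le_div_iff₀ py]; nlinarith
    have g2 : β * (1 / (4 * K * b1) * (X ^ 2 / ℓ ^ 2)) ≤ b1 * (1 / (4 * K * b1) * (X ^ 2 / ℓ ^ 2)) := mnr h3 py
    have g3 : b1 * (1 / (4 * K * b1) * (X ^ 2 / ℓ ^ 2)) = 1 / 4 * (X ^ 2 / (K * ℓ ^ 2)) := by field_simp
    linarith
  have f3 : 2 * Cq * ℓ ^ 2 / X * (1 + β * JJ J * X) ≤ 2 * Cq * ℓ ^ 2 * m := by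
    rw [div_mul_eq_mul_div, div_le_iff₀ hX0, mul_assoc _ m]
    refine mnl ?_ py
    simp only [m]; nlinarith [mnr h3 (show 0 ≤ JJ J * X by positivity)]
  have f4 := mul_le_mul f3 f2 py py
  have f5 : 2 * Cq * ℓ ^ 2 * m * (3 / 4 * (X ^ 2 / (K * ℓ ^ 2))) = 3 / 8 * X ^ 2 := by simp only [K]; field_simp; norm_num
  nlinarith [sq_pos_of_pos hX0]
end P17
section P18
variable {d : ℕ} {J : V d → V d → ℝ} {α c C : ℝ} {P : ℝ → Measure (Config d)} {β δ : ℝ}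
noncomputable def GG (x : ℝ) : ℝ := ((1 + Qb x) ^ 2 + 2 * (1 + Qb x) + 2) / x
lemma GG_d {x : ℝ} (hx : 0 < x) : HasDerivAt GG (-((1 + Qb x) ^ 2 / x ^ 2)) x := by
  have h := (Real.hasDerivAt_log hx.ne').const_add 1
  refine ((((h.pow 2).add (h.const_mul 2)).add_const 2).div (hasDerivAt_id x) hx.ne').congr_deriv ?_
  simp; field_simp; ring
lemma GG_mv {x y : ℝ} (hx : 1 ≤ x) (hxy : x < y) : ∃ c, x < c ∧ c < y ∧ GG y = GG x - (1 + Qb c) ^ 2 / c ^ 2 * (y - x) := by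
  obtain ⟨c, hc, h⟩ := exists_hasDerivAt_eq_slope GG (fun x => -((1 + Qb x) ^ 2 / x ^ 2)) hxy
    (fun z hz => (GG_d (by linarith [hz.1])).continuousAt.continuousWithinAt) (fun z hz => GG_d (by linarith [hz.1]))
  refine ⟨c, hc.1, hc.2, ?_⟩
  rw [_root_.eq_div_iff ly] at h; linarith
lemma GG_anti {x y : ℝ} (hx : 1 ≤ x) (hxy : x ≤ y) : GG y ≤ GG x := by
  rcases hxy.eq_or_lt with rfl | h
  · exact le_rfl
  obtain ⟨c, h1, h2, h3⟩ := GG_mv hx h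
  have : 0 ≤ (1 + Qb c) ^ 2 / c ^ 2 * (y - x) := mul_nonneg py ly
  linarith
lemma GG_dec {x h : ℝ} (hx : 1 ≤ x) (h0 : 0 < h) (h1 : h ≤ x / 4) : GG (x + h) ≤ GG x - (1 + Qb x) ^ 2 / (2 * x ^ 2) * h := by
  obtain ⟨c, h2, h3, h4⟩ := GG_mv hx (show x < x + h by linarith)
  rw [h4, add_sub_cancel_left]
  refine sub_le_sub_left (mnr ?_ h0.le) _
  have := Qz hx
  exact div_le_div₀ py (pow_le_pow_left₀ py (by linarith [ZR ly h2.le]) 2) (by nlinarith) (by nlinarith)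
lemma S8c (hJ : KernelHyp d J α c C) (hP : IsLRP J P) {k X0 a : ℝ} (ha : 0 < a) (hab : a < betaC P) (hk : 0 < k) (hX0 : 1 ≤ X0)
    (hD : ∀ β, a ≤ β → β ≤ betaC P → ∀ X, X0 ≤ X → ch P β = oR X → oR (k * (X ^ 2 / (1 + Qb X) ^ 2)) < ∑' z, DZ J P β z)
    (hX : X0 ≤ (ch P a).toReal) : k / 2 * (betaC P - a) ≤ GG (ch P a).toReal := by
  have fin : ∀ t, a ≤ t → t < betaC P → ch P t ≠ ∞ := fun t h1 h2 => bc_lt hJ hP ly h2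
  have mono : ∀ s t, a ≤ s → s ≤ t → t < betaC P → (ch P s).toReal ≤ (ch P t).toReal := fun s t h1 h2 h3 => QS (fin t (h1.trans h2) h3) (ch_mono hJ hP ly h2)
  have key : ∀ b, a < b → b < betaC P → k / 2 * (b - a) ≤ GG (ch P a).toReal := by
    intro b h1 h2
    have := dini (g := fun t => -GG (ch P t).toReal) (k := k / 2) h1.le (fun s hs t ht hst => neg_le_neg (GG_anti (hX0.trans (hX.trans (mono a s le_rfl hs.1 (by linarith [hs.2])))) (mono s t hs.1 hst (by linarith [ht.2])))) ?_
    · have h3 : 0 ≤ GG (ch P b).toReal := by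
        have : 1 ≤ (ch P b).toReal := hX0.trans (hX.trans (mono a b le_rfl h1.le h2))
        have := Qz this
        unfold GG; positivity
      linarith
    intro t h3 h4
    set X := (ch P t).toReal
    have hXX : X0 ≤ X := hX.trans (mono a t le_rfl h3 ly)
    have hX1 : 1 ≤ X := hX0.trans hXX
    have hl := Qz hX1
    have hch := (QA (fin t h3 ly)).symm
    set k' := k * (X ^ 2 / (1 + Qb X) ^ 2) with hk'
    have hk0 : 0 < k' := by positivity
    obtain ⟨δ₀, h5, h6⟩ := spr_ch hJ hP (show 0 ≤ t by linarith) hk0.le (hD t h3 ly X hXX hch)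
    set δ := min δ₀ (min (b - t) (X / (4 * k')))
    have hδ : 0 < δ := lt_min h5 (lt_min ly py)
    have d2 : δ ≤ b - t := (min_le_right _ _).trans (min_le_left _ _)
    have d3 : δ ≤ X / (4 * k') := (min_le_right _ _).trans (min_le_right _ _)
    refine ⟨t + δ, by linarith, by linarith, ?_⟩
    have h7 := h6 δ hδ.le (min_le_left _ _)
    rw [hch, ← Qo py py, ENNReal.ofReal_le_iff_le_toReal (fin _ ly ly)] at h7
    have h8 := GG_anti (show 1 ≤ X + k' * δ by nlinarith) h7
    have h9 := GG_dec hX1 (h := k' * δ) py (by rw [le_div_iff₀ py] at d3; linarith)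
    have : (1 + Qb X) ^ 2 / (2 * X ^ 2) * (k' * δ) = k / 2 * δ := by rw [hk']; field_simp
    simp only [add_sub_cancel_left]
    show -GG X + _ ≤ _
    linarith
  have h2 : QX (fun b => k / 2 * (b - a)) (nhdsWithin (betaC P) (Set.Iio (betaC P))) (nhds (k / 2 * (betaC P - a))) :=
    tendsto_nhdsWithin_of_tendsto_nhds (Continuous.tendsto (by fun_prop) _)
  refine le_of_tendsto h2 ?_
  filter_upwards [Ioo_mem_nhdsLT hab] with b hb
  exact key b hb.1 hb.2
lemma S8 (hJ : KernelHyp d J α c C) (hP : IsLRP J P) (h1 : α < 1) (hα : α = (d : ℝ) / 3) : 0 < betaC P ∧ ∃ C8 : ℝ, 0 < C8 ∧ ∀ ε, 0 < ε → ε ≤ 1 → ε ≤ betaC P / 2 →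
    ch P (betaC P - ε) ≤ oR (C8 * ε⁻¹ * (1 + Qb ε⁻¹) ^ 2) := by
  have hb : 0 < betaC P := lt_of_lt_of_le (by have := JJ_pos hJ; positivity) (bc_pos hJ hP (hex_ hJ hP hα))
  refine ⟨hb, ?_⟩
  obtain ⟨k, X0, hk, hX0, hD⟩ := S8b hJ hP h1 hα (b0 := betaC P / 2) (b1 := betaC P) ly ly
  set A := max 1 (250 / k)
  have hA1 : 1 ≤ A := le_max_left _ _
  have hA2 : 250 / k ≤ A := le_max_right _ _
  have hlA := Qz hA1
  refine ⟨X0 + 10 / k * (3 + 2 * Qb A) ^ 2, by positivity, fun ε e0 e1 e2 => ?_⟩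
  have ei : 1 ≤ ε⁻¹ := (one_le_inv₀ e0).2 e1
  have hle := Qz ei
  set a := betaC P - ε
  have fin : ch P a ≠ ∞ := bc_lt hJ hP ly ly
  rw [← QA fin]
  refine Qe ?_
  set X := (ch P a).toReal
  have hx1 : 1 ≤ ε⁻¹ * (1 + Qb ε⁻¹) ^ 2 := one_le_mul_of_one_le_of_one_le ei (one_le_pow₀ ly)
  rcases le_total X X0 with h | h
  · have : 0 ≤ 10 / k * (3 + 2 * Qb A) ^ 2 := by positivity
    rw [mul_assoc]; nlinarith
  have h3 := S8c hJ hP (show 0 < a by linarith) ly hk hX0 (fun β hβ => hD β ly) h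
  have hX1 : 1 ≤ X := hX0.trans h
  have hl := Qz hX1
  have h4 := ell4 hX1
  have h5 : k / 2 * ε * X ≤ 5 * (1 + Qb X) ^ 2 := by
    have : betaC P - a = ε := by simp [a]
    rw [this, GG, le_div_iff₀ ly] at h3
    nlinarith
  have h6 : √X ≤ A * ε⁻¹ := by
    have s0 : 0 < √X := QU.2 ly
    have : k / 2 * ε * √X ≤ 125 := by
      refine le_of_mul_le_mul_right ?_ s0
      calc k / 2 * ε * √X * √X = k / 2 * ε * X := by rw [mul_assoc, ZS ly]
        _ ≤ _ := by linarith
    rw [← div_eq_mul_inv, le_div_iff₀ e0]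
    refine le_trans ?_ hA2
    rw [le_div_iff₀ hk]; linarith
  have h7 : Qb X ≤ 2 * (Qb A + Qb ε⁻¹) := by
    rw [← Real.log_mul ly ly]
    have := ZR (QU.2 ly) h6
    rw [Real.log_sqrt ly] at this; linarith
  have h8 : (1 + Qb X) ^ 2 ≤ ((3 + 2 * Qb A) * (1 + Qb ε⁻¹)) ^ 2 := pow_le_pow_left₀ ly (by nlinarith) 2
  calc X = ε⁻¹ * (2 / k) * (k / 2 * ε * X) := by field_simp
    _ ≤ ε⁻¹ * (2 / k) * (5 * ((3 + 2 * Qb A) * (1 + Qb ε⁻¹)) ^ 2) := mnl ly py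
    _ = (10 / k * (3 + 2 * Qb A) ^ 2) * ε⁻¹ * (1 + Qb ε⁻¹) ^ 2 := by ring
    _ ≤ _ := by
      rw [mul_assoc, mul_assoc (X0 + _)]
      exact mnr ly ly
end P18
section P19
variable {d : ℕ} {J : V d → V d → ℝ} {α c C : ℝ} {P : ℝ → Measure (Config d)} {β δ : ℝ}
def cl (U : Finset (V d)) (T : Sw (V d)) : Set (V d) := {y | ∃ u ∈ U, cn T u y}
noncomputable def fU (n : ℕ) (U : Finset (V d)) (T : Finset (Sym2 (V d))) : ℝ := ∑ j ∈ Qm 1 n, ind ((j : ℕ∞) ≤ (cl U (T : Sw (V d))).encard)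
lemma cl_ins {U : Finset (V d)} {T : Set (Sym2 (V d))} {u w : V d} (hu : u ∈ U) : cl U (insert s(u, w) T) = cl (insert w U) T := by
  ext y; constructor
  · rintro ⟨x, hx, h⟩
    refine cn_ind (Q := fun y => y ∈ cl (insert w U) T) ⟨x, by simp [hx], .refl⟩ (fun a b hab _ ⟨z, hz, hb⟩ => ?_) h.symm
    rcases hab with hab | hab
    · rcases Zi.1 hab with ⟨rfl, rfl⟩ | ⟨rfl, rfl⟩
      · exact ⟨_, Finset.mem_insert_of_mem hu, .refl⟩
      · exact ⟨_, Finset.mem_insert_self _ _, .refl⟩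
    · exact ⟨z, hz, hb.trans (cn.one hab).symm⟩
  · rintro ⟨x, hx, h⟩
    have h' : cn (insert s(u, w) T) x y := h.mono (Set.subset_insert _ _)
    rcases Finset.mem_insert.1 hx with rfl | hx
    · exact ⟨u, hu, (cn.one (Set.mem_insert _ _)).trans h'⟩
    · exact ⟨x, hx, h'⟩
lemma cl_none {U : Finset (V d)} {T : Set (Sym2 (V d))} (h : ∀ e ∈ T, ∀ u ∈ U, u ∉ e) : cl U T = U := by
  ext y; refine ⟨?_, fun hy => ⟨y, hy, .refl⟩⟩
  rintro ⟨x, hx, hc⟩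
  exact cn_ind (Q := fun y => y ∈ (U : Set (V d))) hx (fun a b hab _ hb => absurd (Sym2.mem_mk_right a b) (h _ hab b hb)) hc.symm
lemma fU_le (n : ℕ) (U : Finset (V d)) (T : Finset (Sym2 (V d))) : fU n U T ≤ n :=
  (Qj fun j _ => ind_le1 _).trans sy
lemma fU_nn (n : ℕ) (U : Finset (V d)) (T : Finset (Sym2 (V d))) : 0 ≤ fU n U T := Zl fun j _ => ind_nn _
lemma fU_c {n : ℕ} {U : Finset (V d)} {T : Finset (Sym2 (V d))} (hU : U.card ≤ n) (h : U.card = n ∨ cl U (T : Sw (V d)) = U) : fU n U T = U.card := by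
  have h1 : (U.card : ℕ∞) ≤ (cl U (T : Sw (V d))).encard := by
    rw [← Set.encard_coe_eq_coe_finsetCard]; exact ZT fun y hy => ⟨y, hy, .refl⟩
  rw [fU, ← Finset.sum_subset (s₁ := Qm 1 U.card) (Finset.Icc_subset_Icc le_rfl hU) fun j hj hj' => ?_]
  · rw [Qi rfl fun j hj => ind_t (le_trans (by exact_mod_cast (QI.1 hj).2) h1)]; simp
  · simp only [QI, not_and, not_le] at hj hj'
    rcases h with h | h
    · have := hj' hj.1; omega
    · rw [h, Set.encard_coe_eq_coe_finsetCard]; exact ind_f (by exact_mod_cast (hj' hj.1).not_ge)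
lemma cs2 {x y a b a' b' : ℝ} (ha : 0 ≤ a) (hb : 0 ≤ b) (ha' : 0 ≤ a') (hb' : 0 ≤ b') (h : x ^ 2 ≤ a * b) (h' : y ^ 2 ≤ a' * b') : (x + y) ^ 2 ≤ (a + a') * (b + b') := by
  have h1 : (2 * x * y) ^ 2 ≤ (a * b' + a' * b) ^ 2 := by
    nlinarith [mul_le_mul h h' (sq_nonneg _) py, sq_nonneg (a * b' - a' * b)]
  have := abs_le_of_sq_le_sq' h1 py
  nlinarith [this.2]
lemma pr_d (b : ℝ) (e : Sym2 (V d)) : HasDerivAt (fun b => pr J b e) (jw J e * Qc (-b * jw J e)) b := by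
  have := (((hasDerivAt_id b).neg.mul_const (jw J e)).exp).const_sub 1
  refine this.congr_deriv ?_
  simp [mul_comm]
lemma jw_sum (hJ : KernelHyp d J α c C) (E : Finset (Sym2 (V d))) (w : V d) : ∑ e ∈ E with w ∈ e, jw J e ≤ JJ J := by
  classical
  have hs : Summable fun y => J w y := by
    have := (Equiv.subRight w).summable_iff.2 hJ.integrable
    refine this.congr fun y => ?_
    simpa using (hJ.transInv 0 (y - w) w).symm
  have ht : ∑' y, J w y = JJ J := by
    rw [JJ, ← (Equiv.subRight w).tsum_eq (fun x => J 0 x)]; exact tsum_congr fun y => by simpa using hJ.transInv 0 (y - w) w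
  rw [← ht]
  obtain ⟨Y, hY⟩ : ∃ Y : Finset (V d), E.filter (fun e => w ∈ e) ⊆ Y.image (fun y => s(w, y)) := by
    refine ⟨(E.filter (fun e => w ∈ e)).image fun e => if h : w ∈ e then Sym2.Mem.other h else w, fun e he => ?_⟩
    have hw := (Qf.1 he).2
    exact Zm.2 ⟨_, Finset.mem_image_of_mem _ he, by simp [hw]⟩
  refine (Finset.sum_le_sum_of_subset_of_nonneg hY fun e _ _ => jw_nn hJ e).trans ?_
  rw [Finset.sum_image fun a _ b _ h => Sym2.congr_right.1 h]
  refine (Qi rfl fun y _ => jw_mk hJ w y).trans_le (hs.sum_le_tsum _ fun y _ => hJ.nonneg _ _)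
open Classical in
lemma FI (hJ : KernelHyp d J α c C) (hP : IsLRP J P) (hβ : 0 < β) (n : ℕ) : ∀ (m : ℕ) (E : Finset (Sym2 (V d))) (U : Finset (V d)), E.card = m → U.card ≤ n →
    ∃ v' c, HasDerivAt (fun b => ex (pr J b) E (fU n U)) v' β ∧ 0 ≤ c ∧ 0 ≤ ex (pr J β) E (fun T => fU n U T ^ 2) - ex (pr J β) E (fU n U) ^ 2 ∧
      v' ^ 2 ≤ (ex (pr J β) E (fun T => fU n U T ^ 2) - ex (pr J β) E (fU n U) ^ 2) * c ∧
      c ≤ ∑ e ∈ E with (∃ u ∈ U, u ∈ e), jw J e / β + JJ J / β * (ex (pr J β) E (fU n U) - U.card) := by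
  intro m
  induction m with
  | zero =>
    intro E U hE hU
    obtain rfl := Finset.card_eq_zero.1 hE
    have := fU_c hU (T := ∅) (.inr (cl_none sy))
    simp only [ex_empty, this]
    exact ⟨0, 0, hasDerivAt_const _ _, le_rfl, by simp, by simp, by simp⟩
  | succ m ih =>
    intro E U hE hU
    by_cases hc : U.card = n ∨ ∀ e ∈ E, ∀ u ∈ U, u ∉ e
    · have : ∀ T ⊆ E, fU n U T = U.card := fun T hT => fU_c hU (hc.imp id fun h => cl_none fun e he => h e (hT he))
      have h1 : ∀ b, ex (pr J b) E (fU n U) = U.card := fun b => (ex_congr this).trans (ex_const _ _ _)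
      have h2 : ex (pr J β) E (fun T => fU n U T ^ 2) = (U.card : ℝ) ^ 2 := (ex_congr fun T hT => by rw [this T hT]).trans (ex_const _ _ _)
      simp only [h1, h2]
      exact ⟨0, 0, hasDerivAt_const _ _, le_rfl, by simp, by simp, by simpa using Zl fun e _ => div_nonneg (jw_nn hJ e) hβ.le⟩
    push Not at hc
    obtain ⟨hn, e, he, u, hu, hue⟩ := hc
    obtain ⟨w, rfl⟩ := hue
    obtain ⟨E', he', rfl⟩ : ∃ E', s(u, w) ∉ E' ∧ E = insert s(u, w) E' := ⟨E.erase s(u, w), by simp, (Finset.insert_erase he).symm⟩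
    rw [Finset.card_insert_of_notMem he'] at hE
    obtain ⟨A0, c0, d0, n0, s0, q0, b0⟩ := ih E' U oy hU
    obtain ⟨A1, c1, d1, n1, s1, q1, b1⟩ := ih E' (insert w U) oy ((Finset.card_insert_le _ _).trans oy)
    have hf : ∀ T : Finset (Sym2 (V d)), fU n U (insert s(u, w) T) = fU n (insert w U) T := fun T => by
      simp only [fU, Zh, cl_ins hu]
    simp only [ex_insert _ he', hf]
    set v0 := ex (pr J β) E' (fU n U)
    set v1 := ex (pr J β) E' (fU n (insert w U))
    set S0 := ex (pr J β) E' (fun T => fU n U T ^ 2)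
    set S1 := ex (pr J β) E' (fun T => fU n (insert w U) T ^ 2)
    have hp := (bern hJ hP hβ.le).1 s(u, w)
    have hj := jw_nn hJ s(u, w)
    have hpe : Qc (-β * jw J s(u, w)) = 1 - pr J β s(u, w) := by simp [pr]
    have dp := pr_d (J := J) β s(u, w)
    rw [hpe] at dp
    have hκ : jw J s(u, w) * (1 - pr J β s(u, w)) ≤ pr J β s(u, w) / β := by
      rw [le_div_iff₀ hβ, ← hpe]
      have h1 := ZC (β * jw J s(u, w))
      have h2 : Qc (-β * jw J s(u, w)) * Qc (β * jw J s(u, w)) = 1 := by rw [← Za]; simp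
      have h3 := mnl h1 (Qq (-β * jw J s(u, w))).le
      have h4 : pr J β s(u, w) = 1 - Qc (-β * jw J s(u, w)) := rfl
      rw [h4]; linarith
    set p := pr J β s(u, w)
    set j := jw J s(u, w)
    have hq : 0 ≤ 1 - p := by linarith [hp.2]
    have hp0 := hp.1
    have hjb : 0 ≤ j / β := by positivity
    have hS : (1 - p) * S0 + p * S1 - ((1 - p) * v0 + p * v1) ^ 2 = (p * (1 - p) * (v1 - v0) ^ 2) + ((1 - p) * (S0 - v0 ^ 2) + p * (S1 - v1 ^ 2)) := by ring
    have x0 : 0 ≤ p * (1 - p) * (v1 - v0) ^ 2 := by positivity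
    have x1 : 0 ≤ (1 - p) * (S0 - v0 ^ 2) := by positivity
    have x2 : 0 ≤ p * (S1 - v1 ^ 2) := by positivity
    rw [hS]
    refine ⟨j * (1 - p) * (v1 - v0) + ((1 - p) * A0 + p * A1), j / β + ((1 - p) * c0 + p * c1), ?_, by positivity, by positivity, ?_, ?_⟩
    · refine ((dp.const_sub 1 |>.mul d0).add (dp.mul d1)).congr_deriv ?_
      ring
    · refine cs2 x0 hjb py py ?_ (cs2 x1 py x2 py ?_ ?_)
      · have := mnl hκ (show 0 ≤ j * (1 - p) * (v1 - v0) ^ 2 by positivity)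
        calc _ = j * (1 - p) * (v1 - v0) ^ 2 * (j * (1 - p)) := by ring
          _ ≤ _ := this
          _ = _ := by ring
      · nlinarith [mnl q0 (sq_nonneg (1 - p))]
      · nlinarith [mnl q1 (sq_nonneg p)]
    · rw [Finset.filter_insert, if_pos ⟨u, hu, by simp⟩, Finset.sum_insert (by simp [he'])]
      have hb1 : c1 ≤ ∑ e ∈ E' with (∃ u ∈ U, u ∈ e), jw J e / β + JJ J / β * (v1 - U.card) := by
        refine b1.trans ?_
        by_cases hw : w ∈ U
        · rw [Finset.insert_eq_of_mem hw]
        rw [Finset.card_insert_of_notMem hw]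
        have : ∑ e ∈ E' with (∃ u ∈ insert w U, u ∈ e), jw J e / β ≤ ∑ e ∈ E' with (∃ u ∈ U, u ∈ e), jw J e / β + ∑ e ∈ E' with w ∈ e, jw J e / β := by
          rw [QV, QV, QV, ← Finset.sum_add_distrib]
          refine Qj fun e _ => ?_
          have h0 : 0 ≤ jw J e / β := div_nonneg (jw_nn hJ e) hβ.le
          simp only [Finset.exists_mem_insert]
          by_cases h1 : w ∈ e <;> by_cases h2 : ∃ u ∈ U, u ∈ e <;> simp only [h1, h2, or_true, true_or, or_self, if_true, if_false] <;> linarith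
        have h3 := div_le_div_of_nonneg_right (jw_sum hJ E' w) hβ.le
        rw [Finset.sum_div] at h3
        push_cast; linarith
      have := mnl b0 hq
      have := mnl hb1 hp0
      linarith
end P19
section P20
variable {d : ℕ} {J : V d → V d → ℝ} {α c C : ℝ} {P : ℝ → Measure (Config d)} {β δ : ℝ}
lemma gron (hJ : KernelHyp d J α c C) (hP : IsLRP J P) {b0 : ℝ} (hb0 : 0 < b0) (hb : b0 ≤ β) {n : ℕ} (hn : 1 ≤ n) (h0 : 0 ≤ δ) (hδ : √n * δ ≤ 1) (E : Finset (Sym2 (V d))) :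
    ex (pr J (β + δ)) E (fU n {0}) ≤ Qc (√(JJ J / b0)) * ex (pr J β) E (fU n {0}) := by
  classical
  set v := fun t => ex (pr J t) E (fU n ({0} : Finset (V d)))
  set M := √(JJ J / b0) * √n
  have hj := JJ_pos hJ
  have key : ∀ t, b0 ≤ t → ∃ v', HasDerivAt v v' t ∧ v' ≤ M * v t := by
    intro t ht
    have t0 : 0 < t := hb0.trans_le ht
    have hp := (bern hJ hP t0.le).1
    obtain ⟨v', c, h1, h2, h3, h4, h5⟩ := FI hJ hP t0 n E.card E {0} rfl (by simpa using hn)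
    refine ⟨v', h1, abs_le_of_sq_le_sq' (h4.trans ?_) (mul_nonneg py (ex_nn hp fun T _ => fU_nn _ _ _)) |>.2⟩
    have hv : 0 ≤ v t := ex_nn hp fun T _ => fU_nn _ _ _
    have hc : c ≤ JJ J / b0 * v t := by
      have h6 : ∑ e ∈ E with (∃ u ∈ ({0} : Finset (V d)), u ∈ e), jw J e / t ≤ JJ J / t := by
        simp only [Finset.mem_singleton, exists_eq_left]
        rw [← Finset.sum_div]; exact div_le_div_of_nonneg_right (jw_sum hJ E 0) t0.le
      have h7 : c ≤ JJ J / t * v t := by simp only [Finset.card_singleton, Nat.cast_one] at h5; show c ≤ JJ J / t * ex _ _ _; linarith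
      exact h7.trans (mnr (div_le_div_of_nonneg_left hj.le hb0 ht) hv)
    have hs : ex (pr J t) E (fun T => fU n {0} T ^ 2) - ex (pr J t) E (fU n {0}) ^ 2 ≤ n * v t := by
      have : ex (pr J t) E (fun T => fU n {0} T ^ 2) ≤ ex (pr J t) E (fun T => n * fU n {0} T) := ex_mono hp fun T _ => by
        rw [sq]; exact mnr (fU_le _ _ _) (fU_nn _ _ _)
      rw [ex_mul] at this
      have := sq_nonneg (ex (pr J t) E (fU n {0}))
      show _ ≤ n * ex _ _ _
      linarith
    calc _ ≤ (n * v t) * (JJ J / b0 * v t) := mul_le_mul hs hc h2 py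
      _ = (M * v t) ^ 2 := by rw [mul_pow, mul_pow, Zt py, Zt py]; ring
  have hd : ∀ t, b0 ≤ t → ∃ w, HasDerivAt (fun t => v t * Qc (-M * t)) w t ∧ w ≤ 0 := by
    intro t ht
    obtain ⟨v', h1, h2⟩ := key t ht
    have h3 : HasDerivAt (fun t => Qc (-M * t)) (Qc (-M * t) * (-M)) t := by simpa using ((hasDerivAt_id t).const_mul (-M)).exp
    refine ⟨_, h1.mul h3, ?_⟩
    nlinarith [Qq (-M * t)]
  have anti : AntitoneOn (fun t => v t * Qc (-M * t)) (Set.Icc β (β + δ)) := by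
    refine antitoneOn_of_deriv_nonpos (convex_Icc _ _) (fun t ht => ?_) (fun t ht => ?_) fun t ht => ?_
    · obtain ⟨w, h, _⟩ := hd t (hb.trans ht.1); exact h.continuousAt.continuousWithinAt
    · obtain ⟨w, h, _⟩ := hd t (hb.trans (interior_subset ht).1); exact h.differentiableAt.differentiableWithinAt
    · obtain ⟨w, h, h'⟩ := hd t (hb.trans (interior_subset ht).1); rwa [h.deriv]
  have h := anti (Set.left_mem_Icc.2 ly) (Set.right_mem_Icc.2 ly) ly
  simp only at h
  have hv : 0 ≤ v β := ex_nn (bern hJ hP (hb0.le.trans hb)).1 fun T _ => fU_nn _ _ _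
  have e1 : Qc (-M * (β + δ)) * Qc (M * (β + δ)) = 1 := by rw [← Za]; simp
  calc v (β + δ) = v (β + δ) * Qc (-M * (β + δ)) * Qc (M * (β + δ)) := by rw [mul_assoc, e1, mul_one]
    _ ≤ v β * Qc (-M * β) * Qc (M * (β + δ)) := mnr h (Qq _).le
    _ = Qc (M * δ) * v β := by rw [mul_assoc, ← Za, mul_comm]; congr 2; ring
    _ ≤ _ := mnr (QJ.2 (by
      simp only [M]; rw [mul_assoc]; exact mul_le_of_le_one_right (ZP _) hδ)) hv
noncomputable def PK (P : ℝ → Measure (Config d)) (β : ℝ) (j : ℕ) : ℝ≥0∞ := P β {ω | (j : ℕ∞) ≤ (cluster ω 0).encard}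
noncomputable def QQ (P : ℝ → Measure (Config d)) (β : ℝ) (n : ℕ) : ℝ≥0∞ := ∑ j ∈ Qm 1 n, PK P β j
lemma cl_mono {U : Finset (V d)} {T T' : Set (Sym2 (V d))} (h : T ⊆ T') : cl U T ⊆ cl U T' := fun _ ⟨u, hu, hc⟩ => ⟨u, hu, hc.mono h⟩
lemma PK_Dn (j : ℕ) : {ω : Config d | (j : ℕ∞) ≤ (cluster ω 0).encard} = Dn {I : Finset (Sym2 (V d)) | (j : ℕ∞) ≤ (cl {0} (I : Sw (V d))).encard} := by
  classical
  ext ω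
  have hcl : cluster ω 0 = cl {0} (op ω) := by ext y; simp [cl, cluster, cn_conn]
  simp only [Ql, Dn, hcl]
  constructor
  · intro h
    obtain ⟨S, hS, hc⟩ := Set.exists_subset_encard_eq h
    have hf : S.Finite := Set.finite_of_encard_eq_coe hc
    have : ∀ y, ∃ I : Finset (Sym2 (V d)), (I : Sw (V d)) ⊆ op ω ∧ (y ∈ S → cn (I : Sw (V d)) 0 y) := fun y => by
      by_cases hy : y ∈ S
      · obtain ⟨u, hu, h'⟩ := hS hy
        obtain rfl := Finset.mem_singleton.1 hu
        obtain ⟨I, h1, h2⟩ := h'.tr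
        exact ⟨I, h1, fun _ => h2.cn⟩
      · exact ⟨∅, by simp, fun h => absurd h hy⟩
    choose I h1 h2 using this
    refine ⟨hf.toFinset.biUnion I, ?_, fun e he => ?_⟩
    · rw [← hc]
      exact ZT fun y hy => ⟨0, by simp, (h2 y hy).mono fun e he => by
        simp only [Finset.coe_biUnion, Qy]; exact ⟨y, by simpa using hy, he⟩⟩
    · simp only [Finset.coe_biUnion, Qy] at he
      obtain ⟨y, _, he⟩ := he
      exact h1 y he
  · rintro ⟨I, h1, h2⟩
    exact le_trans h1 (ZT (cl_mono h2))
lemma QQ_lim (hJ : KernelHyp d J α c C) (hP : IsLRP J P) (hβ : 0 ≤ β) (n : ℕ) :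
    QX (fun E => oR (ex (pr J β) E (fU n {0}))) Zz (nhds (QQ P β n)) := by
  have hp := (bern hJ hP hβ).1
  have : ∀ E, oR (ex (pr J β) E (fU n {0})) = ∑ j ∈ Qm 1 n, P β {ω | ∃ I ∈ {I : Finset (Sym2 (V d)) | (j : ℕ∞) ≤ (cl {0} (I : Sw (V d))).encard}, I ⊆ E.filter (fun e => ω e = true)} := fun E => by
    have e1 : ex (pr J β) E (fU n {0}) = ∑ j ∈ Qm 1 n, ex (pr J β) E fun T => ind ((j : ℕ∞) ≤ (cl {0} (T : Sw (V d))).encard) := by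
      simp only [ex, fU, Qv]; exact Finset.sum_comm
    rw [e1, Zy fun j _ => ex_nn hp fun T _ => ind_nn _]
    refine Qi rfl fun j _ => ?_
    rw [← (bern hJ hP hβ).fin E fun T => (j : ℕ∞) ≤ (cl {0} (T : Sw (V d))).encard]
    congr 1; ext ω
    exact ⟨fun h => ⟨_, h, subset_rfl⟩, fun ⟨I, h1, h2⟩ => le_trans h1 (ZT (cl_mono (by exact_mod_cast h2)))⟩
  simp only [this, QQ, PK, PK_Dn]
  exact tendsto_finsetSum _ fun j _ => tend_Dn _ _
lemma S9 (hJ : KernelHyp d J α c C) (hP : IsLRP J P) {b0 : ℝ} (hb0 : 0 < b0) (hb : b0 ≤ β) {n : ℕ} (hn : 1 ≤ n) (h0 : 0 ≤ δ) (hδ : √n * δ ≤ 1) :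
    QQ P (β + δ) n ≤ oR (Qc (√(JJ J / b0))) * QQ P β n := by
  refine le_of_tendsto_of_tendsto' (QQ_lim hJ hP ly n) (ENNReal.Tendsto.const_mul (QQ_lim hJ hP ly n) (.inr ENNReal.ofReal_ne_top)) fun E => ?_
  rw [← Qa (Qq _).le]
  exact Qe (gron hJ hP hb0 hb hn h0 hδ E)
lemma meas_PK (j : ℕ) : MeasurableSet {ω : Config d | (j : ℕ∞) ≤ (cluster ω 0).encard} := by rw [PK_Dn]; exact meas_Dn _
lemma PK_anti {j k : ℕ} (h : j ≤ k) : PK P β k ≤ PK P β j := measure_mono fun ω hω => le_trans (show (j : ℕ∞) ≤ k by exact_mod_cast h) (show (k : ℕ∞) ≤ (cluster ω 0).encard from hω)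
open Classical in
lemma QQ_ch (n : ℕ) : QQ P β n ≤ ch P β := by
  calc QQ P β n = ∑ j ∈ Qm 1 n, ∫⁻ ω, {ω | (j : ℕ∞) ≤ (cluster ω 0).encard}.indicator 1 ω ∂P β := Qi rfl fun j _ => by rw [lintegral_indicator_one (meas_PK j)]; rfl
    _ = ∫⁻ ω, ∑ j ∈ Qm 1 n, {ω | (j : ℕ∞) ≤ (cluster ω 0).encard}.indicator 1 ω ∂P β := (lintegral_finsetSum _ fun j _ => measurable_one.indicator (meas_PK j)).symm
    _ ≤ ∫⁻ ω, ∑' x, {ω | cn (op ω) 0 x}.indicator 1 ω ∂P β := lintegral_mono fun ω => ?_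
    _ = ∑' x, ∫⁻ ω, {ω | cn (op ω) 0 x}.indicator 1 ω ∂P β := lintegral_tsum fun x => (measurable_one.indicator (meas_conn 0 x)).aemeasurable
    _ = _ := tsum_congr fun x => by rw [lintegral_indicator_one (meas_conn 0 x)]; simp [tau]
  set F := (Qm 1 n).filter fun j : ℕ => (j : ℕ∞) ≤ (cluster ω 0).encard
  have e1 : ∑ j ∈ Qm 1 n, {ω : Config d | (j : ℕ∞) ≤ (cluster ω 0).encard}.indicator (1 : Config d → ℝ≥0∞) ω = F.card := by
    simp only [F, Finset.card_filter, Zp, Ql, Pi.one_apply]; push_cast; rfl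
  simp only [e1]
  have e2 : (F.card : ℕ∞) ≤ (cluster ω 0).encard := by
    rcases F.eq_empty_or_nonempty with h | h
    · simp [h]
    · refine le_trans ?_ (Qf.1 (F.max'_mem h)).2
      have : F ⊆ Qm 1 (F.max' h) := fun j hj => QI.2 ⟨(QI.1 (Qf.1 hj).1).1, F.le_max' j hj⟩
      have := QB this
      simp at this; exact_mod_cast this
  obtain ⟨S, hS, hc⟩ := Set.exists_subset_encard_eq e2
  have hf : S.Finite := Set.finite_of_encard_eq_coe hc
  refine le_trans ?_ (ENNReal.sum_le_tsum hf.toFinset)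
  rw [Qi rfl fun x hx => QC (show ω ∈ {ω | cn (op ω) 0 x} from cn_conn.2 (hS (by simpa using hx))) _]
  rw [hf.encard_eq_coe_toFinset_card] at hc
  have : hf.toFinset.card = F.card := by exact_mod_cast hc
  simp [this]
end P20
section P21
variable {d : ℕ} {J : V d → V d → ℝ} {α c C : ℝ} {P : ℝ → Measure (Config d)} {β δ : ℝ}
lemma log_half {n : ℕ} (hn : 2 ≤ n) : 1 / 2 ≤ Qb n := by
  have h1 := Real.log_two_gt_d9
  have : Qb 2 ≤ Qb n := ZR ny (by exact_mod_cast hn)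
  linarith
lemma fin_real {A c0 : ℝ} (hA : 0 < A) (hc : 0 < c0) (p : ℕ → ℝ) (hp0 : ∀ n, 0 ≤ p n) (hp : ∀ j k, j ≤ k → p k ≤ p j)
    (hl : ∀ n : ℕ, 1 ≤ n → c0 * √n ≤ ∑ j ∈ Qm 1 n, p j) (hu : ∀ n : ℕ, 2 ≤ n → ∑ j ∈ Qm 1 n, p j ≤ A * √n * Qb n ^ 2) :
    ∃ C₁ : ℝ, 0 < C₁ ∧ ∀ n : ℕ, 2 ≤ n → C₁⁻¹ * (Qb n ^ 2)⁻¹ * (n : ℝ) ^ (-(1/2) : ℝ) ≤ p n ∧ p n ≤ C₁ * Qb n ^ 2 * (n : ℝ) ^ (-(1/2) : ℝ) := by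
  set A' := (2 * A / c0) ^ 2 with hA'
  have hA'0 : 0 < A' := by positivity
  set D := 2 * √(A' + 16) / c0
  have hD : 0 < D := by have : 0 < √(A' + 16) := QU.2 ly
                        positivity
  refine ⟨max A D, lt_max_of_lt_left hA, fun n hn => ?_⟩
  have hL := log_half hn
  set L := Qb n
  have hL0 : 0 < L := by linarith
  have hn0 : (0 : ℝ) < n := by positivity
  have hs : (0 : ℝ) < √n := QU.2 hn0
  have hss : √(n : ℝ) * √n = n := ZS hn0.le
  have hr : (n : ℝ) ^ (-(1/2) : ℝ) = (√n)⁻¹ := by rw [Qu hn0.le, Real.sqrt_eq_rpow]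
  rw [hr]
  constructor
  · set k := ⌈A' * L ^ 4⌉₊
    have hk1 : A' * L ^ 4 ≤ k := Nat.le_ceil _
    have hk2 : (k : ℝ) < A' * L ^ 4 + 1 := Nat.ceil_lt_add_one py
    have hk0 : 0 < k := Nat.ceil_pos.2 py
    have hk0' : (0 : ℝ) < k := by exact_mod_cast hk0
    have hL4 : 1 ≤ 16 * L ^ 4 := by nlinarith [sq_nonneg (L ^ 2), mul_self_le_mul_self (by norm_num : (0:ℝ) ≤ 1/2) hL, mul_self_le_mul_self (by norm_num : (0:ℝ) ≤ 1/4) (show 1/4 ≤ L^2 by nlinarith)]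
    have hk3 : √(k : ℝ) ≤ √(A' + 16) * L ^ 2 := by
      rw [Real.sqrt_le_left py, mul_pow, Zt py]
      nlinarith
    have hk4 : 2 * A / c0 * L ^ 2 ≤ √k := by
      apply Real.le_sqrt_of_sq_le
      calc _ = A' * L ^ 4 := by rw [hA']; ring
        _ ≤ _ := hk1
    have hks : (0 : ℝ) < √k := QU.2 hk0'
    have hkk : √(k : ℝ) * √k = k := ZS hk0'.le
    have hN := hl (n * k) (ZL oy hk0)
    have hsum : ∑ j ∈ Qm 1 (n * k), p j ≤ ∑ j ∈ Qm 1 n, p j + (n * k) * p n := by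
      have hle : n ≤ n * k := Nat.le_mul_of_pos_right n hk0
      have e : ∑ j ∈ Qm 1 (n * k), p j = ∑ j ∈ Qm 1 n, p j + ∑ j ∈ Finset.Ioc n (n * k), p j := by
        rw [← Finset.sum_union]
        · congr 1; ext j; simp only [QI, Zg, Finset.mem_Ioc]; omega
        · rw [Zf]; intro j; simp only [QI, Finset.mem_Ioc]; omega
      rw [e]
      refine add_le_add le_rfl ((QR _ _ (p n) fun j hj => hp _ _ (Finset.mem_Ioc.1 hj).1.le).trans ?_)
      rw [nsmul_eq_mul, Nat.card_Ioc]
      refine mnr ?_ (hp0 n)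
      have : n * k - n ≤ n * k := Nat.sub_le _ _
      exact_mod_cast this
    have hun := hu n hn
    push_cast at hN
    rw [Real.sqrt_mul hn0.le] at hN
    have h5 : A * √n * L ^ 2 ≤ c0 * (√n * √k) / 2 := by
      have : 2 * A * L ^ 2 ≤ c0 * √k := by
        calc 2 * A * L ^ 2 = c0 * (2 * A / c0 * L ^ 2) := by field_simp
          _ ≤ _ := mnl hk4 hc.le
      nlinarith
    have h6 : c0 * (√n * √k) / 2 ≤ n * k * p n := by linarith
    have h7 : c0 / 2 ≤ √n * √k * p n := by
      have : (√n * √k) * (c0 / 2) ≤ (√n * √k) * (√n * √k * p n) := by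
        calc _ = c0 * (√n * √k) / 2 := by ring
          _ ≤ _ := h6
          _ = (√n * √n) * (√k * √k) * p n := by rw [hss, hkk]
          _ = _ := by ring
      exact le_of_mul_le_mul_left this py
    have h8 : c0 / 2 ≤ √n * (√(A' + 16) * L ^ 2) * p n := h7.trans (mnr (mnl hk3 hs.le) (hp0 n))
    have h9 : 1 ≤ D * L ^ 2 * √n * p n := by
      calc 1 = (c0 / 2) * (2 / c0) := by field_simp
        _ ≤ √n * (√(A' + 16) * L ^ 2) * p n * (2 / c0) := mnr h8 py
        _ = _ := by simp only [D]; field_simp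
    calc (max A D)⁻¹ * (L ^ 2)⁻¹ * (√n)⁻¹ ≤ D⁻¹ * (L ^ 2)⁻¹ * (√n)⁻¹ := by gcongr; exact le_max_right _ _
      _ = (D * L ^ 2 * √n)⁻¹ * 1 := by rw [mul_inv, mul_inv, mul_one]
      _ ≤ (D * L ^ 2 * √n)⁻¹ * (D * L ^ 2 * √n * p n) := mnl h9 py
      _ = p n := by field_simp
  · have h1 : n * p n ≤ ∑ j ∈ Qm 1 n, p j := by
      have := Zo (Qm 1 n) p (p n) fun j hj => hp _ _ (QI.1 hj).2
      simpa using this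
    have h2 := h1.trans (hu n hn)
    have h3 : √n * p n ≤ A * L ^ 2 := by
      refine le_of_mul_le_mul_left (a := √n) ?_ hs
      calc _ = √n * √n * p n := by ring
        _ = n * p n := by rw [hss]
        _ ≤ _ := h2
        _ = _ := by ring
    calc p n = √n * p n * (√n)⁻¹ := by field_simp
      _ ≤ A * L ^ 2 * (√n)⁻¹ := by gcongr
      _ ≤ _ := by gcongr; exact le_max_left _ _
lemma QQ_up (hJ : KernelHyp d J α c C) (hP : IsLRP J P) (h1 : α < 1) (hα : α = (d : ℝ) / 3) : ∃ A : ℝ, 0 < A ∧ ∀ n : ℕ, 2 ≤ n → QQ P (betaC P) n ≤ oR (A * √n * Qb n ^ 2) := by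
  obtain ⟨hb, C8, hC8, h8⟩ := S8 hJ hP h1 hα
  set η := min (betaC P / 2) 1
  have hη : 0 < η := lt_min ly one_pos
  have hη1 : η ≤ 1 := min_le_right _ _
  have hη2 : η ≤ betaC P / 2 := min_le_left _ _
  set M9 := Qc (√(JJ J / (betaC P / 2)))
  have hM : 0 < M9 := Qq _
  have hlη : 0 ≤ Qb η⁻¹ := Qz ((one_le_inv₀ hη).2 hη1)
  set B := 2 * (1 + Qb η⁻¹) + 1
  have hB : 0 < B := by positivity
  refine ⟨M9 * C8 * η⁻¹ * B ^ 2, by positivity, fun n hn => ?_⟩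
  have hL := log_half hn
  have hn0 : (0 : ℝ) < n := by positivity
  have hs : (0 : ℝ) < √n := QU.2 hn0
  have hs1 : (1 : ℝ) ≤ √n := Real.one_le_sqrt.2 (by exact_mod_cast (by omega : 1 ≤ n))
  set ε := η / √n
  have hε : 0 < ε := by positivity
  have hεη : ε ≤ η := div_le_self hη.le hs1
  have h9 := S9 (n := n) (δ := ε) (β := betaC P - ε) hJ hP (half_pos hb) ly oy hε.le (by simp only [ε]; rw [mul_div_cancel₀ _ hs.ne']; exact hη1)
  rw [_root_.sub_add_cancel] at h9
  refine (h9.trans (mul_le_mul_right ((QQ_ch n).trans (h8 ε hε (hεη.trans hη1) (hεη.trans hη2))) _)).trans ?_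
  rw [← Qa hM.le]
  apply Qe
  have e : ε⁻¹ = η⁻¹ * √n := by simp only [ε]; rw [inv_div, div_eq_mul_inv, mul_comm]
  have e2 : Qb ε⁻¹ = Qb η⁻¹ + Qb n / 2 := by
    rw [e, Real.log_mul py py, Real.log_sqrt hn0.le]
  have h3 : 1 + Qb ε⁻¹ ≤ B * Qb n := by
    rw [e2]; simp only [B]; nlinarith
  have h4 : 0 ≤ 1 + Qb ε⁻¹ := by rw [e2]; linarith
  calc M9 * (C8 * ε⁻¹ * (1 + Qb ε⁻¹) ^ 2) ≤ M9 * (C8 * ε⁻¹ * (B * Qb n) ^ 2) := by gcongr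
    _ = _ := by rw [e]; ring
lemma QQ_lo (hJ : KernelHyp d J α c C) (hP : IsLRP J P) (h1 : α < 1) (hα : α = (d : ℝ) / 3) : ∃ c0 : ℝ, 0 < c0 ∧ ∀ n : ℕ, 1 ≤ n → oR (c0 * √n) ≤ QQ P (betaC P) n := by
  obtain ⟨hb, -⟩ := S8 hJ hP h1 hα
  set M9 := Qc (√(JJ J / betaC P))
  have hM : 0 < M9 := Qq _
  set m := min (1 / 2) (1 / (4 * (betaC P + 1)))
  have hm : 0 < m := lt_min ny py
  refine ⟨M9⁻¹ * m, by positivity, fun n hn => ?_⟩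
  have hn0 : (0 : ℝ) < n := by exact_mod_cast hn
  have hs : (0 : ℝ) < √n := QU.2 hn0
  have hs1 : (1 : ℝ) ≤ √n := Real.one_le_sqrt.2 (by exact_mod_cast hn)
  have hi : (√(n : ℝ))⁻¹ ≤ 1 := inv_le_one_of_one_le₀ hs1
  have hi0 : 0 < (√(n : ℝ))⁻¹ := by positivity
  have h9 := S9 (n := n) (δ := (√(n : ℝ))⁻¹) (β := betaC P) hJ hP hb le_rfl hn hi0.le (by rw [mul_inv_cancel₀ hs.ne'])
  have ht := theta_bc hJ hP (hex_ hJ hP hα) hi0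
  have h2 : oR (m * √n) ≤ QQ P (betaC P + (√(n : ℝ))⁻¹) n := by
    have h3 : m * (√(n : ℝ))⁻¹ ≤ min (1/2) ((√(n : ℝ))⁻¹ / (4 * (betaC P + (√(n : ℝ))⁻¹))) := by
      apply le_min
      · exact (mul_le_of_le_one_right hm.le hi).trans (min_le_left _ _)
      · calc m * (√(n : ℝ))⁻¹ ≤ 1 / (4 * (betaC P + 1)) * (√(n : ℝ))⁻¹ := by gcongr; exact min_le_right _ _
          _ ≤ 1 / (4 * (betaC P + (√(n : ℝ))⁻¹)) * (√(n : ℝ))⁻¹ := by gcongr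
          _ = _ := by ring
    have h4 : ∀ j ∈ Qm 1 n, oR (m * (√(n : ℝ))⁻¹) ≤ PK P (betaC P + (√(n : ℝ))⁻¹) j := fun j _ =>
      (Qe h3).trans (ht.trans (measure_mono fun ω hω => by
        show (j : ℕ∞) ≤ (cluster ω 0).encard
        rw [Set.Infinite.encard_eq hω]; exact le_top))
    have h5 := Zo _ _ _ h4
    rw [Nat.card_Icc, nsmul_eq_mul, Nat.add_sub_cancel, ← Qw, ← Qa hn0.le] at h5
    refine le_trans (le_of_eq ?_) h5
    congr 1
    have : √(n : ℝ) * √n = n := ZS hn0.le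
    calc m * √n = √n * √n * (m * (√(n : ℝ))⁻¹) := by field_simp
      _ = _ := by rw [this]
  calc oR (M9⁻¹ * m * √n) = oR M9⁻¹ * oR (m * √n) := by rw [← Qa py, mul_assoc]
    _ ≤ oR M9⁻¹ * (oR M9 * QQ P (betaC P) n) := mul_le_mul_right (h2.trans h9) _
    _ = _ := by rw [← mul_assoc, ← Qa py, inv_mul_cancel₀ hM.ne', QP, one_mul]
end P21
theorem cluster_tail_polylog {d : ℕ} {J : V d → V d → ℝ} {α c C : ℝ}
    (hJ : KernelHyp d J α c C)
    (P : ℝ → Measure (Config d)) (hP : IsLRP J P)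
    (hd : d = 1 ∨ d = 2) (hα : α = (d : ℝ) / 3) :
    ∃ C₁ : ℝ, 0 < C₁ ∧ ∀ n : ℕ, 2 ≤ n →
      ENNReal.ofReal (C₁⁻¹ * (Real.log n ^ 2)⁻¹ * (n : ℝ) ^ (-(1/2) : ℝ)) ≤
        P (betaC P) {ω | (n : ℕ∞) ≤ (cluster ω 0).encard} ∧
      P (betaC P) {ω | (n : ℕ∞) ≤ (cluster ω 0).encard} ≤
        ENNReal.ofReal (C₁ * Real.log n ^ 2 * (n : ℝ) ^ (-(1/2) : ℝ)) := by
  have h1 : α < 1 := by rcases hd with rfl | rfl <;> norm_num [hα]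
  obtain ⟨A, hA, hu⟩ := QQ_up hJ hP h1 hα
  obtain ⟨c0, hc, hl⟩ := QQ_lo hJ hP h1 hα
  have hb := (S8 hJ hP h1 hα).1
  have := (bern hJ hP hb.le).prob
  have ft : ∀ n, PK P (betaC P) n ≠ ∞ := fun n => measure_ne_top _ _
  have e : ∀ n, QQ P (betaC P) n = oR (∑ j ∈ Qm 1 n, (PK P (betaC P) j).toReal) := fun n => by
    rw [Zy fun _ _ => QK]
    exact Qi rfl fun j _ => (QA (ft j)).symm
  obtain ⟨C₁, h0, h⟩ := fin_real hA hc (fun n => (PK P (betaC P) n).toReal) (fun _ => QK) (fun j k hjk => QS (ft j) (PK_anti hjk))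
    (fun n hn => by
      have := hl n hn
      rw [e] at this
      exact (Zn (Zl fun _ _ => QK)).1 this)
    (fun n hn => by
      have := hu n hn
      rw [e] at this
      exact (Zn py).1 this)
  refine ⟨C₁, h0, fun n hn => ⟨?_, ?_⟩⟩
  · exact (ENNReal.ofReal_le_iff_le_toReal (ft n)).2 (h n hn).1
  · exact (QA (ft n)).symm.le.trans (Qe (h n hn).2)

end LRP
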